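/- arXiv:math/9605218 — 2 statements merged into one kernel-verified Lean document; each statement's English description precedes it below -/
import Mathlib

section
/- There exists an absolute constant c > 0 such that: if K is a symmetric convex body in ℝ^n, E is the ellipsoid of maximal volume contained in K, and F is an m-dimensional subspace of ℝ^n, then (|K ∩ F| / |E ∩ F|)^{1/m} ≤ c · h(√(n/m) · C_K), where h(y) = y log(2y) for y ≥ 1. -/
open MeasureTheory Metric Set
open scoped Pointwise

noncomputable section


/-- An ellipsoid in `ℝ^n`: the image of the Euclidean unit ball under an
invertible linear map. -/
def IsEllipsoid {n : ℕ} (E : Set (EuclideanSpace ℝ (Fin n))) : Prop :=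
  ∃ T : EuclideanSpace ℝ (Fin n) ≃ₗ[ℝ] EuclideanSpace ℝ (Fin n),
    E = T '' closedBall 0 1

/-- A symmetric convex body in `ℝ^n`: compact, convex, with nonempty interior
and symmetric about the origin. -/
def IsSymmetricConvexBody {n : ℕ} (K : Set (EuclideanSpace ℝ (Fin n))) : Prop :=
  Convex ℝ K ∧ IsCompact K ∧ (interior K).Nonempty ∧ K = -K

/-- `E` is the maximal volume ellipsoid contained in `K`. -/
def IsMaxVolEllipsoidIn {n : ℕ} (E K : Set (EuclideanSpace ℝ (Fin n))) : Prop :=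
  IsEllipsoid E ∧ E ⊆ K ∧
    ∀ E' : Set (EuclideanSpace ℝ (Fin n)), IsEllipsoid E' → E' ⊆ K →
      volume E' ≤ volume E

/-- The cotype-2 constant `C_K` of `X_K = (ℝ^n, ‖·‖_K)`: the smallest `λ > 0` such that
`(Ave_{ε_j = ±1} ‖Σ ε_j x_j‖_K^2)^{1/2} ≥ (1/λ) (Σ ‖x_j‖_K^2)^{1/2}` for all finite
families `x_1, …, x_m` in `ℝ^n`. -/
def cotype2Const {n : ℕ} (K : Set (EuclideanSpace ℝ (Fin n))) : ℝ :=
  sInf {l : ℝ | 0 < l ∧ ∀ (m : ℕ) (x : Fin m → EuclideanSpace ℝ (Fin n)),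
    (1 / l) * Real.sqrt (∑ j, gauge K (x j) ^ 2) ≤
      Real.sqrt ((∑ ε : Fin m → Bool,
        gauge K (∑ j, (if ε j then (1 : ℝ) else -1) • x j) ^ 2) / 2 ^ m)}

/-- The function `h(y) = y log (2y)`. -/
def hfun (y : ℝ) : ℝ := y * Real.log (2 * y)


lemma cheb_nodes (n : ℕ) (hn : Odd n) : ∃ a x : ℕ → ℝ, (∀ i, |x i| ≤ 1) ∧
    (∀ k ≤ n, ∑ i ∈ Finset.range (n+1), a i * x i ^ k = if k = 1 then 1 else 0) ∧
    ∑ i ∈ Finset.range (n+1), |a i| ≤ n := by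
  classical
  set x : ℕ → ℝ := Polynomial.Chebyshev.node n with hx
  have hn0 : n ≠ 0 := by rintro rfl; simp at hn
  have hinj : Set.InjOn x (Finset.range (n+1)) :=
    (Polynomial.Chebyshev.strictAntiOn_node n).injOn
  have hsym : ∀ i ≤ n, x (n - i) = - x i := by
    intro i hi
    simp only [hx, Polynomial.Chebyshev.node]
    rw [← Real.cos_pi_sub]
    congr 1
    rw [Nat.cast_sub hi]
    have : (n:ℝ) ≠ 0 := by exact_mod_cast hn0
    field_simp
  have hne : ∀ i ≤ n, x i ≠ 0 := by
    intro i hi h0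
    have h1 := hsym i hi
    rw [h0, neg_zero, ← h0] at h1
    have := hinj (by simp) (by simp; omega) h1
    obtain ⟨r, hr⟩ := hn
    omega
  set w : ℕ → ℝ := fun i => ∏ j ∈ (Finset.range (n + 1)).erase i, (x i - x j) with hw
  have hwpos : ∀ i ≤ n, 0 < (-1) ^ i * w i := fun i hi =>
    Polynomial.Chebyshev.zero_lt_prod_node_sub_node hi
  have hcoeff : ∀ P : Polynomial ℝ, P.degree ≤ n →
      ∑ i ∈ Finset.range (n+1), P.eval (x i) / w i = P.coeff n := by
    intro P hP
    have h1 : P.degree < (Finset.range (n + 1)).card := by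
      rw [Finset.card_range]
      grw [hP]
      norm_cast
      simp
    have := Lagrange.coeff_eq_sum hinj h1
    simp only [Finset.card_range, Nat.add_sub_cancel] at this
    rw [this]
  set om : ℝ := ∏ j ∈ Finset.range (n+1), (- x j) with hom
  have homne : om ≠ 0 := by
    rw [hom, Finset.prod_ne_zero_iff]
    intro j hj
    exact neg_ne_zero.mpr (hne j (by simpa [Nat.lt_succ_iff] using hj))
  set a : ℕ → ℝ := fun i => - om / (x i ^2 * w i) with ha
  have hwsym : ∀ i ≤ n, w (n - i) = - w i := by
    intro i hi
    simp only [hw]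
    have h1 : ∏ j ∈ (Finset.range (n + 1)).erase (n - i), (x (n - i) - x j)
        = ∏ j ∈ (Finset.range (n + 1)).erase i, (- (x i - x j)) := by
      refine Finset.prod_bij' (fun j _ => n - j) (fun j _ => n - j) ?_ ?_ ?_ ?_ ?_
      · intro j hj; simp at hj ⊢; omega
      · intro j hj; simp at hj ⊢; omega
      · intro j hj; simp at hj ⊢; omega
      · intro j hj; simp at hj ⊢; omega
      · intro j hj
        simp at hj
        rw [hsym i hi, hsym j (by omega)]; ring
    rw [h1, Finset.prod_neg]
    have : ((Finset.range (n + 1)).erase i).card = n := by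
      rw [Finset.card_erase_of_mem (by simp; omega)]; simp
    rw [this, hn.neg_one_pow]; ring
  have hex : ∀ k ≤ n, ∑ i ∈ Finset.range (n+1), a i * x i ^ k = if k = 1 then 1 else 0 := by
    intro k hk
    have hwne : ∀ i ≤ n, w i ≠ 0 := by
      intro i hi h0; have := hwpos i hi; simp [h0] at this
    rcases Nat.lt_or_ge k 2 with h2 | h2
    · interval_cases k
      · -- k = 0
        simp only [pow_zero, mul_one]
        have : ∑ i ∈ Finset.range (n+1), a i = ∑ i ∈ Finset.range (n+1), - a i := by
          rw [← Finset.sum_range_reflect]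
          apply Finset.sum_congr rfl
          intro i hi
          have hi' : i ≤ n := by simpa [Nat.lt_succ_iff] using hi
          simp only [ha, Nat.add_sub_cancel]
          rw [hwsym i hi', hsym i hi']
          have := hwne i hi'
          have := hne i hi'
          field_simp
        rw [Finset.sum_neg_distrib] at this
        simp; linarith
      · simp only [if_true, pow_one]
        -- polynomial (ω - ω 0)/x
        set W : Polynomial ℝ := ∏ j ∈ Finset.range (n+1), (Polynomial.X - Polynomial.C (x j)) with hW
        have hWm : W.Monic := Polynomial.monic_prod_of_monic _ _ fun j _ => Polynomial.monic_X_sub_C _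
        have hWd : W.natDegree = n + 1 := by
          rw [hW, Polynomial.natDegree_prod_of_monic _ _ fun j _ => Polynomial.monic_X_sub_C _]
          simp
        have hd := hcoeff W.divX (by
          apply Polynomial.degree_le_of_natDegree_le
          rw [Polynomial.natDegree_divX_eq_natDegree_tsub_one, hWd]; simp)
        rw [Polynomial.coeff_divX, ← hWd, Polynomial.Monic.coeff_natDegree hWm] at hd
        rw [← hd, hWd]
        apply Finset.sum_congr rfl
        intro i hi
        have hi' : i ≤ n := by simpa [Nat.lt_succ_iff] using hi
        have h3 : W.eval (x i) = 0 := by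
          rw [hW, Polynomial.eval_prod]
          exact Finset.prod_eq_zero hi (by simp)
        have h4 := congrArg (Polynomial.eval (x i)) (Polynomial.divX_mul_X_add W)
        rw [h3] at h4
        simp only [Polynomial.eval_add, Polynomial.eval_mul, Polynomial.eval_X, Polynomial.eval_C] at h4
        have h5 : W.coeff 0 = om := by
          rw [Polynomial.coeff_zero_eq_eval_zero, hW, Polynomial.eval_prod]; simp [hom]
        rw [h5] at h4
        have := hwne i hi'
        have := hne i hi'
        simp only [ha]
        field_simp
        linarith
    · have h1 := hcoeff (Polynomial.X ^ (k-2)) (by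
        rw [Polynomial.degree_X_pow]; exact_mod_cast (by omega : k - 2 ≤ n))
      rw [Polynomial.coeff_X_pow, if_neg (by omega)] at h1
      rw [if_neg (by omega)]
      calc _ = ∑ i ∈ Finset.range (n+1), (-om) * (Polynomial.eval (x i) (Polynomial.X ^ (k-2)) / w i) := by
            apply Finset.sum_congr rfl
            intro i hi
            have hi' : i ≤ n := by simpa [Nat.lt_succ_iff] using hi
            have := hwne i hi'
            have := hne i hi'
            simp only [ha, Polynomial.eval_pow, Polynomial.eval_X]
            obtain ⟨l, rfl⟩ := Nat.exists_eq_add_of_le h2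
            rw [Nat.add_sub_cancel_left, pow_add]
            field_simp
        _ = 0 := by rw [← Finset.mul_sum, h1, mul_zero]
  refine ⟨a, x, ?_, hex, ?_⟩
  · intro i
    rw [abs_le]
    exact Set.mem_Icc.mp (Polynomial.Chebyshev.node_mem_Icc (n := n) (i := i))
  · have hpoly : ∀ P : Polynomial ℝ, P.natDegree ≤ n →
        ∑ i ∈ Finset.range (n+1), a i * P.eval (x i) = P.coeff 1 := by
      intro P hP
      have : ∀ i, P.eval (x i) = ∑ k ∈ Finset.range (n+1), P.coeff k * x i ^ k := fun i =>
        Polynomial.eval_eq_sum_range' (by omega) _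
      simp_rw [this, Finset.mul_sum]
      rw [Finset.sum_comm]
      have : ∀ k ∈ Finset.range (n+1), ∑ i ∈ Finset.range (n+1), a i * (P.coeff k * x i ^ k)
          = P.coeff k * (if k = 1 then 1 else 0) := by
        intro k hk
        rw [← hex k (by simpa [Nat.lt_succ_iff] using hk), Finset.mul_sum]
        apply Finset.sum_congr rfl; intros; ring
      rw [Finset.sum_congr rfl this]
      simp
      omega
    have hT := hpoly (Polynomial.Chebyshev.T ℝ n) (by simp)
    have habs : ∑ i ∈ Finset.range (n+1), |a i| = |∑ i ∈ Finset.range (n+1), a i * (Polynomial.Chebyshev.T ℝ n).eval (x i)| := by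
      have h1 : ∀ i ∈ Finset.range (n+1), a i * (Polynomial.Chebyshev.T ℝ n).eval (x i) = - om * (((x i)^2)⁻¹ * ((-1)^i * w i)⁻¹) := by
        intro i hi
        rw [Polynomial.Chebyshev.eval_T_real_node (by simpa [Nat.lt_succ_iff] using hi)]
        simp only [ha]
        have hsg : (((-1:ℝ) ^ i))⁻¹ = (-1)^i := by rw [← inv_pow, inv_neg_one]
        rw [mul_inv ((-1:ℝ)^i), hsg, div_eq_mul_inv, mul_inv]; ring
      have hnn : 0 ≤ ∑ i ∈ Finset.range (n+1), (((x i)^2)⁻¹ * ((-1)^i * w i)⁻¹) := by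
        apply Finset.sum_nonneg
        intro i hi
        have h3 := hwpos i (by simpa [Nat.lt_succ_iff] using hi)
        positivity
      rw [Finset.sum_congr rfl h1, ← Finset.mul_sum, abs_mul, abs_of_nonneg hnn, Finset.mul_sum]
      · apply Finset.sum_congr rfl
        intro i hi
        have hi' : i ≤ n := by simpa [Nat.lt_succ_iff] using hi
        have h3 := hwpos i hi'
        have h2 := h1 i hi
        rw [Polynomial.Chebyshev.eval_T_real_node (by simpa [Nat.lt_succ_iff] using hi)] at h2
        have h4 : |a i| = |a i * (-1)^i| := by rw [abs_mul, abs_neg_one_pow, mul_one]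
        rw [h4, h2, abs_mul, abs_of_nonneg (a := ((x i)^2)⁻¹ * ((-1)^i * w i)⁻¹)]
        positivity
    rw [habs, hT]
    have h1 : (Polynomial.Chebyshev.T ℝ n).coeff 1 = (Polynomial.derivative (Polynomial.Chebyshev.T ℝ n)).eval 0 := by
      rw [← Polynomial.coeff_zero_eq_eval_zero, Polynomial.coeff_derivative]; simp
    rw [h1, Polynomial.Chebyshev.T_derivative_eq_U]
    have h2 := Polynomial.Chebyshev.U_real_cos (Real.pi/2) (n-1 : ℤ)
    rw [Real.cos_pi_div_two, Real.sin_pi_div_two, mul_one] at h2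
    simp only [Polynomial.eval_mul, Polynomial.eval_intCast, h2]
    rw [abs_mul]
    have := Real.abs_sin_le_one ((((n - 1 : ℤ):ℝ) + 1) * (Real.pi / 2))
    calc _ ≤ |((n:ℤ):ℝ)| * 1 := by gcongr
      _ = n := by simp

lemma exists_moments : ∃ c : ℝ, 0 < c ∧ ∀ t : ℝ, 2 ≤ t → ∃ (M : ℕ) (a x : ℕ → ℝ),
    (∀ i, |x i| ≤ 1) ∧ (∑ i ∈ Finset.range M, a i * x i = 1) ∧
    (∀ k, k ≠ 1 → |∑ i ∈ Finset.range M, a i * x i ^ k| ≤ 1 / t) ∧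
    ∑ i ∈ Finset.range M, |a i| ≤ c * Real.log t := by
  have hl2 : 0 < Real.log 2 := Real.log_pos (by norm_num)
  refine ⟨26 / Real.log 2, by positivity, fun t ht => ?_⟩
  set L := Nat.ceil (Real.log t / Real.log 2) with hL
  set n := 4 * L + 5 with hn
  obtain ⟨a, x, hx, hex, hTV⟩ := cheb_nodes n ⟨2 * L + 2, by omega⟩
  have hlog : 1 ≤ Real.log t / Real.log 2 := by
    rw [le_div_iff₀ hl2, one_mul]; exact Real.log_le_log (by norm_num) ht
  have hLle : (L:ℝ) ≤ Real.log t / Real.log 2 + 1 := (Nat.ceil_lt_add_one (by linarith)).le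
  have htL : t ≤ 2 ^ L := by
    have := Nat.le_ceil (Real.log t / Real.log 2)
    rw [div_le_iff₀ hl2, ← Real.log_pow] at this
    exact (Real.log_le_log_iff (by linarith) (by positivity)).mp this
  have hmom : ∀ k, ∑ i ∈ Finset.range (n+1), (2 * a i) * (x i / 2) ^ k = (2 / 2^k) * ∑ i ∈ Finset.range (n+1), a i * x i ^ k := by
    intro k
    rw [Finset.mul_sum]
    apply Finset.sum_congr rfl; intro i _
    rw [div_pow]; ring
  refine ⟨n+1, fun i => 2 * a i, fun i => x i / 2, ?_, ?_, ?_, ?_⟩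
  · intro i; rw [abs_div]; have := hx i; norm_num; linarith
  · have := hmom 1
    rw [hex 1 (by omega)] at this
    simpa using this
  · intro k hk
    rw [hmom]
    rcases Nat.lt_or_ge n k with h | h
    · rw [abs_mul]
      have h1 : |∑ i ∈ Finset.range (n+1), a i * x i ^ k| ≤ n := by
        refine (Finset.abs_sum_le_sum_abs _ _).trans (le_trans (Finset.sum_le_sum fun i _ => ?_) hTV)
        rw [abs_mul, abs_pow]
        exact mul_le_of_le_one_right (abs_nonneg _) (pow_le_one₀ (abs_nonneg _) (hx i))
      have h2 : (2:ℝ)^(n+1) ≤ 2^k := pow_le_pow_right₀ (by norm_num) h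
      have h3 : (n:ℝ) * t ≤ 2 ^ n := by
        have h4 : (4*L + 5 : ℕ) ≤ 2 ^ (3*L+5) := by
          have : ∀ l : ℕ, 4*l+5 ≤ 2^(3*l+5) := by
            intro l
            induction l with
            | zero => norm_num
            | succ l ih =>
              have : 2^(3*(l+1)+5) = 8 * 2^(3*l+5) := by ring
              omega
          exact this L
        have h5 : (n:ℝ) ≤ 2^(3*L+5) := by rw [hn]; exact_mod_cast h4
        calc (n:ℝ) * t ≤ 2^(3*L+5) * 2^L := by gcongr
          _ = 2^n := by rw [← pow_add, hn]; congr 1; omega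
      rw [abs_of_pos (by positivity)]
      calc 2 / 2^k * |∑ i ∈ Finset.range (n+1), a i * x i ^ k| ≤ 2 / 2^(n+1) * n := by gcongr
        _ = n / 2^n := by rw [pow_succ]; field_simp
        _ ≤ 1 / t := by
          rw [div_le_div_iff₀ (by positivity) (by linarith)]; linarith
    · rw [hex k h, if_neg hk]; simp; linarith
  · simp only [abs_mul]
    rw [← Finset.mul_sum]
    have : (n:ℝ) = 4 * L + 5 := by rw [hn]; push_cast; ring
    calc |(2:ℝ)| * _ ≤ 2 * n := by rw [abs_two]; gcongr
      _ ≤ 26 * (Real.log t / Real.log 2) := by linarith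
      _ = _ := by ring

def sg (b : Bool) : ℝ := if b then 1 else -1

lemma sg_mul_self (b : Bool) : sg b * sg b = 1 := by cases b <;> simp [sg]

def wal {N : ℕ} (S : Finset (Fin N)) (e : Fin N → Bool) : ℝ := ∏ i ∈ S, sg (e i)

lemma sum_prod_bool {N : ℕ} (φ : Fin N → Bool → ℝ) :
    ∑ e : Fin N → Bool, ∏ i, φ i (e i) = ∏ i, (φ i true + φ i false) := by
  have := Finset.prod_univ_sum (R := ℝ) (fun _ : Fin N => (Finset.univ : Finset Bool)) φ
  rw [Fintype.piFinset_univ] at this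
  rw [← this]
  apply Finset.prod_congr rfl
  intro i _
  simp

lemma wal_orth {N : ℕ} (S T : Finset (Fin N)) :
    ∑ e : Fin N → Bool, wal S e * wal T e = if S = T then 2 ^ N else 0 := by
  classical
  have h : ∀ e : Fin N → Bool, wal S e * wal T e =
      ∏ i, ((if i ∈ S then sg (e i) else 1) * (if i ∈ T then sg (e i) else 1)) := by
    intro e
    rw [Finset.prod_mul_distrib]
    simp [wal]
  simp_rw [h]
  rw [sum_prod_bool (fun i b => (if i ∈ S then sg b else 1) * (if i ∈ T then sg b else 1))]
  split_ifs with hST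
  · subst hST
    rw [Finset.prod_congr rfl (g := fun _ => (2:ℝ))]
    · simp
    · intro i _
      by_cases hi : i ∈ S <;> simp [hi, sg] <;> norm_num
  · have : ∃ i, ¬ (i ∈ S ↔ i ∈ T) := by
      by_contra hc; push Not at hc; exact hST (Finset.ext hc)
    obtain ⟨i, hi⟩ := this
    apply Finset.prod_eq_zero (Finset.mem_univ i)
    by_cases h1 : i ∈ S <;> by_cases h2 : i ∈ T <;> simp_all [sg]

section RadH
variable {H : Type*} [NormedAddCommGroup H] [InnerProductSpace ℝ H]

lemma wal_parseval {N : ℕ} (b : Finset (Fin N) → H) :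
    ∑ e : Fin N → Bool, ‖∑ S, wal S e • b S‖ ^ 2 = 2 ^ N * ∑ S, ‖b S‖ ^ 2 := by
  classical
  have h : ∀ e : Fin N → Bool, ‖∑ S, wal S e • b S‖ ^ 2 =
      ∑ S, ∑ T, (wal S e * wal T e) * inner ℝ (b S) (b T) := by
    intro e
    rw [← real_inner_self_eq_norm_sq, sum_inner]
    apply Finset.sum_congr rfl; intro S _
    rw [inner_sum]
    apply Finset.sum_congr rfl; intro T _
    rw [real_inner_smul_left, real_inner_smul_right]; ring
  simp_rw [h]
  rw [Finset.sum_comm, Finset.mul_sum]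
  apply Finset.sum_congr rfl; intro S _
  rw [Finset.sum_comm]
  simp_rw [← Finset.sum_mul, wal_orth]
  simp

def fhat {N : ℕ} (f : (Fin N → Bool) → H) (S : Finset (Fin N)) : H :=
  ((2:ℝ) ^ N)⁻¹ • ∑ d, wal S d • f d

def noise {N : ℕ} (r : ℝ) (f : (Fin N → Bool) → H) (e : Fin N → Bool) : H :=
  ((2:ℝ) ^ N)⁻¹ • ∑ d, (∏ i, (1 + r * (sg (e i) * sg (d i)))) • f d

lemma noise_eq {N : ℕ} (r : ℝ) (f : (Fin N → Bool) → H) (e : Fin N → Bool) :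
    noise r f e = ∑ S : Finset (Fin N), (r ^ S.card) • wal S e • fhat f S := by
  classical
  have h : ∀ d : Fin N → Bool, (∏ i, (1 + r * (sg (e i) * sg (d i)))) =
      ∑ S : Finset (Fin N), r ^ S.card * wal S e * wal S d := by
    intro d
    rw [Finset.prod_one_add, Finset.powerset_univ]
    apply Finset.sum_congr rfl; intro S _
    rw [Finset.prod_mul_distrib, Finset.prod_mul_distrib, Finset.prod_const]
    simp [wal, mul_assoc]
  simp only [noise, fhat, h, Finset.sum_smul]
  rw [Finset.sum_comm, Finset.smul_sum]
  apply Finset.sum_congr rfl; intro S _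
  simp only [Finset.smul_sum, smul_smul]
  apply Finset.sum_congr rfl; intro d _
  congr 1; ring

lemma noise_one {N : ℕ} (f : (Fin N → Bool) → H) (e : Fin N → Bool) :
    noise 1 f e = f e := by
  classical
  unfold noise
  rw [Finset.sum_eq_single e]
  · have : ∏ i : Fin N, (1 + 1 * (sg (e i) * sg (e i))) = 2 ^ N := by
      simp [sg_mul_self]; norm_num
    rw [this, smul_smul, inv_mul_cancel₀ (by positivity), one_smul]
  · intro d _ hd
    have : ∃ i, d i ≠ e i := Function.ne_iff.mp hd
    obtain ⟨i, hi⟩ := this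
    rw [Finset.prod_eq_zero (Finset.mem_univ i), zero_smul]
    cases h1 : d i <;> cases h2 : e i <;> simp_all [sg]
  · simp

lemma fhat_parseval {N : ℕ} (f : (Fin N → Bool) → H) :
    ∑ e, ‖f e‖ ^ 2 = 2 ^ N * ∑ S, ‖fhat f S‖ ^ 2 := by
  rw [← wal_parseval]
  apply Finset.sum_congr rfl; intro e _
  conv_lhs => rw [← noise_one f e, noise_eq]
  simp

lemma semi_sum_le {ι : Type*} (p : Seminorm ℝ H) (s : Finset ι) (g : ι → H) :
    p (∑ i ∈ s, g i) ≤ ∑ i ∈ s, p (g i) := by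
  classical
  induction s using Finset.induction_on with
  | empty => simp
  | insert i s hi ih =>
    rw [Finset.sum_insert hi, Finset.sum_insert hi]
    exact (map_add_le_add p _ _).trans (by gcongr)

lemma noise_seminorm_le {N : ℕ} (p : Seminorm ℝ H) (r : ℝ) (hr : |r| ≤ 1)
    (f : (Fin N → Bool) → H) (hf : ∀ e, p (f e) ≤ 1) (e : Fin N → Bool) :
    p (noise r f e) ≤ 1 := by
  unfold noise
  rw [map_smul_eq_mul, Real.norm_of_nonneg (by positivity)]
  have hpos : ∀ d : Fin N → Bool, 0 ≤ ∏ i, (1 + r * (sg (e i) * sg (d i))) := by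
    intro d
    apply Finset.prod_nonneg
    intro i _
    have := abs_le.mp hr
    cases d i <;> cases e i <;> simp [sg] <;> linarith
  have h1 : p (∑ d, (∏ i, (1 + r * (sg (e i) * sg (d i)))) • f d) ≤
      ∑ d : Fin N → Bool, ∏ i, (1 + r * (sg (e i) * sg (d i))) := by
    refine (semi_sum_le p _ _).trans (Finset.sum_le_sum fun d _ => ?_)
    rw [map_smul_eq_mul, Real.norm_of_nonneg (hpos d)]
    exact mul_le_of_le_one_right (hpos d) (hf d)
  have h2 : ∑ d : Fin N → Bool, ∏ i, (1 + r * (sg (e i) * sg (d i))) = 2 ^ N := by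
    rw [sum_prod_bool (fun i b => 1 + r * (sg (e i) * sg b))]
    rw [Finset.prod_congr rfl (g := fun _ => (2:ℝ))]
    · simp
    · intro i _; simp [sg]; ring
  rw [h2] at h1
  calc _ ≤ ((2:ℝ)^N)⁻¹ * 2 ^ N := by gcongr
    _ = 1 := inv_mul_cancel₀ (by positivity)

lemma rad_proj {N M : ℕ} (p : Seminorm ℝ H) (hp : ∀ x, p x ≤ ‖x‖) (t TV : ℝ) (ht : 2 ≤ t)
    (a x : ℕ → ℝ) (hx : ∀ i, |x i| ≤ 1) (h1 : ∑ i ∈ Finset.range M, a i * x i = 1)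
    (hk : ∀ k, k ≠ 1 → |∑ i ∈ Finset.range M, a i * x i ^ k| ≤ 1 / t)
    (hTV : ∑ i ∈ Finset.range M, |a i| ≤ TV)
    (f : (Fin N → Bool) → H) (hf : ∀ e, p (f e) ≤ 1) (hft : ∀ e, ‖f e‖ ≤ t) :
    (∑ e : Fin N → Bool, p (∑ i, sg (e i) • fhat f {i}) ^ 2) / 2 ^ N ≤ 2 * TV ^ 2 + 2 := by
  classical
  set mm : Finset (Fin N) → ℝ := fun S =>
    ∑ j ∈ Finset.range M, a j * x j ^ S.card - if S.card = 1 then 1 else 0 with hmm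
  set R : (Fin N → Bool) → H := fun e => ∑ S, wal S e • (mm S • fhat f S) with hR
  have hTV0 : 0 ≤ TV := le_trans (Finset.sum_nonneg fun i _ => abs_nonneg _) hTV
  have hmmb : ∀ S, |mm S| ≤ 1 / t := by
    intro S
    by_cases hS : S.card = 1
    · simp [hmm, hS, h1]; linarith
    · simp only [hmm, hS, if_false, sub_zero]; exact hk _ hS
  have hP : ∀ e, ∑ i, sg (e i) • fhat f {i} =
      ∑ S : Finset (Fin N), (if S.card = 1 then (1:ℝ) else 0) • wal S e • fhat f S := by
    intro e
    simp only [ite_smul, one_smul, zero_smul]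
    rw [← Finset.sum_filter]
    have : (Finset.univ.filter fun S : Finset (Fin N) => S.card = 1)
        = Finset.univ.map ⟨singleton, Finset.singleton_injective⟩ := by
      ext S
      simp [Finset.card_eq_one, eq_comm]
    rw [this, Finset.sum_map]
    simp [wal]
  have hdec : ∀ e, ∑ i, sg (e i) • fhat f {i} =
      ∑ j ∈ Finset.range M, a j • noise (x j) f e - R e := by
    intro e
    simp only [hP, hR, noise_eq, Finset.smul_sum, smul_smul]
    rw [Finset.sum_comm, ← Finset.sum_sub_distrib]
    apply Finset.sum_congr rfl; intro S _
    rw [← Finset.sum_smul, ← sub_smul]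
    congr 1
    simp only [hmm, mul_sub, Finset.mul_sum]
    have : ∑ i ∈ Finset.range M, a i * (x i ^ S.card * wal S e) = ∑ i ∈ Finset.range M, wal S e * (a i * x i ^ S.card) :=
      Finset.sum_congr rfl fun i _ => by ring
    rw [this]; ring
  have hRn : ∑ e, ‖R e‖ ^ 2 ≤ 2 ^ N := by
    rw [hR, wal_parseval]
    have h2 : ∑ S, ‖mm S • fhat f S‖ ^ 2 ≤ (1/t)^2 * ∑ S, ‖fhat f S‖ ^ 2 := by
      rw [Finset.mul_sum]
      apply Finset.sum_le_sum; intro S _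
      rw [norm_smul, mul_pow, Real.norm_eq_abs]
      have := hmmb S
      gcongr
    have h3 : ∑ e, ‖f e‖ ^ 2 ≤ 2 ^ N * t ^ 2 := by
      calc _ ≤ ∑ e : Fin N → Bool, t ^ 2 := Finset.sum_le_sum fun e _ => by
            have := hft e
            gcongr
        _ = _ := by simp
    rw [fhat_parseval] at h3
    calc _ ≤ 2 ^ N * ((1/t)^2 * ∑ S, ‖fhat f S‖ ^ 2) := by gcongr
      _ = (1/t)^2 * (2 ^ N * ∑ S, ‖fhat f S‖ ^ 2) := by ring
      _ ≤ (1/t)^2 * (2 ^ N * t ^ 2) := by gcongr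
      _ = 2 ^ N := by field_simp
  have hpe : ∀ e, p (∑ i, sg (e i) • fhat f {i}) ^ 2 ≤ 2 * TV ^ 2 + 2 * ‖R e‖ ^ 2 := by
    intro e
    have h2 : p (∑ j ∈ Finset.range M, a j • noise (x j) f e) ≤ TV := by
      refine (semi_sum_le p _ _).trans (le_trans (Finset.sum_le_sum fun j _ => ?_) hTV)
      rw [map_smul_eq_mul, Real.norm_eq_abs]
      exact mul_le_of_le_one_right (abs_nonneg _) (noise_seminorm_le p _ (hx j) f hf e)
    have h3 : p (∑ i, sg (e i) • fhat f {i}) ≤ TV + ‖R e‖ := by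
      rw [hdec]
      exact (map_sub_le_add p _ _).trans (add_le_add h2 (hp _))
    have h4 : 0 ≤ p (∑ i, sg (e i) • fhat f {i}) := apply_nonneg _ _
    calc _ ≤ (TV + ‖R e‖) ^ 2 := by gcongr
      _ ≤ _ := by nlinarith [sq_nonneg (TV - ‖R e‖)]
  rw [div_le_iff₀ (by positivity)]
  calc _ ≤ ∑ e : Fin N → Bool, (2 * TV ^ 2 + 2 * ‖R e‖ ^ 2) := Finset.sum_le_sum fun e _ => hpe e
    _ = 2 ^ N * (2 * TV ^ 2) + 2 * ∑ e, ‖R e‖ ^ 2 := by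
      rw [Finset.sum_add_distrib, ← Finset.mul_sum (f := fun e => ‖R e‖ ^ 2)]; simp
    _ ≤ 2 ^ N * (2 * TV ^ 2) + 2 * 2 ^ N := by gcongr
    _ = _ := by ring

end RadH

lemma rad_bound : ∃ c : ℝ, 0 < c ∧ ∀ (H : Type) [NormedAddCommGroup H] [InnerProductSpace ℝ H]
    (p : Seminorm ℝ H) (_ : ∀ x, p x ≤ ‖x‖) (C : ℝ) (_ : 0 ≤ C)
    (_ : ∀ (N : ℕ) (x : Fin N → H), ∑ j, p (x j) ^ 2 ≤
      C ^ 2 * ((∑ e : Fin N → Bool, p (∑ j, sg (e j) • x j) ^ 2) / 2 ^ N))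
    (N : ℕ) (u : Fin N → H) (_ : ∀ i x, inner ℝ x (u i) ≤ p x)
    (t : ℝ) (_ : 2 ≤ t) (a : Fin N → ℝ)
    (f : (Fin N → Bool) → H) (_ : ∀ e, p (f e) ≤ 1) (_ : ∀ e, ‖f e‖ ≤ t),
    (∑ e, inner ℝ (f e) (∑ i, (sg (e i) * a i) • u i)) / 2 ^ N ≤
      c * C * Real.log t * Real.sqrt (∑ i, a i ^ 2) := by
  obtain ⟨c, hc, hmom⟩ := exists_moments
  have hl2 : 0 < Real.log 2 := Real.log_pos (by norm_num)
  refine ⟨2 * (c + 1 / Real.log 2), by positivity, ?_⟩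
  intro H _ _ p hp C hC hcot N u hu t ht a f hf hft
  obtain ⟨M, b, x, hx, h1, hk, hTV⟩ := hmom t ht
  have hR := rad_proj p hp t _ ht b x hx h1 hk hTV f hf hft
  have hcot' := hcot N (fun i => fhat f {i})
  have hlt : Real.log 2 ≤ Real.log t := Real.log_le_log (by norm_num) ht
  have hone : 1 ≤ 1 / Real.log 2 * Real.log t := by
    rw [one_div, inv_mul_eq_div, le_div_iff₀ hl2]; linarith
  set B := 2 * (c + 1 / Real.log 2) * Real.log t with hB
  have hB0 : 0 ≤ B := by have : 0 ≤ Real.log t := by linarith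
                         positivity
  have hsq : ∑ i, p (fhat f {i}) ^ 2 ≤ (C * B) ^ 2 := by
    refine hcot'.trans ?_
    rw [mul_pow]
    gcongr
    refine hR.trans ?_
    have h3 : 0 ≤ c * Real.log t := by have : 0 ≤ Real.log t := by linarith
                                       positivity
    have : B = 2 * (c * Real.log t + 1 / Real.log 2 * Real.log t) := by rw [hB]; ring
    rw [this]
    nlinarith
  have hlhs : (∑ e, inner ℝ (f e) (∑ i, (sg (e i) * a i) • u i)) / 2 ^ N
      = ∑ i, a i * inner ℝ (fhat f {i}) (u i) := by
    simp only [fhat, wal, Finset.prod_singleton, real_inner_smul_left, sum_inner, inner_sum,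
      real_inner_smul_right, Finset.mul_sum]
    rw [Finset.sum_comm, Finset.sum_div]
    apply Finset.sum_congr rfl; intro i _
    rw [Finset.sum_div]
    apply Finset.sum_congr rfl; intro e _
    field_simp
  rw [hlhs]
  have h5 : ∀ i, a i * inner ℝ (fhat f {i}) (u i) ≤ |a i| * p (fhat f {i}) := by
    intro i
    have h6 : |inner ℝ (fhat f {i}) (u i)| ≤ p (fhat f {i}) := by
      rw [abs_le']
      refine ⟨hu _ _, ?_⟩
      rw [← inner_neg_left, ← map_neg_eq_map p]
      exact hu _ _
    calc _ ≤ |a i * inner ℝ (fhat f {i}) (u i)| := le_abs_self _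
      _ = |a i| * |inner ℝ (fhat f {i}) (u i)| := abs_mul _ _
      _ ≤ _ := by gcongr
  calc _ ≤ ∑ i, |a i| * p (fhat f {i}) := Finset.sum_le_sum fun i _ => h5 i
    _ ≤ Real.sqrt (∑ i, |a i| ^ 2) * Real.sqrt (∑ i, p (fhat f {i}) ^ 2) :=
      Real.sum_mul_le_sqrt_mul_sqrt _ _ _
    _ ≤ Real.sqrt (∑ i, a i ^ 2) * (C * B) := by
      simp only [sq_abs]
      gcongr
      exact Real.sqrt_le_iff.mpr ⟨by positivity, hsq⟩
    _ = _ := by rw [hB]; ring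

section Anderson
variable {V : Type*} [NormedAddCommGroup V] [NormedSpace ℝ V] [FiniteDimensional ℝ V]
  [MeasurableSpace V] [BorelSpace V] (μ : Measure V) [μ.IsAddHaarMeasure]

lemma and_prod_rot (P Q : Set V) (hP : MeasurableSet P) (hQ : MeasurableSet Q) :
    μ P * μ Q = ∫⁻ u, μ {w | u + (1/2:ℝ) • w ∈ P ∧ u - (1/2:ℝ) • w ∈ Q} ∂μ := by
  have : ProperSpace V := FiniteDimensional.proper ℝ V
  have : SecondCountableTopology V := secondCountable_of_proper
  set f : V → ENNReal := P.indicator 1 with hf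
  set g : V → ENNReal := Q.indicator 1 with hg
  have hfm : Measurable f := measurable_one.indicator hP
  have hgm : Measurable g := measurable_one.indicator hQ
  have h1 : μ P * μ Q = ∫⁻ x2, ∫⁻ x1, f x1 * g x2 ∂μ ∂μ := by
    have : ∀ x2, ∫⁻ x1, f x1 * g x2 ∂μ = μ P * g x2 := by
      intro x2
      rw [lintegral_mul_const _ hfm, hf, lintegral_indicator_one hP]
    simp_rw [this]
    rw [lintegral_const_mul _ hgm, hg, lintegral_indicator_one hQ]
  have h2 : ∫⁻ x2, ∫⁻ x1, f x1 * g x2 ∂μ ∂μ = ∫⁻ x2, ∫⁻ w, f (w + x2) * g x2 ∂μ ∂μ := by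
    congr 1; ext x2
    exact (lintegral_add_right_eq_self (fun x1 => f x1 * g x2) x2).symm
  have h3 : ∫⁻ x2, ∫⁻ w, f (w + x2) * g x2 ∂μ ∂μ = ∫⁻ w, ∫⁻ x2, f (w + x2) * g x2 ∂μ ∂μ := by
    apply lintegral_lintegral_swap
    apply Measurable.aemeasurable
    apply Measurable.mul
    · exact hfm.comp (measurable_snd.add measurable_fst)
    · exact hgm.comp measurable_fst
  have h4 : ∫⁻ w, ∫⁻ x2, f (w + x2) * g x2 ∂μ ∂μ =
      ∫⁻ w, ∫⁻ u, f (u + (1/2:ℝ) • w) * g (u - (1/2:ℝ) • w) ∂μ ∂μ := by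
    congr 1; ext w
    rw [← lintegral_add_right_eq_self (fun x2 => f (w + x2) * g x2) (-((1/2:ℝ) • w))]
    congr 1; ext u
    rw [← sub_eq_add_neg]
    congr 2
    have : w = (1/2:ℝ) • w + (1/2:ℝ) • w := by rw [← add_smul]; norm_num
    nth_rw 1 [this]
    abel
  have h5 : ∫⁻ w, ∫⁻ u, f (u + (1/2:ℝ) • w) * g (u - (1/2:ℝ) • w) ∂μ ∂μ =
      ∫⁻ u, ∫⁻ w, f (u + (1/2:ℝ) • w) * g (u - (1/2:ℝ) • w) ∂μ ∂μ := by
    apply lintegral_lintegral_swap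
    apply Measurable.aemeasurable
    apply Measurable.mul
    · exact hfm.comp (by fun_prop)
    · exact hgm.comp (by fun_prop)
  rw [h1, h2, h3, h4, h5]
  congr 1; ext u
  rw [← lintegral_indicator_one]
  · congr 1; ext w
    simp only [hf, hg, indicator, Set.mem_ofPred_eq, Pi.one_apply]
    split_ifs <;> simp_all
  · apply MeasurableSet.inter
    · exact hP.preimage (by fun_prop : Measurable fun w : V => u + (1/2:ℝ) • w)
    · exact hQ.preimage (by fun_prop : Measurable fun w : V => u - (1/2:ℝ) • w)

def SymC (L : Set V) : Prop := IsClosed L ∧ Convex ℝ L ∧ ∀ x ∈ L, -x ∈ L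

lemma symC_slice (L : Set V) (hL : SymC L) (u : V) :
    SymC {w : V | u + (1/2:ℝ) • w ∈ L ∧ u - (1/2:ℝ) • w ∈ L} := by
  obtain ⟨h1, h2, h3⟩ := hL
  refine ⟨?_, ?_, ?_⟩
  · exact (h1.preimage (by fun_prop : Continuous fun w : V => u + (1/2:ℝ) • w)).inter
      (h1.preimage (by fun_prop : Continuous fun w : V => u - (1/2:ℝ) • w))
  · rintro x ⟨hx, hx'⟩ y ⟨hy, hy'⟩ a b ha hb hab
    have e : u = a • u + b • u := by rw [← add_smul, hab, one_smul]
    constructor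
    · have := h2 hx hy ha hb hab
      convert this using 1
      nth_rw 1 [e]; module
    · have := h2 hx' hy' ha hb hab
      convert this using 1
      nth_rw 1 [e]; module
  · rintro x ⟨hx, hx'⟩
    simp only [Set.mem_ofPred_eq, smul_neg, sub_neg_eq_add, ← sub_eq_add_neg]
    exact ⟨hx', hx⟩

lemma anderson_triv (L L' : Set V) (hL : SymC L) (hL' : SymC L') (z : V) :
    μ (L ∩ {x | x - z ∈ L'}) ≤ (2:ENNReal) ^ (Module.finrank ℝ V : ℝ) * μ (L ∩ L') := by
  rcases Set.eq_empty_or_nonempty (L ∩ {x | x - z ∈ L'}) with h | ⟨a, ha1, ha2⟩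
  · rw [h]; simp
  have key : ∀ (M : Set V), SymC M → ∀ x ∈ M, ∀ y ∈ M, (1/2:ℝ) • (x - y) ∈ M := by
    intro M hM x hx y hy
    have := hM.2.1 hx (hM.2.2 y hy) (by norm_num : (0:ℝ) ≤ 1/2) (by norm_num : (0:ℝ) ≤ 1/2) (by norm_num)
    convert this using 1; module
  have hsub : L ∩ {x | x - z ∈ L'} ⊆ (fun x => x + (-a)) ⁻¹' ((2:ℝ) • (L ∩ L')) := by
    rintro x ⟨hx1, hx2⟩
    refine ⟨(1/2:ℝ) • (x - a), ⟨key L hL _ hx1 _ ha1, ?_⟩, ?_⟩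
    · have := key L' hL' _ hx2 _ ha2
      convert this using 2; abel
    · simp only; rw [smul_smul]; norm_num; abel
  calc _ ≤ _ := measure_mono hsub
    _ = μ ((2:ℝ) • (L ∩ L')) := measure_preimage_add_right μ _ _
    _ = _ := by
      rw [Measure.addHaar_smul]
      congr 1
      rw [abs_of_pos (by positivity), ENNReal.ofReal_pow (by norm_num)]
      simp

lemma anderson_step (c : ENNReal) (hc : c ≠ ⊤)
    (h : ∀ L L' : Set V, SymC L → SymC L' → ∀ z, μ (L ∩ {x | x - z ∈ L'}) ≤ c * μ (L ∩ L'))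
    (L L' : Set V) (hL : SymC L) (hL' : SymC L') (z : V) :
    μ (L ∩ {x | x - z ∈ L'}) ≤ c ^ (1/2:ℝ) * μ (L ∩ L') := by
  have hm : ∀ z : V, MeasurableSet (L ∩ {x | x - z ∈ L'}) := fun z =>
    hL.1.measurableSet.inter (hL'.1.preimage (by fun_prop : Continuous fun x : V => x - z)).measurableSet
  have hneg : μ (L ∩ {x | x - (-z) ∈ L'}) = μ (L ∩ {x | x - z ∈ L'}) := by
    rw [← Measure.measure_preimage_neg μ (L ∩ {x | x - z ∈ L'})]
    congr 1; ext x
    simp only [Set.mem_inter_iff, Set.mem_ofPred_eq, Set.mem_preimage]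
    constructor
    · rintro ⟨h1, h2⟩
      refine ⟨hL.2.2 _ h1, ?_⟩
      have := hL'.2.2 _ h2
      convert this using 1; abel
    · rintro ⟨h1, h2⟩
      refine ⟨by simpa using hL.2.2 _ h1, ?_⟩
      have := hL'.2.2 _ h2
      convert this using 1; abel
  have hsq : ∀ z : V, μ (L ∩ {x | x - z ∈ L'}) * μ (L ∩ {x | x - (-z) ∈ L'}) =
      ∫⁻ u, μ ({w | u + (1/2:ℝ) • w ∈ L ∧ u - (1/2:ℝ) • w ∈ L} ∩
        {w | w - (2:ℝ) • z ∈ {w | u + (1/2:ℝ) • w ∈ L' ∧ u - (1/2:ℝ) • w ∈ L'}}) ∂μ := by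
    intro z
    rw [and_prod_rot μ _ _ (hm z) (hm (-z))]
    congr 1; ext u
    congr 1; ext w
    simp only [Set.mem_inter_iff, Set.mem_ofPred_eq]
    have e1 : u + (1/2:ℝ) • (w - (2:ℝ) • z) = u + (1/2:ℝ) • w - z := by module
    have e2 : u - (1/2:ℝ) • (w - (2:ℝ) • z) = u - (1/2:ℝ) • w - -z := by module
    rw [e1, e2]; tauto
  have h0 : μ (L ∩ L') * μ (L ∩ L') = ∫⁻ u, μ ({w | u + (1/2:ℝ) • w ∈ L ∧ u - (1/2:ℝ) • w ∈ L} ∩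
        {w | u + (1/2:ℝ) • w ∈ L' ∧ u - (1/2:ℝ) • w ∈ L'}) ∂μ := by
    have := hsq 0
    simpa using this
  have h2 : μ (L ∩ {x | x - z ∈ L'}) * μ (L ∩ {x | x - z ∈ L'}) ≤ c * (μ (L ∩ L') * μ (L ∩ L')) := by
    nth_rw 2 [← hneg]
    rw [hsq z, h0]
    calc _ ≤ ∫⁻ u, c * μ ({w | u + (1/2:ℝ) • w ∈ L ∧ u - (1/2:ℝ) • w ∈ L} ∩
        {w | u + (1/2:ℝ) • w ∈ L' ∧ u - (1/2:ℝ) • w ∈ L'}) ∂μ := by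
          apply lintegral_mono
          intro u
          exact h _ _ (symC_slice L hL u) (symC_slice L' hL' u) _
      _ ≤ _ := by
          rw [lintegral_const_mul' _ _ hc]
  have h3 := ENNReal.rpow_le_rpow h2 (by norm_num : (0:ℝ) ≤ 1/2)
  have e : ∀ a : ENNReal, (a * a) ^ (1/2:ℝ) = a := by
    intro a
    rw [← sq, ← ENNReal.rpow_natCast, ← ENNReal.rpow_mul]; norm_num
  rw [e, ENNReal.mul_rpow_of_nonneg _ _ (by norm_num), e] at h3
  exact h3

theorem anderson (L L' : Set V) (hL : SymC L) (hL' : SymC L') (z : V) :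
    μ (L ∩ {x | x - z ∈ L'}) ≤ μ (L ∩ L') := by
  set m : ℝ := (Module.finrank ℝ V : ℝ)
  have hk : ∀ k : ℕ, ∀ L L' : Set V, SymC L → SymC L' → ∀ z,
      μ (L ∩ {x | x - z ∈ L'}) ≤ (2:ENNReal) ^ (m * (1/2)^k : ℝ) * μ (L ∩ L') := by
    intro k
    induction k with
    | zero => intro L L' hL hL' z; rw [pow_zero, mul_one]; exact anderson_triv μ L L' hL hL' z
    | succ k ih =>
      intro L L' hL hL' z
      have := anderson_step μ _ (by simp) ih L L' hL hL' z
      rw [← ENNReal.rpow_mul] at this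
      convert this using 3
      ring
  have hlim : Filter.Tendsto (fun k : ℕ => (2:ENNReal) ^ (m * (1/2)^k : ℝ) * μ (L ∩ L')) Filter.atTop
      (nhds (1 * μ (L ∩ L'))) := by
    apply ENNReal.Tendsto.mul_const _ (Or.inl one_ne_zero)
    have h1 : Filter.Tendsto (fun k : ℕ => (m * (1/2)^k : ℝ)) Filter.atTop (nhds 0) := by
      have := (tendsto_pow_atTop_nhds_zero_of_lt_one (by norm_num : (0:ℝ) ≤ 1/2) (by norm_num)).const_mul m
      simpa using this
    have h2 : Continuous fun x : ℝ => ENNReal.ofReal ((2:ℝ) ^ x) :=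
      ENNReal.continuous_ofReal.comp (Real.continuous_const_rpow (by norm_num))
    have h3 := (h2.tendsto 0).comp h1
    simp only [Real.rpow_zero, ENNReal.ofReal_one] at h3
    refine h3.congr fun k => ?_
    simp only [Function.comp]
    rw [← ENNReal.ofReal_rpow_of_pos (by norm_num)]; simp
  rw [one_mul] at hlim
  exact ge_of_tendsto' hlim fun k => hk k L L' hL hL' z
end Anderson

def gam (N : ℕ) : Measure (Fin N → ℝ) := Measure.pi fun _ => ProbabilityTheory.gaussianReal 0 1

instance (N : ℕ) : IsProbabilityMeasure (gam N) := by unfold gam; infer_instance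

def gden {N : ℕ} (y : Fin N → ℝ) : ENNReal := ∏ i, ProbabilityTheory.gaussianPDF 0 1 (y i)

lemma gden_meas {N : ℕ} : Measurable (gden (N := N)) := by
  unfold gden
  refine Finset.measurable_prod _ fun i _ => ?_
  exact (ProbabilityTheory.measurable_gaussianPDF 0 1).comp (measurable_pi_apply i)

lemma gam_eq (N : ℕ) : gam N = (volume : Measure (Fin N → ℝ)).withDensity gden := by
  unfold gam
  apply Measure.pi_eq
  intro s hs
  rw [withDensity_apply _ (MeasurableSet.univ_pi hs)]
  rw [volume_pi, Measure.restrict_pi_pi]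
  unfold gden
  simp only [ProbabilityTheory.gaussianPDF]
  have hint : ∀ i, Integrable (ProbabilityTheory.gaussianPDFReal 0 1) (volume.restrict (s i)) :=
    fun i => (ProbabilityTheory.integrable_gaussianPDFReal 0 1).restrict
  have h0 : ∀ y : Fin N → ℝ, ∏ i, ENNReal.ofReal (ProbabilityTheory.gaussianPDFReal 0 1 (y i)) =
      ENNReal.ofReal (∏ i, ProbabilityTheory.gaussianPDFReal 0 1 (y i)) := fun y =>
    (ENNReal.ofReal_prod_of_nonneg fun i _ => ProbabilityTheory.gaussianPDFReal_nonneg _ _ _).symm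
  simp_rw [h0]
  rw [← ofReal_integral_eq_lintegral_ofReal (Integrable.fintype_prod hint)
    (Filter.Eventually.of_forall fun y =>
      Finset.prod_nonneg fun i _ => ProbabilityTheory.gaussianPDFReal_nonneg _ _ _),
    integral_fintype_prod_eq_prod (fun _ => ProbabilityTheory.gaussianPDFReal 0 1),
    ENNReal.ofReal_prod_of_nonneg]
  · apply Finset.prod_congr rfl
    intro i _
    rw [ProbabilityTheory.gaussianReal_apply_eq_integral 0 one_ne_zero]
  · intro i _
    exact integral_nonneg fun y => ProbabilityTheory.gaussianPDFReal_nonneg _ _ _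

lemma gden_eq {N : ℕ} (y : Fin N → ℝ) : gden y =
    ENNReal.ofReal ((Real.sqrt (2 * Real.pi))⁻¹ ^ N * Real.exp (- (∑ i, y i ^ 2) / 2)) := by
  unfold gden
  simp only [ProbabilityTheory.gaussianPDF, ProbabilityTheory.gaussianPDFReal]
  rw [← ENNReal.ofReal_prod_of_nonneg]
  · congr 1
    rw [Finset.prod_mul_distrib, ← Real.exp_sum]
    simp [Finset.sum_div, neg_div, Finset.sum_neg_distrib]
  · intro i _; positivity

lemma gam_mp_sign {N : ℕ} (e : Fin N → ℝ) (he : ∀ i, e i = 1 ∨ e i = -1) :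
    MeasurePreserving (fun y : Fin N → ℝ => fun i => e i * y i) (gam N) (gam N) := by
  unfold gam
  apply measurePreserving_pi
  intro i
  refine ⟨by fun_prop, ?_⟩
  rw [ProbabilityTheory.gaussianReal_map_const_mul]
  congr 1
  · simp
  · rcases he i with h | h <;> · rw [h]; ext; simp

lemma gam_shift {N : ℕ} (S : Set (Fin N → ℝ)) (hS : MeasurableSet S) (hsym : ∀ y ∈ S, -y ∈ S)
    (a : Fin N → ℝ) :
    ENNReal.ofReal (Real.exp (-(∑ i, a i ^ 2) / 2)) * gam N S ≤ gam N {y | y - a ∈ S} := by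
  have hsh : ∀ a : Fin N → ℝ, gam N {y | y - a ∈ S} = ∫⁻ y in S, gden (y + a) := by
    intro a
    have hm : MeasurableSet {y : Fin N → ℝ | y - a ∈ S} :=
      hS.preimage (by fun_prop : Measurable fun y : Fin N → ℝ => y - a)
    rw [gam_eq, withDensity_apply _ hm, ← lintegral_indicator hm, ← lintegral_indicator hS]
    rw [← lintegral_add_right_eq_self _ a]
    congr 1; ext y
    have e : y + a - a = y := by abel
    by_cases hy : y ∈ S
    · rw [indicator_of_mem hy, indicator_of_mem (by show y + a - a ∈ S; rwa [e])]
    · rw [indicator_of_notMem hy, indicator_of_notMem (by show ¬ (y + a - a ∈ S); rwa [e])]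
  have hneg : gam N {y | y - (-a) ∈ S} = gam N {y | y - a ∈ S} := by
    have hmp := gam_mp_sign (N := N) (fun _ => -1) (fun _ => Or.inr rfl)
    have hm : MeasurableSet {y : Fin N → ℝ | y - a ∈ S} :=
      hS.preimage (by fun_prop : Measurable fun y : Fin N → ℝ => y - a)
    rw [← hmp.measure_preimage hm.nullMeasurableSet]
    congr 1
    ext y
    have e : (fun i => (-1:ℝ) * y i) = -y := by ext i; simp
    simp only [mem_ofPred_eq, mem_preimage, e]
    constructor
    · intro h; have := hsym _ h; convert this using 1; abel
    · intro h; have := hsym _ h; convert this using 1; abel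
  have h2 : 2 * (ENNReal.ofReal (Real.exp (-(∑ i, a i ^ 2) / 2)) * gam N S) ≤
      gam N {y | y - a ∈ S} + gam N {y | y - (-a) ∈ S} := by
    have hga : Measurable fun y : Fin N → ℝ => gden (y + a) :=
      gden_meas.comp (by fun_prop : Measurable fun y : Fin N → ℝ => y + a)
    rw [hsh a, hsh (-a), ← lintegral_add_left hga]
    rw [gam_eq, withDensity_apply _ hS, ← mul_assoc, ← lintegral_const_mul _ gden_meas]
    apply lintegral_mono
    intro y
    simp only [Function.comp, gden_eq]
    have : (2:ENNReal) = ENNReal.ofReal 2 := by simp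
    rw [this, ← ENNReal.ofReal_mul (by norm_num), ← ENNReal.ofReal_mul (by positivity),
      ← ENNReal.ofReal_add (by positivity) (by positivity)]
    apply ENNReal.ofReal_le_ofReal
    set k := (Real.sqrt (2 * Real.pi))⁻¹ ^ N
    have hk : 0 ≤ k := by positivity
    have e1 : ∑ i, (y + a) i ^ 2 = ∑ i, y i ^ 2 + 2 * ∑ i, y i * a i + ∑ i, a i ^ 2 := by
      rw [Finset.mul_sum, ← Finset.sum_add_distrib, ← Finset.sum_add_distrib]
      apply Finset.sum_congr rfl; intro i _; simp; ring
    have e2 : ∑ i, (y + -a) i ^ 2 = ∑ i, y i ^ 2 - 2 * ∑ i, y i * a i + ∑ i, a i ^ 2 := by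
      rw [Finset.mul_sum, ← Finset.sum_sub_distrib, ← Finset.sum_add_distrib]
      apply Finset.sum_congr rfl; intro i _; simp; ring
    rw [e1, e2]
    set p := ∑ i, y i * a i
    set q := ∑ i, y i ^ 2
    set r := ∑ i, a i ^ 2
    have f1 : Real.exp (-(q + 2 * p + r) / 2) = Real.exp (-r/2) * Real.exp (-q/2) * Real.exp (-p) := by
      rw [← Real.exp_add, ← Real.exp_add]; congr 1; ring
    have f2 : Real.exp (-(q - 2 * p + r) / 2) = Real.exp (-r/2) * Real.exp (-q/2) * Real.exp p := by
      rw [← Real.exp_add, ← Real.exp_add]; congr 1; ring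
    rw [f1, f2]
    have hc : 2 ≤ Real.exp (-p) + Real.exp p := by
      have := Real.one_le_cosh p
      rw [Real.cosh_eq] at this; linarith
    have hpos : 0 ≤ k * (Real.exp (-r/2) * Real.exp (-q/2)) := by positivity
    nlinarith
  rw [hneg, ← two_mul] at h2
  exact (ENNReal.mul_le_mul_iff_right (by norm_num) (by norm_num)).1 h2

lemma gam_sq_integrable {N : ℕ} (i : Fin N) : Integrable (fun y : Fin N → ℝ => y i ^ 2) (gam N) := by
  have hmp : MeasurePreserving (Function.eval i) (gam N) (ProbabilityTheory.gaussianReal 0 1) :=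
    measurePreserving_eval (fun _ => ProbabilityTheory.gaussianReal 0 1) i
  have h1 : Integrable (fun x : ℝ => x ^ 2) (ProbabilityTheory.gaussianReal 0 1) :=
    (ProbabilityTheory.memLp_id_gaussianReal 2).integrable_sq
  exact hmp.integrable_comp_of_integrable h1

lemma gam_sq_integral {N : ℕ} (i : Fin N) : ∫ y, y i ^ 2 ∂(gam N) = 1 := by
  have hmp : MeasurePreserving (Function.eval i) (gam N) (ProbabilityTheory.gaussianReal 0 1) :=
    measurePreserving_eval (fun _ => ProbabilityTheory.gaussianReal 0 1) i
  have h1 : ∫ x, x ^ 2 ∂(ProbabilityTheory.gaussianReal 0 1) = 1 := by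
    have := ProbabilityTheory.variance_fun_id_gaussianReal (μ := 0) (v := 1)
    rw [ProbabilityTheory.variance_of_integral_eq_zero (by fun_prop) (by simp)] at this
    simpa using this
  rw [← h1]
  have := integral_map (μ := gam N) (φ := Function.eval i) hmp.measurable.aemeasurable
    (f := fun x : ℝ => x ^ 2) (by fun_prop)
  rw [hmp.map_eq] at this
  exact this.symm

section GaussStep
variable {V : Type*} [NormedAddCommGroup V] [NormedSpace ℝ V] [FiniteDimensional ℝ V]
  [MeasurableSpace V] [BorelSpace V] (μ : Measure V) [μ.IsAddHaarMeasure]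
  {N : ℕ} (Ψ : V →ₗ[ℝ] (Fin N → ℝ)) (Φ : (Fin N → ℝ) →ₗ[ℝ] V)

def LTr (L : Set V) (t : ℝ) : Set V := {v | v ∈ L ∧ ∑ i, (Ψ v i) ^ 2 ≤ t ^ 2}

def hsup (L : Set V) (t : ℝ) (y : Fin N → ℝ) : ℝ :=
  sSup ((fun v => ∑ i, y i * Ψ v i) '' LTr Ψ L t)

lemma psi_cont : Continuous Ψ := Ψ.continuous_of_finiteDimensional

lemma psi_cont' (i : Fin N) : Continuous fun v => Ψ v i :=
  (continuous_apply i).comp (psi_cont Ψ)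

lemma symC_LTr (L : Set V) (hL : SymC L) (t : ℝ) : SymC (LTr Ψ L t) := by
  refine ⟨?_, ?_, ?_⟩
  · apply hL.1.inter
    exact isClosed_le (continuous_finsetSum _ fun i _ => (psi_cont' Ψ i).pow 2) continuous_const
  · rintro x ⟨hx, hx'⟩ y ⟨hy, hy'⟩ a b ha hb hab
    refine ⟨hL.2.1 hx hy ha hb hab, ?_⟩
    have : ∀ i, (Ψ (a • x + b • y) i) ^ 2 ≤ a * (Ψ x i) ^ 2 + b * (Ψ y i) ^ 2 := by
      intro i
      simp only [map_add, map_smul, Pi.add_apply, Pi.smul_apply, smul_eq_mul]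
      have hb' : b = 1 - a := by linarith
      have : 0 ≤ a * b * (Ψ x i - Ψ y i) ^ 2 := by positivity
      subst hb'
      nlinarith
    calc _ ≤ ∑ i, (a * (Ψ x i) ^ 2 + b * (Ψ y i) ^ 2) := Finset.sum_le_sum fun i _ => this i
      _ = a * ∑ i, (Ψ x i) ^ 2 + b * ∑ i, (Ψ y i) ^ 2 := by
        rw [Finset.sum_add_distrib, Finset.mul_sum, Finset.mul_sum]
      _ ≤ a * t ^ 2 + b * t ^ 2 := by gcongr
      _ = t ^ 2 := by rw [← add_mul, hab, one_mul]
  · rintro x ⟨hx, hx'⟩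
    exact ⟨hL.2.2 x hx, by simpa using hx'⟩

lemma LTr_compact (L : Set V) (hL : SymC L) (hLc : IsCompact L) (t : ℝ) : IsCompact (LTr Ψ L t) :=
  hLc.of_isClosed_subset (symC_LTr Ψ L hL t).1 fun _ h => h.1

lemma LTr_zero (L : Set V) (h0 : (0:V) ∈ L) (t : ℝ) : (0:V) ∈ LTr Ψ L t :=
  ⟨h0, by simp; positivity⟩

lemma hsup_cont (L : Set V) (hL : SymC L) (hLc : IsCompact L) (t : ℝ) :
    Continuous (hsup Ψ L t) := by
  unfold hsup
  apply IsCompact.continuous_sSup (LTr_compact Ψ L hL hLc t)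
  show Continuous fun q : (Fin N → ℝ) × V => ∑ i, q.1 i * Ψ q.2 i
  apply continuous_finsetSum
  intro i _
  exact ((continuous_apply i).comp continuous_fst).mul ((psi_cont' Ψ i).comp continuous_snd)

lemma hsup_cont_in (y : Fin N → ℝ) : Continuous fun v => ∑ i, y i * Ψ v i :=
  continuous_finsetSum _ fun i _ => continuous_const.mul (psi_cont' Ψ i)

lemma le_hsup (L : Set V) (hL : SymC L) (hLc : IsCompact L) (t : ℝ) (y : Fin N → ℝ)
    (v : V) (hv : v ∈ LTr Ψ L t) : ∑ i, y i * Ψ v i ≤ hsup Ψ L t y := by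
  apply le_csSup
  · exact ((LTr_compact Ψ L hL hLc t).image (hsup_cont_in Ψ y)).bddAbove
  · exact ⟨v, hv, rfl⟩

lemma hsup_nonneg (L : Set V) (hL : SymC L) (hLc : IsCompact L) (h0 : (0:V) ∈ L) (t : ℝ)
    (y : Fin N → ℝ) : 0 ≤ hsup Ψ L t y := by
  have := le_hsup Ψ L hL hLc t y 0 (LTr_zero Ψ L h0 t)
  simpa using this

lemma hsup_attained (L : Set V) (hL : SymC L) (hLc : IsCompact L) (h0 : (0:V) ∈ L) (t : ℝ)
    (y : Fin N → ℝ) : ∃ v ∈ LTr Ψ L t, hsup Ψ L t y = ∑ i, y i * Ψ v i := by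
  obtain ⟨v, hv, h1, _⟩ := (LTr_compact Ψ L hL hLc t).exists_sSup_image_eq_and_ge
    ⟨0, LTr_zero Ψ L h0 t⟩ (hsup_cont_in Ψ y).continuousOn
  exact ⟨v, hv, h1⟩

theorem gauss_step (h1 : ∀ v, Φ (Ψ v) = v)
    (h2 : ∀ v y, ∑ i, y i * Ψ v i = ∑ i, Ψ (Φ y) i * Ψ v i)
    (L : Set V) (hL : SymC L) (hLc : IsCompact L) (h0 : (0:V) ∈ L)
    (s A δ : ℝ) (hs : 0 < s) (hA : 0 < A) (hδ : 0 < δ)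
    (hint : Integrable (hsup Ψ L (2 * s)) (gam N))
    (hle : ∫ y, hsup Ψ L (2 * s) y ∂(gam N) ≤ A) :
    ENNReal.ofReal ((1 - δ) * Real.exp (- (2 * A ^ 2 / (δ ^ 2 * s ^ 2)))) * μ (LTr Ψ L (2 * s)) ≤
      μ (LTr Ψ L s) := by
  have : ProperSpace V := FiniteDimensional.proper ℝ V
  have : SecondCountableTopology V := secondCountable_of_proper
  set t := 2 * s with ht
  set σ := δ * s ^ 2 / A with hσ
  have hσ0 : 0 < σ := by positivity
  set M := LTr Ψ L t with hM
  have hMs : SymC M := symC_LTr Ψ L hL t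
  set S : Set V := {v | ∀ v' ∈ M, ∑ i, Ψ v i * Ψ v' i ≤ s ^ 2} with hS
  have hSs : SymC S := by
    refine ⟨?_, ?_, ?_⟩
    · have : S = ⋂ v' ∈ M, {v | ∑ i, Ψ v i * Ψ v' i ≤ s ^ 2} := by ext; simp [hS]
      rw [this]
      refine isClosed_biInter fun v' _ => isClosed_le ?_ continuous_const
      exact continuous_finsetSum _ fun i _ => (psi_cont' Ψ i).mul continuous_const
    · intro x hx y hy a b ha hb hab v' hv'
      have e : ∑ i, Ψ (a • x + b • y) i * Ψ v' i = a * ∑ i, Ψ x i * Ψ v' i + b * ∑ i, Ψ y i * Ψ v' i := by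
        rw [Finset.mul_sum, Finset.mul_sum, ← Finset.sum_add_distrib]
        apply Finset.sum_congr rfl; intro i _; simp; ring
      rw [e]
      calc _ ≤ a * s ^ 2 + b * s ^ 2 := by
            gcongr
            · exact hx v' hv'
            · exact hy v' hv'
        _ = s ^ 2 := by rw [← add_mul, hab, one_mul]
    · intro x hx v' hv'
      have := hx (-v') (hMs.2.2 _ hv')
      simpa using this
  have hsub : M ∩ S ⊆ LTr Ψ L s := by
    rintro v ⟨hv, hv'⟩
    refine ⟨hv.1, ?_⟩
    have := hv' v hv
    simpa [sq] using this
  have hΦc : Continuous Φ := Φ.continuous_of_finiteDimensional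
  set S' : Set (Fin N → ℝ) := {y | σ • Φ y ∈ S} with hS'
  have hS'c : IsClosed S' := hSs.1.preimage (hΦc.const_smul σ)
  have hS'sym : ∀ y ∈ S', -y ∈ S' := by
    intro y hy
    show σ • Φ (-y) ∈ S
    rw [map_neg, smul_neg]; exact hSs.2.2 _ hy
  -- Markov
  have hmark : ENNReal.ofReal (1 - δ) ≤ gam N S' := by
    have hsubset : {y | A / δ ≤ hsup Ψ L t y}ᶜ ⊆ S' := by
      intro y hy v' hv'
      have hy' : hsup Ψ L t y < A / δ := not_le.1 hy
      have e : ∑ i, Ψ (σ • Φ y) i * Ψ v' i = σ * ∑ i, y i * Ψ v' i := by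
        rw [h2 v' y, Finset.mul_sum]
        apply Finset.sum_congr rfl; intro i _; simp; ring
      rw [e]
      calc σ * ∑ i, y i * Ψ v' i ≤ σ * (A / δ) := by
            gcongr
            exact (le_hsup Ψ L hL hLc t y v' hv').trans hy'.le
        _ = s ^ 2 := by rw [hσ]; field_simp
    have hmeas : MeasurableSet {y | A / δ ≤ hsup Ψ L t y} :=
      (isClosed_le continuous_const (hsup_cont Ψ L hL hLc t)).measurableSet
    have hm := mul_meas_ge_le_integral_of_nonneg (μ := gam N)
      (Filter.Eventually.of_forall fun y => hsup_nonneg Ψ L hL hLc h0 t y) hint (A / δ)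
    have hm2 : (gam N).real {y | A / δ ≤ hsup Ψ L t y} ≤ δ := by
      have h3 : A / δ * (gam N).real {y | A / δ ≤ hsup Ψ L t y} ≤ A := hm.trans hle
      have h4 : A / δ * (gam N).real {y | A / δ ≤ hsup Ψ L t y} ≤ A / δ * δ := by
        rwa [div_mul_cancel₀ A hδ.ne']
      exact le_of_mul_le_mul_left h4 (by positivity)
    have h5 : 1 - δ ≤ (gam N).real {y | A / δ ≤ hsup Ψ L t y}ᶜ := by
      rw [probReal_compl_eq_one_sub hmeas]; linarith
    calc ENNReal.ofReal (1 - δ) ≤ ENNReal.ofReal ((gam N).real {y | A / δ ≤ hsup Ψ L t y}ᶜ) :=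
          ENNReal.ofReal_le_ofReal h5
      _ = gam N {y | A / δ ≤ hsup Ψ L t y}ᶜ := by simp
      _ ≤ _ := measure_mono hsubset
  -- shift
  have hshift : ∀ v ∈ M, ENNReal.ofReal ((1 - δ) * Real.exp (- (2 * A ^ 2 / (δ ^ 2 * s ^ 2)))) ≤
      gam N {y | v - σ • Φ y ∈ S} := by
    intro v hv
    have hset : {y | v - σ • Φ y ∈ S} = {y | y - σ⁻¹ • Ψ v ∈ S'} := by
      ext y
      have e : σ • Φ (y - σ⁻¹ • Ψ v) = - (v - σ • Φ y) := by
        rw [map_sub, map_smul, h1, smul_sub, smul_smul, mul_inv_cancel₀ hσ0.ne', one_smul]; abel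
      show v - σ • Φ y ∈ S ↔ σ • Φ (y - σ⁻¹ • Ψ v) ∈ S
      rw [e]
      exact ⟨fun h => hSs.2.2 _ h, fun h => by simpa using hSs.2.2 _ h⟩
    rw [hset]
    refine le_trans ?_ (gam_shift S' hS'c.measurableSet hS'sym _)
    rw [mul_comm, ENNReal.ofReal_mul (by positivity)]
    refine mul_le_mul' ?_ hmark
    apply ENNReal.ofReal_le_ofReal
    apply Real.exp_le_exp.2
    have e : ∑ i, (σ⁻¹ • Ψ v) i ^ 2 = σ⁻¹ ^ 2 * ∑ i, Ψ v i ^ 2 := by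
      rw [Finset.mul_sum]; apply Finset.sum_congr rfl; intro i _; simp; ring
    rw [e]
    have h6 : σ⁻¹ ^ 2 * ∑ i, Ψ v i ^ 2 ≤ σ⁻¹ ^ 2 * t ^ 2 := by
      gcongr; exact hv.2
    have h7 : σ⁻¹ ^ 2 * t ^ 2 / 2 = 2 * A ^ 2 / (δ ^ 2 * s ^ 2) := by
      rw [hσ, ht]; field_simp
    linarith
  -- Fubini
  set W : Set (V × (Fin N → ℝ)) := {p | p.1 ∈ M ∧ p.1 - σ • Φ p.2 ∈ S} with hW
  have hWm : MeasurableSet W := by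
    apply IsClosed.measurableSet
    apply IsClosed.inter
    · exact hMs.1.preimage continuous_fst
    · exact hSs.1.preimage (continuous_fst.sub ((hΦc.comp continuous_snd).const_smul σ))
  have hl : ENNReal.ofReal ((1 - δ) * Real.exp (- (2 * A ^ 2 / (δ ^ 2 * s ^ 2)))) * μ M ≤
      μ.prod (gam N) W := by
    rw [Measure.prod_apply hWm, ← lintegral_indicator_const hMs.1.measurableSet]
    apply lintegral_mono
    intro v
    by_cases hv : v ∈ M
    · rw [indicator_of_mem hv]
      refine (hshift v hv).trans (measure_mono ?_)
      intro y hy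
      exact ⟨hv, hy⟩
    · rw [indicator_of_notMem hv]; exact zero_le
  have hr : μ.prod (gam N) W ≤ μ (LTr Ψ L s) := by
    rw [Measure.prod_apply_symm hWm]
    calc _ ≤ ∫⁻ y, μ (M ∩ S) ∂(gam N) := by
          apply lintegral_mono
          intro y
          exact anderson μ M S hMs hSs (σ • Φ y)
      _ = μ (M ∩ S) := by simp
      _ ≤ _ := measure_mono hsub
  exact hl.trans hr

theorem hsup_int (L : Set V) (hL : SymC L) (hLc : IsCompact L) (h0 : (0:V) ∈ L) (t X n : ℝ)
    (hX : 0 ≤ X) (hn : 0 < n) (c : Fin N → ℝ) (hc : ∀ i, 0 ≤ c i) (hcs : ∑ i, c i = n)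
    (hrad : ∀ y : Fin N → ℝ, (∑ e : Fin N → Bool, hsup Ψ L t (fun i => sg (e i) * y i)) / 2 ^ N ≤
      X * Real.sqrt (∑ i, c i * y i ^ 2)) :
    Integrable (hsup Ψ L t) (gam N) ∧ ∫ y, hsup Ψ L t y ∂(gam N) ≤ X * Real.sqrt n := by
  set G : (Fin N → ℝ) → ℝ := fun y =>
    X * (Real.sqrt n / 2 + (∑ i, c i * y i ^ 2) / (2 * Real.sqrt n)) with hG
  have hsn : 0 < Real.sqrt n := Real.sqrt_pos.2 hn
  have hle : ∀ y : Fin N → ℝ,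
      (∑ e : Fin N → Bool, hsup Ψ L t (fun i => sg (e i) * y i)) / 2 ^ N ≤ G y := by
    intro y
    refine (hrad y).trans ?_
    simp only [hG]
    gcongr
    have hQ : 0 ≤ ∑ i, c i * y i ^ 2 := Finset.sum_nonneg fun i _ => mul_nonneg (hc i) (sq_nonneg _)
    set Q := ∑ i, c i * y i ^ 2
    have : Q = Real.sqrt Q ^ 2 := (Real.sq_sqrt hQ).symm
    have h3 : 2 * Real.sqrt n * Real.sqrt Q ≤ Real.sqrt n ^ 2 + Real.sqrt Q ^ 2 := two_mul_le_add_sq _ _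
    rw [← this] at h3
    have h4 : Real.sqrt n / 2 + Q / (2 * Real.sqrt n) = (Real.sqrt n ^ 2 + Q) / (2 * Real.sqrt n) := by
      field_simp
    rw [h4, le_div_iff₀ (by positivity)]
    linarith
  have hsumint : Integrable (fun y : Fin N → ℝ => ∑ i, c i * y i ^ 2) (gam N) :=
    integrable_finsetSum _ fun i _ => (gam_sq_integrable i).const_mul _
  have hGint : Integrable G (gam N) :=
    ((integrable_const _).add (hsumint.div_const _)).const_mul X
  have hGI : ∫ y, G y ∂(gam N) = X * Real.sqrt n := by
    simp only [hG]
    rw [integral_const_mul, integral_add (integrable_const _) (hsumint.div_const _), integral_div, integral_div,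
      integral_finsetSum _ fun i _ => (gam_sq_integrable i).const_mul _]
    simp only [integral_const_mul, gam_sq_integral, mul_one, hcs]
    simp only [integral_const, probReal_univ, one_smul]
    congr 1
    have := Real.sq_sqrt hn.le
    field_simp
    nlinarith
  have hcont := hsup_cont Ψ L hL hLc t
  have hnn := hsup_nonneg Ψ L hL hLc h0 t
  have hint : Integrable (hsup Ψ L t) (gam N) := by
    refine Integrable.mono' (hGint.const_mul (2 ^ N)) hcont.aestronglyMeasurable ?_
    refine Filter.Eventually.of_forall fun y => ?_
    rw [Real.norm_of_nonneg (hnn y)]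
    have h1 : hsup Ψ L t y ≤ ∑ e : Fin N → Bool, hsup Ψ L t (fun i => sg (e i) * y i) := by
      have := Finset.single_le_sum (s := Finset.univ)
        (f := fun e : Fin N → Bool => hsup Ψ L t (fun i => sg (e i) * y i))
        (fun e _ => hnn _) (Finset.mem_univ (fun _ => true))
      simpa [sg] using this
    refine h1.trans ?_
    have := hle y
    rw [div_le_iff₀ (by positivity)] at this
    linarith
  refine ⟨hint, ?_⟩
  have hsg : ∀ e : Fin N → Bool, ∀ i, sg (e i) = 1 ∨ sg (e i) = -1 := by
    intro e i; cases e i <;> simp [sg]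
  have hmp := fun e : Fin N → Bool => gam_mp_sign (fun i => sg (e i)) (hsg e)
  have hinte : ∀ e : Fin N → Bool, Integrable (fun y => hsup Ψ L t (fun i => sg (e i) * y i)) (gam N) :=
    fun e => (hmp e).integrable_comp_of_integrable hint
  have hIe : ∀ e : Fin N → Bool, ∫ y, hsup Ψ L t (fun i => sg (e i) * y i) ∂(gam N) =
      ∫ y, hsup Ψ L t y ∂(gam N) := by
    intro e
    have := integral_map (μ := gam N) (hmp e).measurable.aemeasurable (f := hsup Ψ L t)
      hcont.aestronglyMeasurable
    rw [(hmp e).map_eq] at this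
    exact this.symm
  have havg : ∫ y, (∑ e : Fin N → Bool, hsup Ψ L t (fun i => sg (e i) * y i)) / 2 ^ N ∂(gam N) =
      ∫ y, hsup Ψ L t y ∂(gam N) := by
    rw [integral_div, integral_finsetSum _ fun e _ => hinte e]
    simp only [hIe]
    simp
  rw [← havg, ← hGI]
  exact integral_mono ((integrable_finsetSum _ fun e _ => hinte e).div_const _) hGint hle
end GaussStep

theorem iter_bound (c1 : ℝ) (m D : ℝ) (hm : 1 ≤ m) (hD : 1 ≤ D) (g : ℝ → ENNReal)
    (hg : ∀ s δ : ℝ, 1 ≤ s → 0 < δ → δ < 1 →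
      ENNReal.ofReal ((1 - δ) * Real.exp (- (2 * (c1 * Real.sqrt m * D * Real.log (2 * s)) ^ 2 /
        (δ ^ 2 * s ^ 2)))) * g (2 * s) ≤ g s) (J : ℕ) :
    g (2 ^ J * (2 * hfun D)) ≤ ENNReal.ofReal (Real.exp ((54 * c1 ^ 2 + 10) * m)) * g (2 * hfun D) := by
  set T := 2 * hfun D with hT
  have hlog2 : 0.6931471803 < Real.log 2 := Real.log_two_gt_d9
  set l := Real.log (2 * D) with hl
  have hlD : Real.log 2 ≤ l := Real.log_le_log (by norm_num) (by linarith)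
  have hTl : T = 2 * D * l := by rw [hT, hfun, ← hl]; ring
  have hl0 : 0 < l := by linarith
  have hT1 : 1 ≤ T := by rw [hTl]; nlinarith
  have hlT : Real.log T ≤ 2 * l := by
    rw [hTl, Real.log_mul (by positivity) hl0.ne', ← hl]
    have := Real.log_le_sub_one_of_pos hl0
    linarith
  set b : ℕ → ℝ := fun j => 18 * c1 ^ 2 * (400/729) ^ j + (9/10) ^ j with hb
  have hstep : ∀ j : ℕ, g (2 ^ (j+1) * T) ≤ ENNReal.ofReal (Real.exp (b j * m)) * g (2 ^ j * T) := by
    intro j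
    set s := 2 ^ j * T with hs
    have h2j : (1:ℝ) ≤ 2 ^ j := one_le_pow₀ (by norm_num)
    have hs1 : 1 ≤ s := by rw [hs]; nlinarith
    set δ : ℝ := (1/2) * (9/10) ^ j with hδ
    have hδ0 : 0 < δ := by positivity
    have h9 : ((9:ℝ)/10) ^ j ≤ 1 := pow_le_one₀ (by norm_num) (by norm_num)
    have hδ1 : δ ≤ 1/2 := by rw [hδ]; linarith
    have h := hg s δ hs1 hδ0 (by linarith)
    have e2 : 2 * s = 2 ^ (j+1) * T := by rw [hs]; ring
    rw [e2] at h
    have hlogs : Real.log (2 ^ (j+1) * T) ≤ (j + 3) * l := by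
      rw [Real.log_mul (by positivity) (by positivity), Real.log_pow]
      push_cast
      have : ((j:ℝ) + 1) * Real.log 2 ≤ (j + 1) * l := by gcongr
      linarith
    have hlogs0 : 0 ≤ Real.log (2 ^ (j+1) * T) := by
      apply Real.log_nonneg; rw [← e2]; linarith
    have hbern : (j:ℝ) + 3 ≤ 3 * (4/3) ^ j := by
      have := one_add_mul_le_pow (a := (1/3:ℝ)) (by norm_num) j
      norm_num at this; linarith
    have hexpo : 2 * (c1 * Real.sqrt m * D * Real.log (2 ^ (j+1) * T)) ^ 2 / (δ ^ 2 * s ^ 2) ≤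
        18 * c1 ^ 2 * (400/729) ^ j * m := by
      have h1 : D * Real.log (2 ^ (j+1) * T) ≤ D * (3 * (4/3) ^ j * l) := by
        gcongr
        refine hlogs.trans ?_
        gcongr
      have h2 : (D * Real.log (2 ^ (j+1) * T)) ^ 2 ≤ (D * (3 * (4/3) ^ j * l)) ^ 2 := by
        gcongr
      have h3 : (c1 * Real.sqrt m * D * Real.log (2 ^ (j+1) * T)) ^ 2 =
          c1 ^ 2 * m * (D * Real.log (2 ^ (j+1) * T)) ^ 2 := by
        have := Real.sq_sqrt (by linarith : 0 ≤ m)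
        calc _ = c1 ^ 2 * (Real.sqrt m ^ 2) * (D * Real.log (2 ^ (j+1) * T)) ^ 2 := by ring
          _ = _ := by rw [this]
      rw [h3, div_le_iff₀ (by positivity)]
      have h4 : 18 * c1 ^ 2 * (400/729) ^ j * m * (δ ^ 2 * s ^ 2) =
          2 * (c1 ^ 2 * m * (D * (3 * (4/3) ^ j * l)) ^ 2) := by
        rw [hδ, hs, hTl]
        have e : ((400:ℝ)/729) ^ j = (((4:ℝ)/3) ^ j) ^ 2 * ((((10:ℝ)/9) ^ j) ^ 2 * (((1:ℝ)/2) ^ j) ^ 2) := by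
          rw [← pow_mul, ← pow_mul, ← pow_mul, mul_comm j 2, pow_mul, pow_mul, pow_mul, ← mul_pow, ← mul_pow]
          norm_num
        have e1 : ((10:ℝ)/9) ^ j * (9/10) ^ j = 1 := by rw [← mul_pow]; norm_num
        have e2 : ((1:ℝ)/2) ^ j * 2 ^ j = 1 := by rw [← mul_pow]; norm_num
        rw [e]
        calc _ = 18 * c1 ^ 2 * (((4:ℝ)/3) ^ j) ^ 2 * m * D ^ 2 * l ^ 2 *
              ((((10:ℝ)/9) ^ j * (9/10) ^ j) ^ 2 * ((((1:ℝ)/2) ^ j * 2 ^ j)) ^ 2) := by ring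
          _ = _ := by rw [e1, e2]; ring
      rw [h4]
      gcongr
    have h1δ : Real.exp (-(9/10) ^ j) ≤ 1 - δ := by
      have h1 : Real.exp (-(9/10) ^ j) * Real.exp ((9/10) ^ j) = 1 := by rw [← Real.exp_add]; simp
      have h2 : 2 * δ + 1 ≤ Real.exp ((9/10) ^ j) := by
        have := Real.add_one_le_exp (((9:ℝ)/10) ^ j)
        rw [hδ]; linarith
      have h3 : 1 ≤ (1 - δ) * Real.exp ((9/10) ^ j) := by nlinarith
      have h4 : 0 < Real.exp ((9/10:ℝ) ^ j) := Real.exp_pos _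
      by_contra hcon
      push Not at hcon
      nlinarith
    have hlow : Real.exp (- (b j * m)) ≤ (1 - δ) * Real.exp (- (2 * (c1 * Real.sqrt m * D *
        Real.log (2 ^ (j+1) * T)) ^ 2 / (δ ^ 2 * s ^ 2))) := by
      calc Real.exp (- (b j * m)) ≤ Real.exp (-(9/10) ^ j) * Real.exp (-(18 * c1 ^ 2 * (400/729) ^ j * m)) := by
            rw [← Real.exp_add, hb]
            apply Real.exp_le_exp.2
            have : (9/10:ℝ) ^ j * 1 ≤ (9/10) ^ j * m := by gcongr
            simp only; nlinarith
        _ ≤ _ := by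
            gcongr
            linarith
    have h5 := (mul_le_mul_left (ENNReal.ofReal_le_ofReal hlow) (g (2 ^ (j+1) * T))).trans h
    calc g (2 ^ (j+1) * T) = ENNReal.ofReal (Real.exp (b j * m)) *
          (ENNReal.ofReal (Real.exp (-(b j * m))) * g (2 ^ (j+1) * T)) := by
          rw [← mul_assoc (ENNReal.ofReal _), ← ENNReal.ofReal_mul (by positivity), ← Real.exp_add]; simp
      _ ≤ _ := by gcongr
  have hind : ∀ J : ℕ, g (2 ^ J * T) ≤
      ENNReal.ofReal (Real.exp ((∑ j ∈ Finset.range J, b j) * m)) * g T := by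
    intro J
    induction J with
    | zero => simp
    | succ J ih =>
      refine (hstep J).trans ?_
      have e : Real.exp ((∑ j ∈ Finset.range (J+1), b j) * m) =
          Real.exp (b J * m) * Real.exp ((∑ j ∈ Finset.range J, b j) * m) := by
        rw [Finset.sum_range_succ, ← Real.exp_add]; congr 1; ring
      rw [e, ENNReal.ofReal_mul (Real.exp_pos _).le, mul_assoc]
      exact mul_le_mul' le_rfl ih
  refine (hind J).trans ?_
  gcongr
  have g1 : ∑ j ∈ Finset.range J, ((400:ℝ)/729) ^ j ≤ 3 := by
    rw [geom_sum_eq (by norm_num)]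
    have : (0:ℝ) < (400/729) ^ J := by positivity
    rw [div_le_iff_of_neg (by norm_num)]; linarith
  have g2 : ∑ j ∈ Finset.range J, ((9:ℝ)/10) ^ j ≤ 10 := by
    rw [geom_sum_eq (by norm_num)]
    have : (0:ℝ) < (9/10) ^ J := by positivity
    rw [div_le_iff_of_neg (by norm_num)]; linarith
  rw [hb, Finset.sum_add_distrib, ← Finset.mul_sum]
  nlinarith [sq_nonneg c1]

lemma sum_embed {ι κ X : Type*} [Fintype ι] [Fintype κ] [AddCommMonoid X] (f : ι ↪ κ) (g : κ → X)
    (hg : ∀ k, k ∉ Set.range f → g k = 0) : ∑ k, g k = ∑ i, g (f i) := by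
  classical
  rw [← Finset.sum_map Finset.univ f g]
  symm
  apply Finset.sum_subset (Finset.subset_univ _)
  intro k _ hk
  apply hg
  simpa using hk

lemma compact_convexHull' {W : Type*} [NormedAddCommGroup W] [NormedSpace ℝ W] [FiniteDimensional ℝ W]
    (s : Set W) (hs : IsCompact s) (hne : s.Nonempty) : IsCompact (convexHull ℝ s) := by
  classical
  set d := Module.finrank ℝ W
  obtain ⟨s0, hs0⟩ := hne
  have himg : convexHull ℝ s = (fun q : (Fin (d+1) → ℝ) × (Fin (d+1) → W) => ∑ k, q.1 k • q.2 k) ''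
      (stdSimplex ℝ (Fin (d+1)) ×ˢ Set.univ.pi fun _ => s) := by
    ext x
    constructor
    · intro hx
      obtain ⟨ι, _, z, w, hz, haff, hw, hw1, hx⟩ := eq_pos_convex_span_of_mem_convexHull hx
      have hcard : Fintype.card ι ≤ Fintype.card (Fin (d+1)) := by
        rw [Fintype.card_fin]
        exact haff.card_le_finrank_succ.trans (Nat.succ_le_succ (Submodule.finrank_le _))
      obtain ⟨f⟩ := Function.Embedding.nonempty_of_card_le hcard
      set w' : Fin (d+1) → ℝ := Function.extend f w 0 with hw'
      set z' : Fin (d+1) → W := Function.extend f z (fun _ => s0) with hz'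
      have hwf : ∀ i, w' (f i) = w i := fun i => f.injective.extend_apply _ _ _
      have hzf : ∀ i, z' (f i) = z i := fun i => f.injective.extend_apply _ _ _
      have hw0 : ∀ k, k ∉ Set.range f → w' k = 0 := by
        intro k hk
        rw [hw', Function.extend_apply' _ _ _ (by simpa using hk)]; rfl
      refine ⟨(w', z'), ⟨⟨?_, ?_⟩, ?_⟩, ?_⟩
      · intro k
        by_cases hk : k ∈ Set.range f
        · obtain ⟨i, rfl⟩ := hk
          show 0 ≤ w' (f i)
          rw [hwf]; exact (hw i).le
        · show 0 ≤ w' k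
          rw [hw0 k hk]
      · show ∑ k, w' k = 1
        rw [sum_embed f _ hw0, ← hw1]; simp [hwf]
      · intro k _
        show z' k ∈ s
        by_cases hk : k ∈ Set.range f
        · obtain ⟨i, rfl⟩ := hk
          rw [hzf]; exact hz ⟨i, rfl⟩
        · rw [hz', Function.extend_apply' _ _ _ (by simpa using hk)]; exact hs0
      · show ∑ k, w' k • z' k = x
        rw [sum_embed f (fun k => w' k • z' k) (fun k hk => by rw [hw0 k hk, zero_smul]), ← hx]; simp [hwf, hzf]
    · rintro ⟨⟨w, z⟩, ⟨hw, hz⟩, rfl⟩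
      exact (convex_convexHull ℝ s).sum_mem (fun i _ => hw.1 i) hw.2
        (fun i _ => subset_convexHull ℝ s (hz i (Set.mem_univ _)))
  rw [himg]
  apply IsCompact.image
  · exact (isCompact_stdSimplex ℝ _).prod (isCompact_univ_pi fun _ => hs)
  · fun_prop

lemma bipolar' {H : Type*} [NormedAddCommGroup H] [InnerProductSpace ℝ H] [CompleteSpace H]
    (K : Set H) (hK : Convex ℝ K) (hKc : IsClosed K) (h0 : (0:H) ∈ K) (x : H)
    (hx : ∀ v : H, (∀ k ∈ K, inner ℝ k v ≤ 1) → inner ℝ x v ≤ 1) : x ∈ K := by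
  by_contra hxK
  obtain ⟨f, u, hf, hfx⟩ := geometric_hahn_banach_closed_point hK hKc hxK
  have hu : 0 < u := by simpa using hf 0 h0
  set v0 := (InnerProductSpace.toDual ℝ H).symm f with hv0
  have hv : ∀ y, inner ℝ y (u⁻¹ • v0) = u⁻¹ * f y := by
    intro y
    rw [real_inner_smul_right, real_inner_comm, hv0, InnerProductSpace.toDual_symm_apply]
  have := hx (u⁻¹ • v0) (by
    intro k hk
    rw [hv, inv_mul_le_iff₀ hu]; simpa using (hf k hk).le)
  rw [hv, inv_mul_le_iff₀ hu] at this
  linarith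

lemma det_trace_le {n : ℕ} (A : Matrix (Fin n) (Fin n) ℝ) (l : ℝ)
    (h : ∀ ε : ℝ, 0 < ε → (1 + ε • A).det ≤ (1 + ε * l) ^ n) : A.trace ≤ n * l := by
  set q := (1 + (Polynomial.X : Polynomial ℝ) • A.map (Polynomial.C : ℝ →+* Polynomial ℝ) : Matrix (Fin n) (Fin n) (Polynomial ℝ)).det.divX.divX with hq
  set f : ℝ → ℝ := fun ε => 1 + A.trace * ε + Polynomial.eval ε q * ε ^ 2 - (1 + ε * l) ^ n with hf
  have hd : HasDerivAt f (A.trace - n * l) 0 := by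
    have h1 : HasDerivAt (fun ε : ℝ => 1 + A.trace * ε) (A.trace * 1) 0 :=
      ((hasDerivAt_id (0:ℝ)).const_mul A.trace).const_add 1
    have h2 := (q.hasDerivAt 0).mul ((hasDerivAt_id (0:ℝ)).pow 2)
    have h3 := (((hasDerivAt_id (0:ℝ)).mul_const l).const_add 1).pow n
    have := (h1.add h2).sub h3
    exact HasDerivAt.congr_deriv this (by simp)
  rw [hasDerivAt_iff_tendsto_slope] at hd
  have hd' := hd.mono_left (nhdsWithin_mono (0:ℝ) (fun x (hx : x ∈ Set.Ioi (0:ℝ)) => ne_of_gt hx))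
  have : A.trace - n * l ≤ 0 := by
    apply le_of_tendsto hd'
    filter_upwards [self_mem_nhdsWithin] with ε hε
    have hε' : 0 < ε := hε
    rw [slope_def_field]
    have f0 : f 0 = 0 := by simp [hf]
    have fe : f ε ≤ 0 := by
      have := h ε hε'
      rw [Matrix.det_one_add_smul] at this
      simp only [hf]; linarith
    rw [f0]
    apply div_nonpos_of_nonpos_of_nonneg <;> linarith
  linarith

theorem john {n : ℕ} (hn : 0 < n) (K : Set (EuclideanSpace ℝ (Fin n))) (hK : Convex ℝ K)
    (hKc : IsClosed K) (hB : closedBall 0 1 ⊆ K)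
    (hmax : ∀ S : EuclideanSpace ℝ (Fin n) →ₗ[ℝ] EuclideanSpace ℝ (Fin n),
      (∀ x ∈ closedBall (0:EuclideanSpace ℝ (Fin n)) 1, S x ∈ K) → |LinearMap.det S| ≤ 1) :
    ∃ (N : ℕ) (c : Fin N → ℝ) (u : Fin N → EuclideanSpace ℝ (Fin n)),
      (∀ i, 0 ≤ c i) ∧ ∑ i, c i = n ∧ (∀ i, ∀ x ∈ K, inner ℝ x (u i) ≤ 1) ∧
      ∀ x, ∑ i, (c i * inner ℝ x (u i)) • u i = x := by
  classical
  have hinner : ∀ x y : EuclideanSpace ℝ (Fin n), inner ℝ x y = ∑ i, x i * y i := by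
    intro x y
    rw [PiLp.inner_apply]
    apply Finset.sum_congr rfl; intro i _; simp [mul_comm]
  have h0K : (0:EuclideanSpace ℝ (Fin n)) ∈ K := hB (by simp)
  set Ko : Set (EuclideanSpace ℝ (Fin n)) := {v | ∀ k ∈ K, inner ℝ k v ≤ 1} with hKo
  have hKoB : Ko ⊆ closedBall 0 1 := by
    intro v hv
    rw [mem_closedBall_zero_iff]
    by_cases hv0 : v = 0
    · simp [hv0]
    have := hv (‖v‖⁻¹ • v) (hB (by
      rw [mem_closedBall_zero_iff, norm_smul, norm_inv, norm_norm, inv_mul_cancel₀ (norm_ne_zero_iff.2 hv0)]))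
    rw [real_inner_smul_left, real_inner_self_eq_norm_sq, sq, ← mul_assoc,
      inv_mul_cancel₀ (norm_ne_zero_iff.2 hv0), one_mul] at this
    exact this
  have hKocl : IsClosed Ko := by
    have : Ko = ⋂ k ∈ K, {v | inner ℝ k v ≤ 1} := by ext; simp [hKo]
    rw [this]
    exact isClosed_biInter fun k _ => isClosed_le (by fun_prop) continuous_const
  have hKoc : IsCompact Ko := (isCompact_closedBall (0:EuclideanSpace ℝ (Fin n)) 1).of_isClosed_subset hKocl hKoB
  set P : Set (Fin n × Fin n → ℝ) := (fun q : EuclideanSpace ℝ (Fin n) × EuclideanSpace ℝ (Fin n) => fun p => q.1 p.1 * q.2 p.2) ''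
    (closedBall 0 1 ×ˢ Ko) with hP
  have hPc : IsCompact P := by
    apply ((isCompact_closedBall (0:EuclideanSpace ℝ (Fin n)) 1).prod hKoc).image
    fun_prop
  have h0Ko : (0:EuclideanSpace ℝ (Fin n)) ∈ Ko := by intro k _; simp
  have hP0 : (0 : Fin n × Fin n → ℝ) ∈ P := ⟨(0,0), ⟨by simp, h0Ko⟩, by ext; simp⟩
  set Q := convexHull ℝ P with hQ
  have hQc : IsCompact Q := compact_convexHull' P hPc ⟨0, hP0⟩
  set I0 : Fin n × Fin n → ℝ := fun p => if p.1 = p.2 then (1 / n : ℝ) else 0 with hI0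
  have hn' : (0:ℝ) < n := by exact_mod_cast hn
  have hmem : I0 ∈ Q := by
    by_contra hnot
    obtain ⟨φ, l, hφ, hφI⟩ := geometric_hahn_banach_closed_point (convex_convexHull ℝ P) hQc.isClosed hnot
    have hl : 0 < l := by simpa using hφ 0 (subset_convexHull ℝ P hP0)
    set T : Fin n × Fin n → ℝ := fun p => φ (fun j => if p = j then 1 else 0) with hT
    have hφT : ∀ M : Fin n × Fin n → ℝ, φ M = ∑ p, M p * T p := by
      intro M
      exact LinearMap.pi_apply_eq_sum_univ φ.toLinearMap M
    set A : Matrix (Fin n) (Fin n) ℝ := fun j i => T (i, j) with hA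
    have htr : A.trace ≤ n * l := by
      apply det_trace_le
      intro ε hε
      have hr : 0 < 1 + ε * l := by positivity
      set S : EuclideanSpace ℝ (Fin n) →ₗ[ℝ] EuclideanSpace ℝ (Fin n) := (1 + ε * l)⁻¹ • Matrix.toLpLin 2 2 (1 + ε • A) with hS
      have hdet : LinearMap.det S = ((1 + ε * l)⁻¹) ^ n * (1 + ε • A).det := by
        rw [hS, LinearMap.det_smul, Matrix.toLpLin_eq_toLin, LinearMap.det_toLin]
        simp
      have hSK : ∀ x ∈ closedBall (0:EuclideanSpace ℝ (Fin n)) 1, S x ∈ K := by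
        intro x hx
        apply bipolar' K hK hKc h0K
        intro v hv
        have e1 : inner ℝ (S x) v = (1 + ε * l)⁻¹ * (inner ℝ x v + ε * φ (fun p => x p.1 * v p.2)) := by
          rw [hS, LinearMap.smul_apply, real_inner_smul_left]
          congr 1
          rw [Matrix.toLpLin_apply, hinner, hinner, hφT, Fintype.sum_prod_type]
          rw [Finset.sum_comm, Finset.mul_sum, ← Finset.sum_add_distrib]
          apply Finset.sum_congr rfl
          intro j _
          have e0 : ((1 + ε • A).mulVec x.ofLp) j = x.ofLp j + ε * ∑ i, T (i, j) * x.ofLp i := by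
            rw [Matrix.add_mulVec, Matrix.one_mulVec, Matrix.smul_mulVec]
            rfl
          show ((1 + ε • A).mulVec x.ofLp) j * v.ofLp j = _
          rw [e0, add_mul, mul_assoc, Finset.sum_mul]
          congr 2
          apply Finset.sum_congr rfl; intro i _; ring
        rw [e1, inv_mul_le_iff₀ hr, mul_one]
        have e2 : φ (fun p => x p.1 * v p.2) < l :=
          hφ _ (subset_convexHull ℝ P ⟨(x, v), ⟨hx, hv⟩, rfl⟩)
        have e3 : inner ℝ x v ≤ 1 := hv x (hB hx)
        nlinarith
      have := (le_abs_self _).trans (hmax S hSK)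
      rw [hdet, inv_pow, inv_mul_le_iff₀ (by positivity), mul_one] at this
      exact this
    have hI : φ I0 = A.trace / n := by
      rw [hφT, Fintype.sum_prod_type, Matrix.trace, Finset.sum_div]
      apply Finset.sum_congr rfl; intro i _
      simp [hI0, hA, Matrix.diag]
      ring
    rw [hI, lt_div_iff₀ hn'] at hφI
    linarith
  obtain ⟨ι, _, z, w, hz, _, hw, hw1, hx⟩ := eq_pos_convex_span_of_mem_convexHull hmem
  have hz' : ∀ i, ∃ q : EuclideanSpace ℝ (Fin n) × EuclideanSpace ℝ (Fin n), q.1 ∈ closedBall (0:EuclideanSpace ℝ (Fin n)) 1 ∧ q.2 ∈ Ko ∧ (fun p : Fin n × Fin n => q.1 p.1 * q.2 p.2) = z i := by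
    intro i
    obtain ⟨q, ⟨hq1, hq2⟩, hq⟩ := hz ⟨i, rfl⟩
    exact ⟨q, hq1, hq2, hq⟩
  choose q hq1 hq2 hq using hz'
  have hcoord : ∀ a b : Fin n, ∑ i, w i * ((q i).1 a * (q i).2 b) = if a = b then (1 / n : ℝ) else 0 := by
    intro a b
    have := congrFun hx (a, b)
    simp only [Finset.sum_apply, Pi.smul_apply, smul_eq_mul, ← hq, hI0] at this
    exact this
  have htrace : ∑ i, w i * inner ℝ (q i).1 (q i).2 = 1 := by
    simp only [hinner, Finset.mul_sum]
    rw [Finset.sum_comm]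
    simp only [hcoord]
    simp [hn'.ne']
  have hle1 : ∀ i, inner ℝ (q i).1 (q i).2 ≤ 1 := fun i => hq2 i _ (hB (hq1 i))
  have hzero : ∀ i, w i * (1 - inner ℝ (q i).1 (q i).2) = 0 := by
    have hs : ∑ i, w i * (1 - inner ℝ (q i).1 (q i).2) = 0 := by
      simp only [mul_sub, mul_one, Finset.sum_sub_distrib, hw1, htrace, sub_self]
    intro i
    exact (Finset.sum_eq_zero_iff_of_nonneg (fun i _ => mul_nonneg (hw i).le (by linarith [hle1 i]))).1 hs i
      (Finset.mem_univ i)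
  have heq : ∀ i, (q i).1 = (q i).2 := by
    intro i
    have h1 : inner ℝ (q i).1 (q i).2 = 1 := by
      rcases mul_eq_zero.1 (hzero i) with h | h
      · exact absurd h (hw i).ne'
      · linarith
    have h2 : ‖(q i).1‖ ≤ 1 := mem_closedBall_zero_iff.1 (hq1 i)
    have h3 : ‖(q i).2‖ ≤ 1 := mem_closedBall_zero_iff.1 (hKoB (hq2 i))
    have h4 := norm_sub_sq_real (q i).1 (q i).2
    rw [h1] at h4
    have h5 : ‖(q i).1 - (q i).2‖ ^ 2 ≤ 0 := by
      rw [h4]; nlinarith [norm_nonneg (q i).1, norm_nonneg (q i).2]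
    have h6 : ‖(q i).1 - (q i).2‖ = 0 := by
      apply pow_eq_zero_iff (two_ne_zero) |>.1
      exact le_antisymm h5 (sq_nonneg _)
    exact sub_eq_zero.1 (norm_eq_zero.1 h6)
  set e := (Fintype.equivFin ι).symm
  refine ⟨Fintype.card ι, fun k => n * w (e k), fun k => (q (e k)).2, ?_, ?_, ?_, ?_⟩
  · intro k; exact mul_nonneg hn'.le (hw _).le
  · rw [← Finset.mul_sum, e.sum_comp w, hw1, mul_one]
  · intro k x hx; exact hq2 _ x hx
  · intro x
    rw [e.sum_comp (fun i => ((n * w i) * inner ℝ x (q i).2) • (q i).2)]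
    ext a
    have : (∑ i, ((n * w i) * inner ℝ x (q i).2) • (q i).2) a =
        ∑ i, (n * w i) * inner ℝ x (q i).2 * (q i).2 a := by simp
    rw [this]
    simp only [hinner, Finset.mul_sum, Finset.sum_mul]
    rw [Finset.sum_comm]
    have e2 : ∀ b : Fin n, ∑ i, (n * w i) * (x b * (q i).2 b) * (q i).2 a = x b * (n * (if a = b then (1 / n : ℝ) else 0)) := by
      intro b
      rw [← hcoord a b, Finset.mul_sum, Finset.mul_sum]
      apply Finset.sum_congr rfl; intro i _
      rw [heq i]; ring
    simp only [e2]
    simp [hn'.ne']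

lemma scb_nhds {n : ℕ} (K : Set (EuclideanSpace ℝ (Fin n))) (hK : IsSymmetricConvexBody K) :
    K ∈ nhds (0 : EuclideanSpace ℝ (Fin n)) := by
  obtain ⟨hc, _, ⟨x, hx⟩, hs⟩ := hK
  have hx' : -x ∈ interior K := by
    have : interior K = -interior K := by
      conv_lhs => rw [hs]
      exact ((Homeomorph.neg (EuclideanSpace ℝ (Fin n))).preimage_interior K).symm
    rw [this]; simpa using hx
  rw [_root_.mem_nhds_iff]
  refine ⟨interior K, interior_subset, isOpen_interior, ?_⟩
  have := hc.interior hx hx' (by norm_num : (0:ℝ) ≤ 1/2) (by norm_num : (0:ℝ) ≤ 1/2) (by norm_num)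
  simpa using this

lemma rad_parseval {H : Type*} [NormedAddCommGroup H] [InnerProductSpace ℝ H] {N : ℕ} (x : Fin N → H) :
    ∑ e : Fin N → Bool, ‖∑ j, sg (e j) • x j‖ ^ 2 = 2 ^ N * ∑ j, ‖x j‖ ^ 2 := by
  classical
  have h : ∀ e : Fin N → Bool, ‖∑ S, sg (e S) • x S‖ ^ 2 =
      ∑ S, ∑ T, (wal {S} e * wal {T} e) * inner ℝ (x S) (x T) := by
    intro e
    rw [← real_inner_self_eq_norm_sq, sum_inner]
    apply Finset.sum_congr rfl; intro S _
    rw [inner_sum]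
    apply Finset.sum_congr rfl; intro T _
    rw [real_inner_smul_left, real_inner_smul_right]; simp [wal]; ring
  simp_rw [h]
  rw [Finset.sum_comm, Finset.mul_sum]
  apply Finset.sum_congr rfl; intro S _
  rw [Finset.sum_comm]
  simp_rw [← Finset.sum_mul, wal_orth]
  simp

lemma cotype_props {n : ℕ} (hn : 0 < n) (K : Set (EuclideanSpace ℝ (Fin n)))
    (hK : IsSymmetricConvexBody K) : 1 ≤ cotype2Const K ∧
    ∀ (m : ℕ) (x : Fin m → EuclideanSpace ℝ (Fin n)), ∑ j, gauge K (x j) ^ 2 ≤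
      cotype2Const K ^ 2 * ((∑ e : Fin m → Bool, gauge K (∑ j, sg (e j) • x j) ^ 2) / 2 ^ m) := by
  have hnh := scb_nhds K hK
  have habs : Absorbent ℝ K := absorbent_nhds_zero hnh
  obtain ⟨hc, hcomp, _, hs⟩ := hK
  obtain ⟨r, hr, hrK⟩ := Metric.mem_nhds_iff.1 hnh
  obtain ⟨R, hR, hKR⟩ := hcomp.isBounded.subset_closedBall_lt 0 0
  have hup : ∀ x, gauge K x ≤ r⁻¹ * ‖x‖ := by
    intro x
    rw [inv_mul_eq_div, le_div_iff₀ hr, mul_comm]; exact mul_gauge_le_norm hrK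
  have hlo : ∀ x, ‖x‖ ≤ R * gauge K x := by
    intro x
    have := le_gauge_of_subset_closedBall (x := x) habs hR.le hKR
    rw [div_le_iff₀ hR] at this; linarith
  set S := {l : ℝ | 0 < l ∧ ∀ (m : ℕ) (x : Fin m → EuclideanSpace ℝ (Fin n)),
    (1 / l) * Real.sqrt (∑ j, gauge K (x j) ^ 2) ≤
      Real.sqrt ((∑ ε : Fin m → Bool,
        gauge K (∑ j, (if ε j then (1 : ℝ) else -1) • x j) ^ 2) / 2 ^ m)} with hS
  have hCS : cotype2Const K = sInf S := rfl
  have hne : S.Nonempty := by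
    refine ⟨R / r, by positivity, ?_⟩
    intro m x
    have h1 : ∑ j, gauge K (x j) ^ 2 ≤ r⁻¹ ^ 2 * ∑ j, ‖x j‖ ^ 2 := by
      rw [Finset.mul_sum]
      apply Finset.sum_le_sum; intro j _
      rw [← mul_pow]
      exact pow_le_pow_left₀ (gauge_nonneg _) (hup _) 2
    have h2 : ∑ j, ‖x j‖ ^ 2 ≤ R ^ 2 * ((∑ ε : Fin m → Bool,
        gauge K (∑ j, sg (ε j) • x j) ^ 2) / 2 ^ m) := by
      rw [← mul_div_assoc, le_div_iff₀ (by positivity), mul_comm, ← rad_parseval, Finset.mul_sum]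
      apply Finset.sum_le_sum; intro e _
      rw [← mul_pow]
      exact pow_le_pow_left₀ (norm_nonneg _) (hlo _) 2
    show _ ≤ Real.sqrt ((∑ ε : Fin m → Bool, gauge K (∑ j, sg (ε j) • x j) ^ 2) / 2 ^ m)
    apply Real.le_sqrt_of_sq_le
    rw [mul_pow, Real.sq_sqrt (Finset.sum_nonneg fun _ _ => sq_nonneg _)]
    have h3 : ∑ j, gauge K (x j) ^ 2 ≤ (R / r) ^ 2 * ((∑ ε : Fin m → Bool,
        gauge K (∑ j, sg (ε j) • x j) ^ 2) / 2 ^ m) := by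
      refine h1.trans ((mul_le_mul_of_nonneg_left h2 (sq_nonneg _)).trans (le_of_eq ?_))
      rw [← mul_assoc]; congr 1; field_simp
    rw [one_div, inv_pow, inv_mul_le_iff₀ (by positivity)]
    exact h3
  have hone : ∀ l ∈ S, 1 ≤ l := by
    intro l hl
    obtain ⟨hl0, hl⟩ := hl
    set v : EuclideanSpace ℝ (Fin n) := EuclideanSpace.single ⟨0, hn⟩ 1 with hv
    have hvn : ‖v‖ = 1 := by simp [hv]
    have hg : 0 < gauge K v := by
      have := hlo v
      rw [hvn] at this
      by_contra h
      nlinarith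
    have hneg : gauge K (-v) = gauge K v := by
      apply gauge_neg
      intro x hx; rw [hs]; simpa using hx
    have := hl 1 (fun _ => v)
    have e1 : ∀ ε : Fin 1 → Bool, gauge K (∑ j, (if ε j then (1 : ℝ) else -1) • v) = gauge K v := by
      intro ε
      rw [Fin.sum_univ_one]
      split_ifs
      · simp
      · simpa using hneg
    simp only [e1] at this
    simp only [Finset.sum_const, Finset.card_univ, Fintype.card_fin, Fintype.card_fun, Fintype.card_bool, nsmul_eq_mul] at this
    have e2 : ((2 ^ 1 : ℕ) : ℝ) * gauge K v ^ 2 / 2 ^ 1 = gauge K v ^ 2 := by push_cast; ring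
    rw [e2, Nat.cast_one, one_mul, Real.sqrt_sq hg.le, one_div, inv_mul_le_iff₀ hl0] at this
    nlinarith
  refine ⟨by rw [hCS]; exact le_csInf hne hone, ?_⟩
  intro m x
  set b := (∑ e : Fin m → Bool, gauge K (∑ j, sg (e j) • x j) ^ 2) / 2 ^ m with hb
  set a := ∑ j, gauge K (x j) ^ 2 with ha
  have hb0 : 0 ≤ b := by positivity
  have ha0 : 0 ≤ a := Finset.sum_nonneg fun _ _ => sq_nonneg _
  have h1 : ∀ l ∈ S, Real.sqrt a ≤ l * Real.sqrt b := by
    intro l hl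
    have := hl.2 m x
    rw [one_div, inv_mul_le_iff₀ hl.1] at this
    exact this
  have hC1 : 1 ≤ sInf S := le_csInf hne hone
  have h2 : Real.sqrt a ≤ sInf S * Real.sqrt b := by
    rcases (Real.sqrt_nonneg b).eq_or_lt with h0 | h0
    · obtain ⟨l, hl⟩ := hne
      have := h1 l hl
      rw [← h0] at this ⊢; simpa using this
    · rw [← div_le_iff₀ h0]
      apply le_csInf hne
      intro l hl
      rw [div_le_iff₀ h0]; exact h1 l hl
  rw [hCS]
  have h3 := pow_le_pow_left₀ (Real.sqrt_nonneg a) h2 2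
  rwa [Real.sq_sqrt ha0, mul_pow, Real.sq_sqrt hb0] at h3

lemma hmax_of {n : ℕ} (K : Set (EuclideanSpace ℝ (Fin n)))
    (T : EuclideanSpace ℝ (Fin n) ≃ₗ[ℝ] EuclideanSpace ℝ (Fin n))
    (hE : IsMaxVolEllipsoidIn (T '' closedBall 0 1) K)
    (S : EuclideanSpace ℝ (Fin n) →ₗ[ℝ] EuclideanSpace ℝ (Fin n))
    (hS : ∀ x ∈ closedBall (0:EuclideanSpace ℝ (Fin n)) 1, S x ∈ T ⁻¹' K) : |LinearMap.det S| ≤ 1 := by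
  by_cases h0 : LinearMap.det S = 0
  · simp [h0]
  set S' := LinearMap.equivOfDetNeZero S h0 with hS'
  have hSS : ∀ x, S' x = S x := fun x => rfl
  have hm := hE.2.2 ((S'.trans T) '' closedBall 0 1) ⟨_, rfl⟩ (by
    rintro _ ⟨x, hx, rfl⟩
    exact hS x hx)
  have e1 : (S'.trans T : EuclideanSpace ℝ (Fin n) → EuclideanSpace ℝ (Fin n)) '' closedBall 0 1 =
      (T.toLinearMap ∘ₗ S) '' closedBall 0 1 := rfl
  have e2 : (T : EuclideanSpace ℝ (Fin n) → EuclideanSpace ℝ (Fin n)) '' closedBall 0 1 =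
      T.toLinearMap '' closedBall 0 1 := rfl
  rw [e1, e2, Measure.addHaar_image_linearMap, Measure.addHaar_image_linearMap] at hm
  have hv0 : volume (closedBall (0:EuclideanSpace ℝ (Fin n)) 1) ≠ 0 :=
    (measure_closedBall_pos volume _ one_pos).ne'
  have hvt : volume (closedBall (0:EuclideanSpace ℝ (Fin n)) 1) ≠ ⊤ := measure_closedBall_lt_top.ne
  rw [ENNReal.mul_le_mul_iff_left hv0 hvt, LinearMap.det_comp, abs_mul,
    ENNReal.ofReal_le_ofReal_iff (abs_nonneg _)] at hm
  have hT : 0 < |LinearMap.det T.toLinearMap| := abs_pos.2 (LinearEquiv.isUnit_det' T).ne_zero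
  nlinarith

lemma psi_phi {H V : Type*} [NormedAddCommGroup H] [InnerProductSpace ℝ H] [FiniteDimensional ℝ H]
    [AddCommGroup V] [Module ℝ V] (A : V →ₗ[ℝ] H) (hA : Function.Injective A)
    {N : ℕ} (c : Fin N → ℝ) (u : Fin N → H) (hc : ∀ i, 0 ≤ c i)
    (hu : ∀ x, ∑ i, (c i * inner ℝ x (u i)) • u i = x) :
    ∃ (Ψ : V →ₗ[ℝ] (Fin N → ℝ)) (Φ : (Fin N → ℝ) →ₗ[ℝ] V),
      (∀ v i, Ψ v i = Real.sqrt (c i) * inner ℝ (A v) (u i)) ∧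
      (∀ v, Φ (Ψ v) = v) ∧
      (∀ v y, ∑ i, y i * Ψ v i = ∑ i, Ψ (Φ y) i * Ψ v i) ∧
      (∀ v, ∑ i, Ψ v i ^ 2 = ‖A v‖ ^ 2) := by
  classical
  set Ψ : V →ₗ[ℝ] (Fin N → ℝ) := LinearMap.pi fun i =>
    (Real.sqrt (c i)) • ((innerₗ H (u i)) ∘ₗ A) with hΨ
  have hΨv : ∀ v i, Ψ v i = Real.sqrt (c i) * inner ℝ (A v) (u i) := by
    intro v i
    simp [hΨ, real_inner_comm]
  set W : (Fin N → ℝ) →ₗ[ℝ] H := ∑ i, (LinearMap.proj i : (Fin N → ℝ) →ₗ[ℝ] ℝ).smulRight (Real.sqrt (c i) • u i) with hW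
  have hWy : ∀ y, W y = ∑ i, y i • Real.sqrt (c i) • u i := by
    intro y; simp [hW, LinearMap.sum_apply]
  set e := LinearEquiv.ofInjective A hA with he
  set Φ : (Fin N → ℝ) →ₗ[ℝ] V := e.symm.toLinearMap ∘ₗ
    (A.range.orthogonalProjectionOnto : H →ₗ[ℝ] A.range) ∘ₗ W with hΦ
  have hAe : ∀ z : A.range, A (e.symm z) = z := by
    intro z
    have := LinearEquiv.apply_symm_apply e z
    exact congrArg Subtype.val this
  have hAΦ : ∀ y, A (Φ y) = (A.range.orthogonalProjectionOnto (W y) : H) := fun y => hAe _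
  have hWΨ : ∀ v, W (Ψ v) = A v := by
    intro v
    rw [hWy]
    conv_rhs => rw [← hu (A v)]
    apply Finset.sum_congr rfl; intro i _
    rw [hΨv, smul_smul]
    congr 1
    have := Real.mul_self_sqrt (hc i)
    linear_combination inner ℝ (A v) (u i) * this
  have hin : ∀ y v, ∑ i, y i * Ψ v i = inner ℝ (W y) (A v) := by
    intro y v
    rw [hWy, sum_inner]
    apply Finset.sum_congr rfl; intro i _
    rw [real_inner_smul_left, real_inner_smul_left, hΨv, real_inner_comm (u i)]
  refine ⟨Ψ, Φ, hΨv, ?_, ?_, ?_⟩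
  · intro v
    apply hA
    rw [hAΦ, hWΨ]
    exact Submodule.starProjection_eq_self_iff.2 (LinearMap.mem_range_self A v)
  · intro v y
    rw [hin, hin, hWΨ, hAΦ]
    have := Submodule.starProjection_inner_eq_zero (K := A.range) (W y) (A v) (LinearMap.mem_range_self A v)
    rw [inner_sub_left, sub_eq_zero] at this
    exact this
  · intro v
    have := hin (Ψ v) v
    rw [hWΨ, real_inner_self_eq_norm_sq] at this
    rw [← this]
    apply Finset.sum_congr rfl; intro i _; ring

theorem section_volume_ratio_le_cotype :
    ∃ c : ℝ, 0 < c ∧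
      ∀ (n : ℕ) (K E : Set (EuclideanSpace ℝ (Fin n))),
        IsSymmetricConvexBody K → IsMaxVolEllipsoidIn E K →
        ∀ (F : Submodule ℝ (EuclideanSpace ℝ (Fin n))) (m : ℕ), 0 < m →
          Module.finrank ℝ F = m →
          ((volume (Subtype.val ⁻¹' K : Set ↥F)).toReal /
              (volume (Subtype.val ⁻¹' E : Set ↥F)).toReal) ^ ((1 : ℝ) / m) ≤
            c * hfun (Real.sqrt ((n : ℝ) / m) * cotype2Const K) := by
  obtain ⟨c0, hc0, hrad⟩ := rad_bound
  refine ⟨2 * Real.exp (54 * c0 ^ 2 + 10), by positivity, ?_⟩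
  intro n K E hK hE F m hm hF
  have hmn : m ≤ n := by
    have := Submodule.finrank_le F
    rw [hF] at this; simpa using this
  have hn : 0 < n := by omega
  have hnR : (0:ℝ) < n := by exact_mod_cast hn
  have hmR : (1:ℝ) ≤ m := by exact_mod_cast hm
  have hm0 : (0:ℝ) < m := by linarith
  obtain ⟨T, rfl⟩ := hE.1
  have hmax := hmax_of K T hE
  have hnh := scb_nhds K hK
  have habs : Absorbent ℝ K := absorbent_nhds_zero hnh
  obtain ⟨hC1, hcot⟩ := cotype_props hn K hK
  obtain ⟨hKcv, hKc, _, hKs⟩ := hK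
  have hKneg : ∀ ⦃x⦄, x ∈ K → -x ∈ K := by intro x hx; rw [hKs]; simpa using hx
  have hbal : Balanced ℝ K := (balanced_iff_neg_mem hKcv).2 hKneg
  set C := cotype2Const K with hC
  set D := Real.sqrt ((n:ℝ) / m) * C with hD
  have hD1 : 1 ≤ D := by
    have : 1 ≤ Real.sqrt ((n:ℝ) / m) := by
      rw [Real.one_le_sqrt, one_le_div hm0]; exact_mod_cast hmn
    nlinarith
  have hTc : Continuous T := T.toLinearMap.continuous_of_finiteDimensional
  obtain ⟨N, c, u, hcn, hcs, huK, hid⟩ := john hn (T ⁻¹' K) (hKcv.linear_preimage T.toLinearMap)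
    (hKc.isClosed.preimage hTc) (fun x hx => hE.2.1 ⟨x, hx, rfl⟩) hmax
  set p : Seminorm ℝ (EuclideanSpace ℝ (Fin n)) := (gaugeSeminorm hbal hKcv habs).comp T.toLinearMap with hp
  have hpx : ∀ x, p x = gauge K (T x) := fun x => rfl
  have hp1 : ∀ x, p x ≤ ‖x‖ := by
    intro x
    rw [hpx]
    by_cases hx : x = 0
    · simp [hx]
    · apply gauge_le_of_mem (norm_nonneg _)
      refine ⟨T (‖x‖⁻¹ • x), hE.2.1 ⟨_, ?_, rfl⟩, ?_⟩
      · rw [mem_closedBall_zero_iff, norm_smul, norm_inv, norm_norm, inv_mul_cancel₀ (norm_ne_zero_iff.2 hx)]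
      · show ‖x‖ • T (‖x‖⁻¹ • x) = T x
        rw [← map_smul, smul_smul, mul_inv_cancel₀ (norm_ne_zero_iff.2 hx), one_smul]
  have hpu : ∀ i x, inner ℝ x (u i) ≤ p x := by
    intro i x
    apply le_of_forall_gt_imp_ge_of_dense
    intro a ha
    rw [hpx] at ha
    obtain ⟨b, hb0, hba, y, hy, hyx⟩ := exists_lt_of_gauge_lt habs ha
    have hx : x = b • T.symm y := by
      apply T.injective; rw [map_smul, LinearEquiv.apply_symm_apply]; exact hyx.symm
    have := huK i (T.symm y) (by simpa using hy)
    rw [hx, real_inner_smul_left]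
    nlinarith
  set A : F →ₗ[ℝ] EuclideanSpace ℝ (Fin n) := T.symm.toLinearMap ∘ₗ F.subtype with hA
  have hTA : ∀ v : F, T (A v) = v := fun v => T.apply_symm_apply _
  have hAinj : Function.Injective A := T.symm.injective.comp Subtype.val_injective
  obtain ⟨Ψ, Φ, hΨ, h1, h2, h3⟩ := psi_phi A hAinj c u hcn hid
  set L : Set F := Subtype.val ⁻¹' K with hL
  have hLcl : IsClosed L := hKc.isClosed.preimage continuous_subtype_val
  have hLc : IsCompact L := by
    rw [Metric.isCompact_iff_isClosed_bounded]
    refine ⟨hLcl, ?_⟩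
    obtain ⟨R, hR⟩ := hKc.isBounded.subset_closedBall 0
    apply (isBounded_closedBall (x := (0:F)) (r := R)).subset
    intro v hv
    have := hR hv
    rw [mem_closedBall_zero_iff] at this ⊢
    exact this
  have hLs : SymC L := ⟨hLcl, hKcv.linear_preimage F.subtype, fun x hx => hKneg hx⟩
  have h0 : (0:F) ∈ L := by
    show ((0:F) : EuclideanSpace ℝ (Fin n)) ∈ K
    simpa using mem_of_mem_nhds hnh
  set g : ℝ → ENNReal := fun s => volume (LTr Ψ L s) with hg
  have hiter := iter_bound c0 m D hmR hD1 g (by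
    intro s δ hs hδ _
    have ht : 2 ≤ 2 * s := by linarith
    have hlog : 0 < Real.log (2 * s) := Real.log_pos (by linarith)
    have hX : 0 < c0 * C * Real.log (2 * s) := by positivity
    have hr : ∀ y : Fin N → ℝ, (∑ e : Fin N → Bool, hsup Ψ L (2 * s) (fun i => sg (e i) * y i)) / 2 ^ N ≤
        c0 * C * Real.log (2 * s) * Real.sqrt (∑ i, c i * y i ^ 2) := by
      intro y
      have hatt := fun e : Fin N → Bool => hsup_attained Ψ L hLs hLc h0 (2 * s) (fun i => sg (e i) * y i)
      choose v hv hve using hatt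
      have := hrad (EuclideanSpace ℝ (Fin n)) p hp1 C (by linarith) (by
          intro N' x
          simp only [hpx, map_sum, map_smul]
          exact hcot N' (fun j => T (x j))) N u hpu (2 * s) ht (fun i => Real.sqrt (c i) * y i)
        (fun e => A (v e)) (by
          intro e
          rw [hpx, hTA]
          exact gauge_le_one_of_mem (hv e).1) (by
          intro e
          have h4 := (hv e).2
          rw [h3] at h4
          exact abs_le_of_sq_le_sq' h4 (by linarith) |>.2)
      have e1 : ∀ e : Fin N → Bool, inner ℝ (A (v e)) (∑ i, (sg (e i) * (Real.sqrt (c i) * y i)) • u i) =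
          hsup Ψ L (2 * s) (fun i => sg (e i) * y i) := by
        intro e
        rw [hve, inner_sum]
        apply Finset.sum_congr rfl; intro i _
        rw [real_inner_smul_right, hΨ]; ring
      have e2 : ∀ i, (Real.sqrt (c i) * y i) ^ 2 = c i * y i ^ 2 := by
        intro i; rw [mul_pow, Real.sq_sqrt (hcn i)]
      simp only [e1, e2] at this
      exact this
    obtain ⟨hint, hle⟩ := hsup_int Ψ L hLs hLc h0 (2 * s) _ n hX.le hnR c hcn hcs hr
    have hAeq : c0 * C * Real.log (2 * s) * Real.sqrt n = c0 * Real.sqrt m * D * Real.log (2 * s) := by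
      have : Real.sqrt n = Real.sqrt m * Real.sqrt ((n:ℝ) / m) := by
        rw [← Real.sqrt_mul hm0.le, mul_div_cancel₀ _ hm0.ne']
      rw [hD, this]; ring
    rw [hAeq] at hle
    have hApos : 0 < c0 * Real.sqrt m * D * Real.log (2 * s) := by
      have := Real.sqrt_pos.2 hm0
      have : 0 < D := by linarith
      positivity
    exact gauss_step volume Ψ Φ h1 h2 L hLs hLc h0 s _ δ (by linarith) hApos hδ hint hle)
  have hh : 0 < hfun D := by
    have : 0 < Real.log (2 * D) := Real.log_pos (by linarith)
    unfold hfun; positivity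
  set t := 2 * hfun D with ht
  have ht0 : 0 < t := by positivity
  obtain ⟨J, hJ⟩ : ∃ J : ℕ, L ⊆ LTr Ψ L (2 ^ J * t) := by
    have hAc : Continuous A := A.continuous_of_finiteDimensional
    obtain ⟨R, hR⟩ := (hLc.image hAc).isBounded.subset_closedBall 0
    obtain ⟨J, hJ⟩ := pow_unbounded_of_one_lt (R / t) (one_lt_two : (1:ℝ) < 2)
    refine ⟨J, fun v hv => ⟨hv, ?_⟩⟩
    rw [h3]
    have h4 : ‖A v‖ ≤ R := mem_closedBall_zero_iff.1 (hR ⟨v, hv, rfl⟩)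
    rw [div_lt_iff₀ ht0] at hJ
    exact pow_le_pow_left₀ (norm_nonneg _) (by linarith) 2
  set E' : Set F := Subtype.val ⁻¹' (T '' closedBall 0 1) with hE'
  have hsub : LTr Ψ L t ⊆ t • E' := by
    rintro v ⟨_, hv⟩
    rw [h3] at hv
    have hv' : ‖A v‖ ≤ t := abs_le_of_sq_le_sq' hv ht0.le |>.2
    refine ⟨t⁻¹ • v, ⟨A (t⁻¹ • v), ?_, hTA _⟩, ?_⟩
    · rw [mem_closedBall_zero_iff, map_smul, norm_smul, norm_inv, Real.norm_of_nonneg ht0.le,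
        inv_mul_le_iff₀ ht0, mul_one]; exact hv'
    · show t • t⁻¹ • v = v
      rw [smul_smul, mul_inv_cancel₀ ht0.ne', one_smul]
  have hE'L : E' ⊆ L := fun v hv => hE.2.1 hv
  have hLfin : volume L ≠ ⊤ := hLc.measure_lt_top.ne
  have hE'fin : volume E' ≠ ⊤ := ((measure_mono hE'L).trans_lt hLc.measure_lt_top).ne
  have hvol : volume L ≤ ENNReal.ofReal (Real.exp ((54 * c0 ^ 2 + 10) * m)) *
      (ENNReal.ofReal (t ^ m) * volume E') := by
    calc volume L ≤ g (2 ^ J * t) := measure_mono hJ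
      _ ≤ _ := hiter J
      _ ≤ _ := by
        gcongr
        refine (measure_mono hsub).trans (le_of_eq ?_)
        rw [Measure.addHaar_smul, hF, abs_of_pos (by positivity)]
  have hvolR : (volume L).toReal ≤ Real.exp ((54 * c0 ^ 2 + 10) * m) * (t ^ m * (volume E').toReal) := by
    have := ENNReal.toReal_mono (by finiteness) hvol
    rw [ENNReal.toReal_mul, ENNReal.toReal_mul, ENNReal.toReal_ofReal (by positivity),
      ENNReal.toReal_ofReal (by positivity)] at this
    exact this
  have hratio : (volume L).toReal / (volume E').toReal ≤ (2 * Real.exp (54 * c0 ^ 2 + 10) * hfun D) ^ m := by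
    apply div_le_of_le_mul₀ ENNReal.toReal_nonneg (by positivity)
    refine hvolR.trans (le_of_eq ?_)
    rw [mul_comm (54 * c0 ^ 2 + 10) (m:ℝ), Real.exp_nat_mul, ht, mul_pow, mul_pow, mul_pow]; ring
  calc ((volume L).toReal / (volume E').toReal) ^ ((1:ℝ) / m)
      ≤ ((2 * Real.exp (54 * c0 ^ 2 + 10) * hfun D) ^ m) ^ ((1:ℝ) / m) :=
        Real.rpow_le_rpow (by positivity) hratio (by positivity)
    _ = 2 * Real.exp (54 * c0 ^ 2 + 10) * hfun D := by
        rw [one_div, Real.pow_rpow_inv_natCast (by positivity) hm.ne']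
end
end

section
/- There exists an absolute constant c > 0 such that: if K is a symmetric convex body in ℝ^n and E is the ellipsoid of maximal volume contained in K, then for every ε ∈ (0,1) there exists a subspace F of ℝ^n with dim F = m ≥ (1−ε)n such that M_{E∩F} ≤ [c · h(C_K) · log(2/ε) / √ε] · M_K, where h(y) = y log(2y) for y ≥ 1. -/
open MeasureTheory Metric Set
open scoped Pointwise

noncomputable section

/-- `M_K = (∫_{S^{n-1}} ‖x‖_K^2 dσ(x))^{1/2}`, where `σ` is the rotation-invariant
probability measure on the Euclidean unit sphere and `‖·‖_K` is the gauge of `K`. -/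
def Mval {n : ℕ} (K : Set (EuclideanSpace ℝ (Fin n))) : ℝ :=
  Real.sqrt (⨍ x : sphere (0 : EuclideanSpace ℝ (Fin n)) 1,
    gauge K (x : EuclideanSpace ℝ (Fin n)) ^ 2
      ∂((volume : Measure (EuclideanSpace ℝ (Fin n))).toSphere))

/-- The quantity `M_K` for a body `K` living in a subspace `F` of `ℝ^n`,
computed over the unit sphere of `F` with its rotation-invariant probability
measure. -/
def MvalSub {n : ℕ} (F : Submodule ℝ (EuclideanSpace ℝ (Fin n))) (K : Set ↥F) : ℝ :=
  Real.sqrt (⨍ x : sphere (0 : ↥F) 1,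
    gauge K (x : ↥F) ^ 2 ∂((volume : Measure ↥F).toSphere))

section gaussian
open ProbabilityTheory
variable {V : Type*} [NormedAddCommGroup V] [InnerProductSpace ℝ V] [FiniteDimensional ℝ V]
  [MeasurableSpace V] [BorelSpace V]

lemma aux_int_exp : Integrable (fun x : V => Real.exp (-(1/2) * ‖x‖^2)) := by
  have h := GaussianFourier.integrable_cexp_neg_mul_sq_norm_add (V := V) (b := (1/2:ℂ)) (by norm_num) 0 0
  have h2 := h.re
  refine h2.congr (Filter.Eventually.of_forall fun x => ?_)
  simp only [zero_mul, add_zero]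
  have : (-(1/2:ℂ) * (‖x‖:ℂ)^2) = ((-(1/2) * ‖x‖^2 : ℝ) : ℂ) := by push_cast; ring
  rw [this, ← Complex.ofReal_exp]
  exact Complex.ofReal_re _

lemma aux_gauss_density : ∃ k : ℝ, 0 < k ∧ stdGaussian V =
    (volume : Measure V).withDensity (fun x => ENNReal.ofReal (k * Real.exp (-(1/2) * ‖x‖^2))) := by
  set k : ℝ := ((2 * Real.pi) ^ ((Module.finrank ℝ V : ℝ) / 2))⁻¹ with hk
  have hkpos : 0 < k := by positivity
  refine ⟨k, hkpos, ?_⟩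
  have : IsFiniteMeasure ((volume : Measure V).withDensity
      (fun x => ENNReal.ofReal (k * Real.exp (-(1/2) * ‖x‖^2)))) :=
    isFiniteMeasure_withDensity_ofReal (aux_int_exp.const_mul k).hasFiniteIntegral
  refine Measure.ext_of_charFun ?_
  ext t
  rw [charFun_stdGaussian, charFun_apply, integral_withDensity_eq_integral_toReal_smul (by fun_prop)
    (by simp)]
  have h := GaussianFourier.integral_cexp_neg_mul_sq_norm_add (V := V) (b := (1/2:ℂ)) (by norm_num)
    Complex.I t
  have h1 : ∀ x : V, (ENNReal.ofReal (k * Real.exp (-(1/2) * ‖x‖^2))).toReal •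
      Complex.exp ((inner ℝ x t : ℝ) * Complex.I) =
      (k:ℂ) * Complex.exp (-(1/2) * ‖x‖ ^ 2 + Complex.I * (inner ℝ t x : ℝ)) := by
    intro x
    rw [ENNReal.toReal_ofReal (by positivity), Complex.exp_add, real_inner_comm, Complex.real_smul]
    push_cast
    rw [mul_comm Complex.I]; ring
  simp_rw [h1]
  rw [integral_const_mul, h]
  have h2 : ((Real.pi:ℂ) / (1/2)) ^ ((Module.finrank ℝ V : ℂ) / 2) =
      (((2 * Real.pi) ^ ((Module.finrank ℝ V : ℝ) / 2) : ℝ) : ℂ) := by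
    rw [Complex.ofReal_cpow (by positivity)]
    push_cast
    congr 1; ring
  rw [h2, ← mul_assoc, ← Complex.ofReal_mul, hk, inv_mul_cancel₀ (by positivity)]
  simp
  ring_nf

lemma aux_int_inner_sq (y : V) : ∫ x, (inner ℝ y x)^2 ∂(stdGaussian V) = ‖y‖^2 := by
  have h := variance_dual_stdGaussian (innerSL ℝ y)
  have h0 := integral_strongDual_stdGaussian (innerSL ℝ y)
  rw [variance_of_integral_eq_zero (by fun_prop) h0] at h
  simpa using h

lemma aux_memLp_id : MemLp (fun x : V => x) 2 (stdGaussian V) :=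
  IsGaussian.memLp_two_id (μ := stdGaussian V)

lemma aux_integrable_norm_sq : Integrable (fun x : V => ‖x‖^2) (stdGaussian V) := by
  have := (aux_memLp_id (V := V)).norm.integrable_sq
  simpa using this

lemma aux_integrable_inner_sq (y : V) :
    Integrable (fun x : V => (inner ℝ y x)^2) (stdGaussian V) := by
  refine (aux_integrable_norm_sq.const_mul (‖y‖^2)).mono' (by fun_prop) ?_
  refine Filter.Eventually.of_forall fun x => ?_
  have := abs_real_inner_le_norm y x
  rw [Real.norm_eq_abs, abs_pow, ← mul_pow]
  gcongr

lemma aux_int_norm_sq : ∫ x, ‖x‖^2 ∂(stdGaussian V) = Module.finrank ℝ V := by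
  let b := stdOrthonormalBasis ℝ V
  have : ∀ x : V, ‖x‖^2 = ∑ i, (inner ℝ (b i) x)^2 := fun x => by
    rw [← b.sum_sq_norm_inner_right x]; simp
  simp_rw [this]
  rw [integral_finsetSum _ (fun i _ => aux_integrable_inner_sq _)]
  simp_rw [aux_int_inner_sq]
  simp

lemma aux_polar [Nontrivial V] (f : V → ℝ) (hf : ∀ r : ℝ, 0 < r → ∀ x, f (r • x) = r^2 * f x) :
    ∫ x, f x * Real.exp (-(1/2) * ‖x‖^2) =
      (∫ x : sphere (0:V) 1, f x ∂(volume : Measure V).toSphere) *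
      ∫ r : Ioi (0:ℝ), r.1^2 * Real.exp (-(1/2) * r.1^2)
        ∂(Measure.volumeIoiPow (Module.finrank ℝ V - 1)) := by
  calc ∫ x, f x * Real.exp (-(1/2) * ‖x‖^2)
      = ∫ x : ({(0)}ᶜ : Set V), f x.1 * Real.exp (-(1/2) * ‖x.1‖^2)
          ∂((volume : Measure V).comap (↑)) := by
        rw [integral_subtype_comap (measurableSet_singleton _).compl
          fun x : V ↦ f x * Real.exp (-(1/2) * ‖x‖^2), restrict_compl_singleton]
    _ = ∫ z, f z.1.1 * (z.2.1^2 * Real.exp (-(1/2) * z.2.1^2))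
          ∂((volume : Measure V).toSphere.prod (.volumeIoiPow (Module.finrank ℝ V - 1))) := by
        rw [← (volume : Measure V).measurePreserving_homeomorphUnitSphereProd.integral_comp
          (Homeomorph.measurableEmbedding _)]
        refine integral_congr_ae (Filter.Eventually.of_forall fun x => ?_)
        have hx : (x:V) ≠ 0 := x.2
        have hx' : 0 < ‖(x:V)‖ := norm_pos_iff.2 hx
        simp only [homeomorphUnitSphereProd_apply_fst_coe, homeomorphUnitSphereProd_apply_snd_coe]
        rw [hf _ (by positivity)]
        field_simp
    _ = _ := integral_prod_mul (fun x : sphere (0:V) 1 => f x)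
        (fun r : Ioi (0:ℝ) => r.1^2 * Real.exp (-(1/2) * r.1^2))

lemma aux_avg [Nontrivial V] (f : V → ℝ) (hf : ∀ r : ℝ, 0 < r → ∀ x, f (r • x) = r^2 * f x) :
    ∫ x, f x ∂(stdGaussian V) = Module.finrank ℝ V *
      ⨍ x : sphere (0:V) 1, f x ∂(volume : Measure V).toSphere := by
  obtain ⟨k, hk, h⟩ := aux_gauss_density (V := V)
  have key : ∀ g : V → ℝ, ∫ x, g x ∂(stdGaussian V) = k * ∫ x, g x * Real.exp (-(1/2) * ‖x‖^2) := by
    intro g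
    rw [h, integral_withDensity_eq_integral_toReal_smul (by fun_prop) (by simp), ← integral_const_mul]
    refine integral_congr_ae (Filter.Eventually.of_forall fun x => ?_)
    simp only [smul_eq_mul]
    rw [ENNReal.toReal_ofReal (by positivity)]; ring
  have h1 := aux_int_norm_sq (V := V)
  rw [key, aux_polar (V := V) (fun x => ‖x‖^2)
    (fun r hr x => by rw [norm_smul, mul_pow, Real.norm_of_nonneg hr.le])] at h1
  rw [key, aux_polar f hf, ← h1, average_eq]
  have h3 : (volume : Measure V).toSphere.real univ ≠ 0 := by
    rw [measureReal_def, ENNReal.toReal_ne_zero]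
    exact ⟨fun h => Measure.toSphere_ne_zero (volume : Measure V) (Measure.measure_univ_eq_zero.1 h),
      measure_ne_top _ _⟩
  have h4 : (∫ x : sphere (0:V) 1, ‖(x:V)‖^2 ∂(volume : Measure V).toSphere) =
      (volume : Measure V).toSphere.real univ := by
    simp only [norm_eq_of_mem_sphere, one_pow, integral_const, smul_eq_mul, mul_one]
  rw [h4, smul_eq_mul]
  generalize (volume : Measure V).toSphere.real univ = s at h3
  field_simp

lemma aux_map_gauss {N : ℕ} (x : Fin N → V) (α : ℝ) (hα : 0 ≤ α)
    (hx : ∀ z, α * ‖z‖^2 = ∑ j, (inner ℝ (x j) z)^2) :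
    (stdGaussian (EuclideanSpace ℝ (Fin N))).map (fun c => ∑ j, c j • x j) =
      (stdGaussian V).map (fun y => √α • y) := by
  have : IsProbabilityMeasure ((stdGaussian (EuclideanSpace ℝ (Fin N))).map
    (fun c => ∑ j, c j • x j)) := Measure.isProbabilityMeasure_map (by fun_prop)
  have : IsProbabilityMeasure ((stdGaussian V).map (fun y => √α • y)) :=
    Measure.isProbabilityMeasure_map (by fun_prop)
  refine Measure.ext_of_charFun ?_
  ext t
  rw [charFun_apply, charFun_apply, integral_map (by fun_prop) (by fun_prop),
    integral_map (by fun_prop) (by fun_prop)]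
  have h1 : ∀ c : EuclideanSpace ℝ (Fin N), (inner ℝ (∑ j, c j • x j) t : ℝ) =
      inner ℝ c (WithLp.toLp 2 (fun j => inner ℝ (x j) t)) := by
    intro c
    rw [sum_inner, PiLp.inner_apply]
    refine Finset.sum_congr rfl fun j _ => ?_
    rw [inner_smul_left]; simp [mul_comm]
  have h2 : ∀ y : V, (inner ℝ (√α • y) t : ℝ) = inner ℝ y (√α • t) := fun y => by
    rw [inner_smul_left, inner_smul_right]; simp
  simp_rw [h1, h2]
  rw [← charFun_apply, ← charFun_apply, charFun_stdGaussian, charFun_stdGaussian]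
  congr 3
  rw [← Complex.ofReal_pow, ← Complex.ofReal_pow, EuclideanSpace.norm_sq_eq, norm_smul, mul_pow,
    Real.norm_of_nonneg (Real.sqrt_nonneg α), Real.sq_sqrt hα, hx]
  simp

/-- sign flips preserve the Gaussian -/
lemma aux_sign {N : ℕ} (s : Fin N → ℝ) (hs : ∀ j, s j ^ 2 = 1) :
    (stdGaussian (EuclideanSpace ℝ (Fin N))).map
      (fun c => (WithLp.toLp 2 (fun j => s j * c j) : EuclideanSpace ℝ (Fin N))) =
    stdGaussian (EuclideanSpace ℝ (Fin N)) := by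
  have h := aux_map_gauss (V := EuclideanSpace ℝ (Fin N))
    (fun j => s j • EuclideanSpace.single j (1:ℝ)) 1 zero_le_one (fun z => by
      rw [one_mul, EuclideanSpace.norm_sq_eq]
      refine Finset.sum_congr rfl fun j _ => ?_
      rw [inner_smul_left, mul_pow]
      simp [hs, EuclideanSpace.inner_single_left])
  simp only [Real.sqrt_one, one_smul, Measure.map_id'] at h
  rw [← h, h]
  conv_rhs => rw [← h]
  congr 1
  ext c i
  simp only [WithLp.ofLp_sum, WithLp.ofLp_smul, Finset.sum_apply, Pi.smul_apply, smul_eq_mul,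
    PiLp.ofLp_single]
  rw [Finset.sum_eq_single i]
  · simp [mul_comm]
  · intro j _ hj; simp [Pi.single_apply, hj.symm]
  · simp

/-- The cotype estimate for a tight frame. -/
lemma aux_cotype (p : V → ℝ) (hp0 : ∀ x, 0 ≤ p x) (hpc : Continuous p)
    (hps : ∀ (r : ℝ) x, p (r • x) = |r| * p x)
    (b : ℝ) (hb : ∀ x, p x ≤ b * ‖x‖) (l : ℝ) (hl : 0 < l) {N : ℕ}
    (hcot : ∀ (x : Fin N → V), (1 / l) * Real.sqrt (∑ j, p (x j) ^ 2) ≤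
      Real.sqrt ((∑ ε : Fin N → Bool,
        p (∑ j, (if ε j then (1 : ℝ) else -1) • x j) ^ 2) / 2 ^ N))
    (x : Fin N → V) (α : ℝ) (hα : 0 ≤ α)
    (hx : ∀ z, α * ‖z‖^2 = ∑ j, (inner ℝ (x j) z)^2) :
    ∑ j, p (x j)^2 ≤ l^2 * α * ∫ y, p y ^ 2 ∂(stdGaussian V) := by
  have hint : ∀ {W : Type} [NormedAddCommGroup W] [InnerProductSpace ℝ W] [FiniteDimensional ℝ W]
    [MeasurableSpace W] [BorelSpace W] (T : W →L[ℝ] V),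
      Integrable (fun c => p (T c)^2) (stdGaussian W) := by
    intro W _ _ _ _ _ T
    refine (aux_integrable_norm_sq.const_mul ((|b| * ‖T‖)^2)).mono'
      ((hpc.comp T.continuous).pow 2).aestronglyMeasurable ?_
    refine Filter.Eventually.of_forall fun c => ?_
    rw [Real.norm_of_nonneg (by positivity), ← mul_pow]
    have h1 := hb (T c)
    have h2 := T.le_opNorm c
    have h3 : p (T c) ≤ |b| * ‖T‖ * ‖c‖ := by
      calc p (T c) ≤ b * ‖T c‖ := h1
        _ ≤ |b| * ‖T c‖ := by gcongr; exact le_abs_self b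
        _ ≤ |b| * (‖T‖ * ‖c‖) := by gcongr
        _ = _ := by ring
    exact pow_le_pow_left₀ (hp0 _) h3 2
  let G := stdGaussian (EuclideanSpace ℝ (Fin N))
  have hI : ∀ s : Fin N → ℝ, Integrable (fun c : EuclideanSpace ℝ (Fin N) =>
      p (∑ j, s j • c j • x j)^2) G := by
    intro s
    have := hint (W := EuclideanSpace ℝ (Fin N))
      (LinearMap.toContinuousLinearMap
        (∑ j, s j • LinearMap.toSpanSingleton ℝ V (x j) ∘ₗ (EuclideanSpace.projₗ j)))
    refine this.congr (Filter.Eventually.of_forall fun c => ?_)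
    simp
  have hval : ∀ s : Fin N → ℝ, (∀ j, s j ^2 = 1) →
      ∫ c, p (∑ j, s j • c j • x j)^2 ∂G = α * ∫ y, p y^2 ∂(stdGaussian V) := by
    intro s hs
    have h1 : ∫ c, p (∑ j, c j • x j)^2 ∂G = α * ∫ y, p y^2 ∂(stdGaussian V) := by
      have e := aux_map_gauss x α hα hx
      have e2 : ∫ v, p v^2 ∂(G.map (fun c => ∑ j, c j • x j)) =
        ∫ v, p v^2 ∂((stdGaussian V).map (fun y => √α • y)) := by rw [e]
      rw [integral_map (by fun_prop) (by fun_prop),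
        integral_map (by fun_prop) (by fun_prop)] at e2
      rw [e2, ← integral_const_mul]
      congr 1; ext y
      rw [hps, mul_pow, sq_abs, Real.sq_sqrt hα]
    rw [← h1]
    conv_rhs => rw [show G = _ from (aux_sign s hs).symm]
    rw [integral_map (by fun_prop) (by fun_prop)]
    congr 1; ext c
    simp [mul_smul]
  have hpt : ∀ c : EuclideanSpace ℝ (Fin N), ∑ j, (c j)^2 * p (x j)^2 ≤
      l^2 * ((∑ ε : Fin N → Bool,
        p (∑ j, (if ε j then (1 : ℝ) else -1) • c j • x j) ^ 2) / 2 ^ N) := by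
    intro c
    have h := hcot (fun j => c j • x j)
    have h1 : √(∑ j, p (c j • x j) ^ 2) ≤ l * √((∑ ε : Fin N → Bool,
        p (∑ j, (if ε j then (1 : ℝ) else -1) • c j • x j) ^ 2) / 2 ^ N) := by
      rw [one_div, inv_mul_le_iff₀ hl] at h
      exact h
    have h2 := pow_le_pow_left₀ (Real.sqrt_nonneg _) h1 2
    rw [mul_pow, Real.sq_sqrt (by positivity), Real.sq_sqrt (by positivity)] at h2
    refine le_trans (le_of_eq ?_) h2
    refine Finset.sum_congr rfl fun j _ => ?_
    rw [hps, mul_pow, sq_abs]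
  have hc2 : ∀ j, (∫ c : EuclideanSpace ℝ (Fin N), (c j)^2 ∂G) = 1 ∧
      Integrable (fun c : EuclideanSpace ℝ (Fin N) => (c j)^2) G := by
    intro j
    have h1 := aux_int_inner_sq (EuclideanSpace.single j (1:ℝ) : EuclideanSpace ℝ (Fin N))
    have h2 := aux_integrable_inner_sq (EuclideanSpace.single j (1:ℝ) : EuclideanSpace ℝ (Fin N))
    simp [EuclideanSpace.inner_single_left] at h1 h2
    exact ⟨h1, h2⟩
  have hsgn : ∀ ε : Fin N → Bool, ∀ j, (if ε j then (1 : ℝ) else -1)^2 = 1 := by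
    intro ε j; split_ifs <;> norm_num
  have hfin := integral_mono (μ := G)
    (integrable_finsetSum _ fun j _ => ((hc2 j).2.mul_const (p (x j)^2)))
    (((integrable_finsetSum Finset.univ fun (ε : Fin N → Bool) _ =>
      hI (fun j => if ε j then (1 : ℝ) else -1)).div_const (2^N)).const_mul (l^2)) hpt
  rw [integral_finsetSum _ (fun j _ => ((hc2 j).2.mul_const (p (x j)^2))), integral_const_mul,
    integral_div, integral_finsetSum _ (fun (ε : Fin N → Bool) _ =>
      hI (fun j => if ε j then (1 : ℝ) else -1))] at hfin
  simp_rw [integral_mul_const, (hc2 _).1] at hfin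
  rw [Finset.sum_congr rfl (fun ε _ => hval _ (hsgn ε))] at hfin
  simp at hfin
  rw [mul_assoc]; exact hfin

end gaussian

section pietsch
variable {V : Type*} [NormedAddCommGroup V] [InnerProductSpace ℝ V] [FiniteDimensional ℝ V]

def auxCone (p : V → ℝ) (hps : ∀ (r : ℝ) x, p (r • x) = |r| * p x) :
    PointedCone ℝ ((V →ₗ[ℝ] V) × ℝ) where
  carrier := {y | ∃ (N : ℕ) (x : Fin N → V), (∀ z, inner ℝ (y.1 z) z = ∑ j, (inner ℝ (x j) z)^2) ∧
    y.2 ≤ ∑ j, p (x j)^2}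
  zero_mem' := ⟨0, fun _ => 0, by simp, by simp⟩
  add_mem' := by
    rintro ⟨A, s⟩ ⟨B, t⟩ ⟨N, x, h1, h2⟩ ⟨M, y, h3, h4⟩
    refine ⟨N + M, Fin.append x y, ?_, ?_⟩
    · intro z
      rw [Fin.sum_univ_add]
      simp only [Fin.append_left, Fin.append_right]
      rw [← h1, ← h3]
      simp [inner_add_left]
    · rw [Fin.sum_univ_add]
      simp only [Fin.append_left, Fin.append_right]
      exact add_le_add h2 h4
  smul_mem' := by
    rintro ⟨c, hc⟩ ⟨A, s⟩ ⟨N, x, h1, h2⟩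
    refine ⟨N, fun j => √c • x j, ?_, ?_⟩
    · intro z
      simp only [inner_smul_left, mul_pow]
      rw [← Finset.mul_sum]
      simp only [RCLike.conj_to_real, Real.sq_sqrt hc]
      rw [← h1]
      simp [inner_smul_left, NNReal.smul_def]
    · simp only [hps, mul_pow, sq_abs, Real.sq_sqrt hc]
      rw [← Finset.mul_sum]
      exact mul_le_mul_of_nonneg_left h2 hc

lemma aux_pietsch [Nontrivial V] {n : ℕ} (hn : Module.finrank ℝ V = n)
    (p : V → ℝ) (hps : ∀ (r : ℝ) x, p (r • x) = |r| * p x) (D : ℝ)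
    (H : ∀ (N : ℕ) (x : Fin N → V) (α : ℝ), 0 ≤ α →
      (∀ z, α * ‖z‖^2 = ∑ j, (inner ℝ (x j) z)^2) → ∑ j, p (x j)^2 ≤ D * α) :
    ∃ (b : OrthonormalBasis (Fin n) ℝ V) (q : Fin n → ℝ), ∑ i, q i = D ∧
      ∀ x, p x ^ 2 ≤ ∑ i, q i * (inner ℝ (b i) x)^2 := by
  have hn0 : (n:ℝ) ≠ 0 := by
    rw [← hn]; exact_mod_cast Module.finrank_pos.ne'
  let F : ((V →ₗ[ℝ] V) × ℝ) →ₗ[ℝ] ℝ :=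
    (D / n) • (LinearMap.trace ℝ V ∘ₗ LinearMap.fst ℝ _ _) - LinearMap.snd ℝ _ _
  let φ : (ℝ × ℝ) →ₗ[ℝ] ((V →ₗ[ℝ] V) × ℝ) :=
    LinearMap.prodMap (LinearMap.toSpanSingleton ℝ (V →ₗ[ℝ] V) LinearMap.id) LinearMap.id
  have hF : ∀ α t : ℝ, F (α • LinearMap.id, t) = D * α - t := by
    intro α t
    simp only [F, LinearMap.sub_apply, LinearMap.smul_apply, LinearMap.comp_apply,
      LinearMap.fst_apply, LinearMap.snd_apply, map_smul, LinearMap.trace_id, hn, smul_eq_mul]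
    field_simp
  let f : ((V →ₗ[ℝ] V) × ℝ) →ₗ.[ℝ] ℝ := ⟨LinearMap.range φ, F ∘ₗ (LinearMap.range φ).subtype⟩
  have hφ : ∀ α t, φ (α, t) = (α • LinearMap.id, t) := fun α t => rfl
  obtain ⟨g, hg1, hg2⟩ := riesz_extension (auxCone p hps) f (by
      rintro ⟨_, ⟨α, t⟩, rfl⟩ ⟨N, x, h1, h2⟩
      change 0 ≤ F (φ (α, t))
      change ∀ z, inner ℝ ((α • LinearMap.id : V →ₗ[ℝ] V) z) z = _ at h1
      change t ≤ _ at h2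
      rw [hφ, hF]
      have h3 : ∀ z, α * ‖z‖^2 = ∑ j, (inner ℝ (x j) z)^2 := fun z => by
        rw [← h1]; simp [inner_smul_left]
      have hα : 0 ≤ α := by
        obtain ⟨z, hz⟩ := exists_ne (0:V)
        have h4 := h3 z
        have : 0 < ‖z‖^2 := by positivity
        have h5 : 0 ≤ α * ‖z‖^2 := by rw [h4]; positivity
        exact nonneg_of_mul_nonneg_left h5 this
      have := H N x α hα h3
      linarith) (by
      rintro ⟨A, t⟩
      have hB : ((1/2:ℝ) • (A + LinearMap.adjoint A)).IsSymmetric := by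
        intro x y
        simp only [LinearMap.smul_apply, LinearMap.add_apply, inner_smul_left, inner_smul_right,
          inner_add_left, inner_add_right, LinearMap.adjoint_inner_left,
          LinearMap.adjoint_inner_right]
        simp only [RCLike.conj_to_real]
        ring
      set B := (1/2:ℝ) • (A + LinearMap.adjoint A) with hBdef
      let b := hB.eigenvectorBasis hn
      let μ := hB.eigenvalues hn
      obtain ⟨α, hα⟩ : ∃ α : ℝ, ∀ i, 0 ≤ μ i + α := by
        refine ⟨∑ i, |μ i|, fun i => ?_⟩
        have := Finset.single_le_sum (f := fun i => |μ i|) (fun i _ => abs_nonneg _)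
          (Finset.mem_univ i)
        have h2 := neg_abs_le (μ i)
        linarith
      have hAB : ∀ z, inner ℝ (A z) z = ∑ i, μ i * (inner ℝ (b i) z)^2 := by
        intro z
        have h1 : inner ℝ (A z) z = inner ℝ (B z) z := by
          simp only [hBdef, LinearMap.smul_apply, LinearMap.add_apply, inner_smul_left,
            inner_add_left, LinearMap.adjoint_inner_left]
          rw [real_inner_comm z (A z)]
          simp only [RCLike.conj_to_real]
          ring
        rw [h1, ← b.sum_inner_mul_inner (B z) z]
        refine Finset.sum_congr rfl fun i _ => ?_
        rw [hB z (b i), hB.apply_eigenvectorBasis, inner_smul_right, real_inner_comm]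
        simp [b, μ]
        ring
      refine ⟨⟨φ (α, -t), _, rfl⟩, n, fun i => √(μ i + α) • b i, ?_, ?_⟩
      · intro z
        simp only [hφ, Prod.fst_add, LinearMap.add_apply, inner_add_left, LinearMap.smul_apply,
          LinearMap.id_apply, inner_smul_left, mul_pow, hAB, RCLike.conj_to_real]
        simp only [Real.sq_sqrt (hα _), add_mul, Finset.sum_add_distrib]
        rw [← Finset.mul_sum]
        have := b.sum_sq_norm_inner_right z
        simp only [Real.norm_eq_abs, sq_abs] at this
        rw [this, real_inner_self_eq_norm_sq]
        ring
      · simp only [hφ, Prod.snd_add, neg_add_cancel]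
        positivity)
  have hg1' : ∀ α t : ℝ, g (α • LinearMap.id, t) = D * α - t := by
    intro α t
    have := hg1 ⟨φ (α, t), _, rfl⟩
    rw [← hF]; exact this
  have hgt : ∀ A (t:ℝ), g (A, t) = g (A, 0) - t := by
    intro A t
    have h1 := hg1' 0 t
    have h2 : ((A, t) : (V →ₗ[ℝ] V) × ℝ) = (A, 0) + ((0:ℝ) • LinearMap.id, t) := by simp
    rw [h2, map_add, h1]; ring
  -- the operators
  let R : V →ₗ[ℝ] V →ₗ[ℝ] (V →ₗ[ℝ] V) := LinearMap.mk₂ ℝ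
    (fun x y => LinearMap.toSpanSingleton ℝ V y ∘ₗ (innerSL ℝ x : V →ₗ[ℝ] ℝ))
    (by intros; ext; simp [inner_add_left, add_smul])
    (by intros; ext; simp [inner_smul_left, mul_smul])
    (by intros; ext; simp)
    (by intros; ext; exact smul_comm _ _ _)
  have hR : ∀ x y z, R x y z = (inner ℝ x z : ℝ) • y := by intros; simp [R]
  have hanti : ∀ A : V →ₗ[ℝ] V, (∀ z, inner ℝ (A z) z = (0:ℝ)) → g (A, 0) = 0 := by
    intro A hA
    have h1 := hg2 (A, 0) ⟨0, fun _ => 0, by simp [hA], by simp⟩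
    have h2 := hg2 (-A, 0) ⟨0, fun _ => 0, by simp [hA], by simp⟩
    have h3 : ((-A, 0) : (V →ₗ[ℝ] V) × ℝ) = -(A, 0) := by simp
    rw [h3, map_neg] at h2
    linarith
  let q : V →ₗ[ℝ] V →ₗ[ℝ] ℝ := R.compr₂ (g ∘ₗ LinearMap.inl ℝ _ _)
  have hq : ∀ x y, q x y = g (R x y, 0) := fun x y => rfl
  have hqs : ∀ x y, q x y = q y x := by
    intro x y
    have h := hanti (R x y - R y x) (fun z => by
      simp [hR, inner_sub_left, inner_smul_left]; ring)
    have h2 : ((R x y - R y x, 0) : (V →ₗ[ℝ] V) × ℝ) = (R x y, 0) - (R y x, 0) := by simp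
    rw [h2, map_sub] at h
    rw [hq, hq]; linarith
  have hqp : ∀ x, p x ^ 2 ≤ q x x := by
    intro x
    have h := hg2 (R x x, p x ^2) ⟨1, fun _ => x, fun z => by
      simp [hR, inner_smul_left]; ring, by simp⟩
    rw [hgt] at h
    rw [hq]; linarith
  let e := stdOrthonormalBasis ℝ V
  let Q : V →ₗ[ℝ] V := ∑ i, LinearMap.toSpanSingleton ℝ V (e i) ∘ₗ (q.flip (e i))
  have hQ : ∀ x y, inner ℝ (Q x) y = q x y := by
    intro x y
    have h1 : Q x = ∑ i, q x (e i) • e i := by simp [Q, LinearMap.sum_apply]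
    rw [h1, sum_inner]
    conv_rhs => rw [← e.sum_repr' y]
    rw [map_sum]
    refine Finset.sum_congr rfl fun i _ => ?_
    rw [inner_smul_left, map_smul]
    simp [mul_comm]
  have hQs : Q.IsSymmetric := by
    intro x y
    rw [hQ, real_inner_comm, hQ, hqs]
  let b := hQs.eigenvectorBasis hn
  have hqb : ∀ i x, q (b i) x = hQs.eigenvalues hn i * inner ℝ (b i) x := by
    intro i x
    rw [← hQ, hQs.apply_eigenvectorBasis, inner_smul_left]
    simp [b]
  refine ⟨b, hQs.eigenvalues hn, ?_, ?_⟩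
  · have h1 := hg1' 1 0
    have h2 : LinearMap.id = ∑ i, R (b i) (b i) := by
      ext z
      simp [LinearMap.sum_apply, hR, b.sum_repr']
    rw [one_smul, mul_one, sub_zero] at h1
    rw [← h1]
    have h3 : g (LinearMap.id, 0) = (g ∘ₗ LinearMap.inl ℝ _ _) LinearMap.id := rfl
    rw [h3, h2, map_sum]
    refine Finset.sum_congr rfl fun i _ => ?_
    have h4 : (g ∘ₗ LinearMap.inl ℝ _ _) (R (b i) (b i)) = q (b i) (b i) := rfl
    rw [h4, hqb]
    simp
  · intro x
    refine (hqp x).trans (le_of_eq ?_)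
    have h0 : q x x = ∑ i, inner ℝ (b i) x * q (b i) x := by
      have h1 : q x x = q x (∑ i, (inner ℝ (b i) x : ℝ) • b i) := by rw [b.sum_repr' x]
      rw [h1, map_sum]
      refine Finset.sum_congr rfl fun i _ => ?_
      rw [map_smul, smul_eq_mul, hqs]
    rw [h0]
    refine Finset.sum_congr rfl fun i _ => ?_
    rw [hqb]; ring
end pietsch

section john

lemma aux_deriv {n : ℕ} (s : Fin n → ℝ)
    (h : ∀ t : ℝ, 0 < t → t < 1 → ∏ i, (1 + t * (s i - 1)) ≤ 1) : ∑ i, s i ≤ n := by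
  have hd : HasDerivAt (fun t : ℝ => ∏ i, (1 + t * (s i - 1))) (∑ i, (s i - 1)) 0 := by
    have := HasDerivAt.fun_finsetProd (u := Finset.univ) (f := fun i (t:ℝ) => 1 + t * (s i - 1))
      (f' := fun i => s i - 1) (x := 0) (fun i _ => by
        simpa using ((hasDerivAt_id (0:ℝ)).mul_const (s i - 1)).const_add 1)
    simpa using this
  have h2 := hd.hasDerivWithinAt (s := Ioi 0)
  rw [hasDerivWithinAt_iff_tendsto_slope' (by simp)] at h2
  have h3 : ∑ i, (s i - 1) ≤ 0 := by
    refine le_of_tendsto h2 ?_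
    filter_upwards [Ioo_mem_nhdsGT (zero_lt_one (α := ℝ))] with t ht
    rw [slope_def_field]
    simp only [zero_mul, add_zero, Finset.prod_const_one, sub_zero]
    exact div_nonpos_of_nonpos_of_nonneg (by linarith [h t ht.1 ht.2]) ht.1.le
  simp at h3
  linarith

lemma aux_john {n : ℕ} (p : EuclideanSpace ℝ (Fin n) → ℝ)
    (hps : ∀ (r : ℝ) x, p (r • x) = |r| * p x) (hadd : ∀ x y, p (x + y) ≤ p x + p y)
    (T : EuclideanSpace ℝ (Fin n) ≃ₗ[ℝ] EuclideanSpace ℝ (Fin n))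
    (hT : ∀ x, p (T x) ≤ ‖x‖)
    (hmax : ∀ T' : EuclideanSpace ℝ (Fin n) ≃ₗ[ℝ] EuclideanSpace ℝ (Fin n),
      (∀ x, ‖x‖ ≤ 1 → p (T' x) ≤ 1) →
      volume (T' '' closedBall 0 1) ≤ volume (T '' closedBall 0 1))
    (W : EuclideanSpace ℝ (Fin n) →ₗ[ℝ] EuclideanSpace ℝ (Fin n))
    (hW : ∀ x, p (T (W x)) ≤ ‖x‖)
    (b : OrthonormalBasis (Fin n) ℝ (EuclideanSpace ℝ (Fin n))) :
    ∑ i, ‖W (b i)‖^2 ≤ n := by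
  set Wa := LinearMap.adjoint W with hWa
  have hS : (W ∘ₗ Wa).IsSymmetric := by
    intro x y
    simp only [LinearMap.comp_apply]
    rw [← LinearMap.adjoint_inner_right, LinearMap.adjoint_inner_left]
  have hn : Module.finrank ℝ (EuclideanSpace ℝ (Fin n)) = n := by simp
  let f := hS.eigenvectorBasis hn
  let s := hS.eigenvalues hn
  have hsf : ∀ i, W (Wa (f i)) = s i • f i := fun i => by
    exact hS.apply_eigenvectorBasis hn i
  have hs : ∀ i, s i = ‖Wa (f i)‖^2 := by
    intro i
    rw [← real_inner_self_eq_norm_sq, LinearMap.adjoint_inner_left, hsf, inner_smul_right,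
      real_inner_self_eq_norm_sq]
    simp
  have hsum : ∑ i, ‖W (b i)‖^2 = ∑ i, s i := by
    have h1 : ∀ i, ‖W (b i)‖^2 = ∑ k, (inner ℝ (W (b i)) (f k))^2 := fun i => by
      rw [← f.sum_sq_norm_inner_left]; simp
    have h2 : ∀ k, s k = ∑ i, (inner ℝ (b i) (Wa (f k)))^2 := fun k => by
      rw [hs, ← b.sum_sq_norm_inner_right]; simp
    simp_rw [h1, h2]
    rw [Finset.sum_comm]
    simp_rw [hWa, LinearMap.adjoint_inner_right]
  rw [hsum]
  refine aux_deriv s fun t ht0 ht1 => ?_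
  let r : Fin n → ℝ := fun i => 1 + t * (s i - 1)
  have hr : ∀ i, 0 < r i := fun i => by
    have : 0 ≤ s i := by rw [hs]; positivity
    have : 0 ≤ t * s i := by positivity
    simp only [r]; linarith
  let P : EuclideanSpace ℝ (Fin n) →ₗ[ℝ] EuclideanSpace ℝ (Fin n) :=
    Matrix.toLin f.toBasis f.toBasis (Matrix.diagonal fun i => √(r i))
  have hPf : ∀ i, P (f i) = √(r i) • f i := by
    intro i
    have := Matrix.toLin_self f.toBasis f.toBasis (Matrix.diagonal fun i => √(r i)) i
    simp only [OrthonormalBasis.coe_toBasis] at this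
    rw [this, Finset.sum_eq_single i]
    · simp
    · intro j _ hj; simp [Matrix.diagonal_apply, hj]
    · simp
  have hPdet : LinearMap.det P = ∏ i, √(r i) := by
    simp only [P, LinearMap.det_toLin, Matrix.det_diagonal]
  have hPpos : 0 < LinearMap.det P := by
    rw [hPdet]; exact Finset.prod_pos fun i _ => Real.sqrt_pos.2 (hr i)
  let Pe := LinearMap.equivOfDetNeZero P hPpos.ne'
  have hPe : ∀ x, Pe x = P x := fun x => rfl
  have hPx : ∀ x, P x = ∑ i, (√(r i) * inner ℝ (f i) x) • f i := by
    intro x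
    conv_lhs => rw [← f.sum_repr' x]
    rw [map_sum]
    refine Finset.sum_congr rfl fun i _ => ?_
    rw [map_smul, hPf, smul_smul, mul_comm]
  have hPs : P.IsSymmetric := by
    intro x y
    rw [hPx, hPx, sum_inner, inner_sum]
    refine Finset.sum_congr rfl fun i _ => ?_
    simp only [inner_smul_left, inner_smul_right, RCLike.conj_to_real]
    rw [real_inner_comm x (f i)]
    ring
  have hPP : ∀ x, P (P x) = (1 - t) • x + t • W (Wa x) := by
    have : P ∘ₗ P = (1 - t) • LinearMap.id + t • (W ∘ₗ Wa) := by
      refine f.toBasis.ext fun i => ?_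
      simp only [OrthonormalBasis.coe_toBasis, LinearMap.comp_apply, LinearMap.add_apply,
        LinearMap.smul_apply, LinearMap.id_apply, hPf, map_smul, hsf, smul_smul, ← add_smul]
      rw [Real.mul_self_sqrt (hr i).le]
      congr 1
      simp only [r]; ring
    intro x
    exact congrArg (fun A => A x) this
  have hm := hmax (Pe.trans T) (by
    intro v hv
    obtain ⟨u, rfl⟩ := Pe.surjective v
    rw [hPe] at hv
    have h1 : ‖P u‖^2 = (1 - t) * ‖u‖^2 + t * ‖Wa u‖^2 := by
      rw [← real_inner_self_eq_norm_sq, ← hPs, hPP, inner_add_left, inner_smul_left, inner_smul_left,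
        ← LinearMap.adjoint_inner_right, real_inner_self_eq_norm_sq, real_inner_self_eq_norm_sq]
      simp
    have h2 : p ((Pe.trans T) (Pe u)) ≤ (1 - t) * ‖u‖ + t * ‖Wa u‖ := by
      rw [LinearEquiv.trans_apply, hPe, hPe, hPP, map_add, map_smul, map_smul]
      refine (hadd _ _).trans ?_
      rw [hps, hps, abs_of_pos ht0, abs_of_pos (by linarith)]
      have := hT u
      have := hW (Wa u)
      gcongr
    refine h2.trans ?_
    have h3 : ((1 - t) * ‖u‖ + t * ‖Wa u‖)^2 ≤ 1 := by
      have h4 : ‖P u‖^2 ≤ 1 := by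
        have := norm_nonneg (P u)
        nlinarith
      have h5 : 0 ≤ t * (1 - t) * (‖u‖ - ‖Wa u‖)^2 :=
        mul_nonneg (mul_nonneg ht0.le (by linarith)) (sq_nonneg _)
      nlinarith
    exact (abs_le_one_iff_mul_self_le_one.2 (by rw [← sq]; exact h3)) |> (abs_le.1 · |>.2))
  have e1 : ((Pe.trans T) '' closedBall 0 1) =
      (((T : EuclideanSpace ℝ (Fin n) →ₗ[ℝ] EuclideanSpace ℝ (Fin n)) ∘ₗ P) ''
        closedBall 0 1) := rfl
  have e2 : (T '' closedBall 0 1) =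
      ((T : EuclideanSpace ℝ (Fin n) →ₗ[ℝ] EuclideanSpace ℝ (Fin n)) '' closedBall 0 1) := rfl
  rw [e1, e2, Measure.addHaar_image_linearMap, Measure.addHaar_image_linearMap,
    ENNReal.mul_le_mul_iff_left (by
      exact (measure_closedBall_pos volume 0 one_pos).ne') (by
      exact measure_closedBall_lt_top.ne),
    ENNReal.ofReal_le_ofReal_iff (abs_nonneg _), LinearMap.det_comp, abs_mul] at hm
  have hTd : 0 < |LinearMap.det (T : EuclideanSpace ℝ (Fin n) →ₗ[ℝ] EuclideanSpace ℝ (Fin n))| :=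
    abs_pos.2 (LinearEquiv.isUnit_det' T).ne_zero
  have hP1 : LinearMap.det P ≤ 1 := by
    rw [abs_of_pos hPpos] at hm
    exact (mul_le_iff_le_one_right hTd).1 hm
  have : ∏ i, r i = (LinearMap.det P)^2 := by
    rw [hPdet, ← Finset.prod_pow]
    exact Finset.prod_congr rfl fun i _ => (Real.sq_sqrt (hr i).le).symm
  change ∏ i, r i ≤ 1
  rw [this]
  exact pow_le_one₀ hPpos.le hP1
end john

section assembly
open ProbabilityTheory

lemma aux_HS {V V' ι : Type*} [NormedAddCommGroup V] [InnerProductSpace ℝ V]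
    [FiniteDimensional ℝ V] [MeasurableSpace V] [BorelSpace V]
    [NormedAddCommGroup V'] [InnerProductSpace ℝ V'] [FiniteDimensional ℝ V'] [Fintype ι]
    (c : OrthonormalBasis ι ℝ V) (A : V →ₗ[ℝ] V') :
    ∫ x, ‖A x‖^2 ∂(stdGaussian V) = ∑ i, ‖A (c i)‖^2 := by
  let e := stdOrthonormalBasis ℝ V'
  have h1 : ∀ x, ‖A x‖^2 = ∑ k, (inner ℝ (LinearMap.adjoint A (e k)) x)^2 := fun x => by
    rw [← e.sum_sq_norm_inner_right]; simp [LinearMap.adjoint_inner_left]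
  have h2 : ∀ k, ‖LinearMap.adjoint A (e k)‖^2 =
      ∑ i, (inner ℝ (LinearMap.adjoint A (e k)) (c i))^2 := fun k => by
    rw [← c.sum_sq_norm_inner_left]; simp
  simp_rw [h1]
  rw [integral_finsetSum _ (fun i _ => aux_integrable_inner_sq _)]
  simp_rw [aux_int_inner_sq, h2]
  rw [Finset.sum_comm]

lemma aux_gauge_pre {V V' : Type*} [AddCommGroup V] [Module ℝ V]
    [NormedAddCommGroup V'] [NormedSpace ℝ V'] (A : V →ₗ[ℝ] V') (x : V) :
    gauge {x | ‖A x‖ ≤ 1} x = ‖A x‖ := by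
  have hset : {r ∈ Set.Ioi (0 : ℝ) | r⁻¹ • x ∈ {x | ‖A x‖ ≤ 1}} =
      {r | 0 < r ∧ ‖A x‖ ≤ r} := by
    ext r
    simp only [mem_ofPred_eq, mem_Ioi]
    refine and_congr_right fun hr => ?_
    rw [map_smul, norm_smul, norm_inv, Real.norm_of_nonneg hr.le, inv_mul_le_iff₀ hr, mul_one]
  rw [gauge_def', hset]
  rcases (norm_nonneg (A x)).eq_or_lt with h | h
  · rw [← h]
    have : {r : ℝ | 0 < r ∧ 0 ≤ r} = Ioi 0 := by
      ext r; simp only [mem_ofPred_eq, mem_Ioi]; exact ⟨fun h => h.1, fun h => ⟨h, h.le⟩⟩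
    rw [this, csInf_Ioi]
  · have : {r : ℝ | 0 < r ∧ ‖A x‖ ≤ r} = Ici ‖A x‖ := by
      ext r; simp only [mem_ofPred_eq, mem_Ici]; exact ⟨fun h => h.2, fun h' => ⟨h.trans_le h', h'⟩⟩
    rw [this, csInf_Ici]

lemma aux_rademacher {V : Type*} [NormedAddCommGroup V] [InnerProductSpace ℝ V] :
    ∀ (m : ℕ) (y : V) (x : Fin m → V),
    ∑ ε : Fin m → Bool, ‖y + ∑ j, (if ε j then (1 : ℝ) else -1) • x j‖^2 =
      2^m * (‖y‖^2 + ∑ j, ‖x j‖^2) := by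
  intro m
  induction m with
  | zero => intro y x; simp
  | succ m ih =>
    intro y x
    rw [← (Fin.consEquiv (fun _ => Bool)).sum_comp, Fintype.sum_prod_type]
    simp only [Fin.sum_univ_succ, Fin.consEquiv_apply, Fin.cons_zero, Fin.cons_succ, ← add_assoc]
    simp only [ih, Fintype.sum_bool]
    simp only [if_true, one_smul, Bool.false_eq_true, if_false, neg_smul]
    have := parallelogram_law_with_norm ℝ y (x 0)
    rw [← sub_eq_add_neg, pow_succ]
    linear_combination (2^m) * this

/-- facts on the gauge of a symmetric convex body -/
lemma aux_gauge {n : ℕ} {K : Set (EuclideanSpace ℝ (Fin n))} (hK : IsSymmetricConvexBody K) :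
    (∀ (r : ℝ) x, gauge K (r • x) = |r| * gauge K x) ∧
    (∀ x y, gauge K (x + y) ≤ gauge K x + gauge K y) ∧ Continuous (gauge K) ∧
    (∀ x, x ∈ K ↔ gauge K x ≤ 1) ∧ (∃ b, 0 < b ∧ ∀ x, gauge K x ≤ b * ‖x‖) ∧
    (∃ a, 0 < a ∧ ∀ x, ‖x‖ ≤ a * gauge K x) := by
  obtain ⟨hc, hcomp, ⟨x0, hx0⟩, hsym⟩ := hK
  have hneg : ∀ x ∈ K, -x ∈ K := fun x hx => by rw [hsym] at hx; exact hx
  have h0 : (0 : EuclideanSpace ℝ (Fin n)) ∈ interior K := by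
    have h1 := hc.openSegment_interior_self_subset_interior hx0 (hneg x0 (interior_subset hx0))
    apply h1
    exact ⟨1/2, 1/2, by norm_num, by norm_num, by norm_num, by simp⟩
  have hnhds : K ∈ nhds (0 : EuclideanSpace ℝ (Fin n)) := mem_interior_iff_mem_nhds.1 h0
  have habs : Absorbent ℝ K := absorbent_nhds_zero hnhds
  refine ⟨?_, gauge_add_le hc habs, continuous_gauge hc hnhds, ?_, ?_, ?_⟩
  · intro r x
    rcases le_total 0 r with h | h
    · rw [gauge_smul_of_nonneg h, abs_of_nonneg h, smul_eq_mul]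
    · rw [← gauge_neg hneg, ← neg_smul, gauge_smul_of_nonneg (by linarith), abs_of_nonpos h,
        smul_eq_mul]
  · intro x
    rw [gauge_le_one_iff_mem_closure hc hnhds, hcomp.isClosed.closure_eq]
  · obtain ⟨δ, hδ, hsub⟩ := Metric.nhds_basis_closedBall.mem_iff.1 hnhds
    refine ⟨δ⁻¹, by positivity, fun x => ?_⟩
    have h1 := gauge_mono (absorbent_nhds_zero (closedBall_mem_nhds
      (0 : EuclideanSpace ℝ (Fin n)) hδ)) hsub x
    rw [gauge_closedBall hδ.le] at h1
    rw [inv_mul_eq_div]; exact h1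
  · obtain ⟨a, ha, hsub⟩ := hcomp.isBounded.subset_closedBall_lt 0 0
    refine ⟨a, ha, fun x => ?_⟩
    have h1 := gauge_mono habs hsub x
    rw [gauge_closedBall ha.le, div_le_iff₀ ha] at h1
    linarith

lemma aux_cotype_nonempty {n : ℕ} (p : EuclideanSpace ℝ (Fin n) → ℝ)
    (hp0 : ∀ x, 0 ≤ p x) (a b : ℝ) (ha : 0 < a) (hb : 0 < b)
    (h1 : ∀ x, p x ≤ b * ‖x‖) (h2 : ∀ x, ‖x‖ ≤ a * p x) (m : ℕ)
    (x : Fin m → EuclideanSpace ℝ (Fin n)) :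
    (1 / (b * a)) * Real.sqrt (∑ j, p (x j) ^ 2) ≤
      Real.sqrt ((∑ ε : Fin m → Bool,
        p (∑ j, (if ε j then (1 : ℝ) else -1) • x j) ^ 2) / 2 ^ m) := by
  rw [one_div, inv_mul_le_iff₀ (by positivity)]
  apply Real.sqrt_le_iff.2
  refine ⟨by positivity, ?_⟩
  rw [mul_pow, Real.sq_sqrt (by positivity)]
  have hr := aux_rademacher m 0 x
  simp only [zero_add, norm_zero] at hr
  have h3 : ∑ j, p (x j)^2 ≤ b^2 * ∑ j, ‖x j‖^2 := by
    rw [Finset.mul_sum]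
    refine Finset.sum_le_sum fun j _ => ?_
    rw [← mul_pow]
    exact pow_le_pow_left₀ (hp0 _) (h1 _) 2
  have h4 : ∑ ε : Fin m → Bool, ‖∑ j, (if ε j then (1 : ℝ) else -1) • x j‖^2 ≤
      a^2 * ∑ ε : Fin m → Bool, p (∑ j, (if ε j then (1 : ℝ) else -1) • x j) ^ 2 := by
    rw [Finset.mul_sum]
    refine Finset.sum_le_sum fun j _ => ?_
    rw [← mul_pow]
    exact pow_le_pow_left₀ (norm_nonneg _) (h2 _) 2
  rw [hr] at h4
  refine h3.trans ?_
  rw [mul_pow, mul_assoc]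
  gcongr
  rw [← mul_div_assoc, le_div_iff₀ (by positivity)]
  linarith

lemma aux_basis {n : ℕ} (hn : 0 < n) (p : EuclideanSpace ℝ (Fin n) → ℝ)
    (hp0 : ∀ x, 0 ≤ p x)
    (hps : ∀ (r : ℝ) x, p (r • x) = |r| * p x) (hadd : ∀ x y, p (x + y) ≤ p x + p y)
    (hpos : ∀ x, x ≠ 0 → 0 < p x)
    (T : EuclideanSpace ℝ (Fin n) ≃ₗ[ℝ] EuclideanSpace ℝ (Fin n))
    (hT : ∀ x, p (T x) ≤ ‖x‖)
    (hmax : ∀ T' : EuclideanSpace ℝ (Fin n) ≃ₗ[ℝ] EuclideanSpace ℝ (Fin n),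
      (∀ x, ‖x‖ ≤ 1 → p (T' x) ≤ 1) →
      volume (T' '' closedBall 0 1) ≤ volume (T '' closedBall 0 1))
    (G : ℝ) (hG : 0 ≤ G)
    (H : ∀ (N : ℕ) (x : Fin N → EuclideanSpace ℝ (Fin n)) (α : ℝ), 0 ≤ α →
      (∀ z, α * ‖z‖^2 = ∑ j, (inner ℝ (x j) z)^2) → ∑ j, p (x j)^2 ≤ (n * G^2) * α) :
    0 < G ∧ ∃ b : OrthonormalBasis (Fin n) ℝ (EuclideanSpace ℝ (Fin n)),
      ∑ i, ‖T.symm (b i)‖ ≤ n * G := by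
  have : Nonempty (Fin n) := ⟨⟨0, hn⟩⟩
  obtain ⟨b, q, hq1, hq2⟩ := aux_pietsch (n := n) (by simp) p hps (n * G^2) H
  have hqpos : ∀ i, 0 < q i := by
    intro i
    have h1 := hq2 (b i)
    have h2 := hpos (b i) (b.orthonormal.ne_zero i)
    rw [Finset.sum_eq_single i (by
      intro j _ hj; rw [b.inner_eq_zero hj]; simp) (by simp)] at h1
    simp at h1
    have : 0 < p (b i)^2 := by positivity
    linarith
  have hDpos : 0 < n * G^2 := by
    rw [← hq1]; exact Finset.sum_pos (fun i _ => hqpos i) Finset.univ_nonempty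
  have hGpos : 0 < G := by
    rcases hG.eq_or_lt with h | h
    · rw [← h] at hDpos; simp at hDpos
    · exact h
  refine ⟨hGpos, b, ?_⟩
  let w : EuclideanSpace ℝ (Fin n) →ₗ[ℝ] EuclideanSpace ℝ (Fin n) :=
    b.toBasis.constr ℝ (fun i => (√(q i))⁻¹ • b i)
  have hwb : ∀ i, w (b i) = (√(q i))⁻¹ • b i := by
    intro i
    have := b.toBasis.constr_basis ℝ (fun i => (√(q i))⁻¹ • b i) i
    rwa [OrthonormalBasis.coe_toBasis] at this
  have hwi : ∀ i x, inner ℝ (b i) (w x) = (√(q i))⁻¹ * inner ℝ (b i) x := by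
    intro i x
    conv_lhs => rw [← b.sum_repr' x]
    rw [map_sum, inner_sum, Finset.sum_eq_single i]
    · rw [map_smul, hwb, inner_smul_right, inner_smul_right]
      simp [mul_comm]
    · intro j _ hj
      rw [map_smul, hwb, inner_smul_right, inner_smul_right, b.inner_eq_zero hj.symm]; simp
    · simp
  have hw : ∀ x, p (w x) ≤ ‖x‖ := by
    intro x
    have h1 := hq2 (w x)
    have h2 : ∑ i, q i * (inner ℝ (b i) (w x))^2 = ‖x‖^2 := by
      rw [← b.sum_sq_norm_inner_right x]
      refine Finset.sum_congr rfl fun i _ => ?_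
      rw [hwi, mul_pow, inv_pow, Real.sq_sqrt (hqpos i).le, ← mul_assoc,
        mul_inv_cancel₀ (hqpos i).ne']
      simp
    rw [h2] at h1
    exact (pow_le_pow_iff_left₀ (hp0 _) (norm_nonneg _) two_ne_zero).1 h1
  have hj := aux_john p hps hadd T hT hmax ((T.symm : _ →ₗ[ℝ] _) ∘ₗ w)
    (fun x => by simpa using hw x) b
  have hj2 : ∑ i, ‖T.symm (b i)‖^2 / q i ≤ n := by
    refine le_trans (le_of_eq ?_) hj
    refine Finset.sum_congr rfl fun i _ => ?_
    simp only [LinearMap.comp_apply, hwb, map_smul, norm_smul, mul_pow, norm_inv, inv_pow,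
      LinearEquiv.coe_coe]
    rw [Real.norm_of_nonneg (Real.sqrt_nonneg _), Real.sq_sqrt (hqpos i).le]
    ring
  have hcs := Finset.sq_sum_div_le_sum_sq_div Finset.univ (fun i => ‖T.symm (b i)‖)
    (fun i _ => hqpos i)
  rw [hq1, div_le_iff₀ hDpos] at hcs
  have h5 : (∑ i, ‖T.symm (b i)‖)^2 ≤ (n * G)^2 := by
    refine hcs.trans ?_
    calc _ ≤ (n:ℝ) * (n * G^2) := by gcongr
      _ = _ := by ring
  exact (pow_le_pow_iff_left₀ (by positivity) (by positivity) two_ne_zero).1 h5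

lemma aux_select {n : ℕ} (hn : 0 < n) (a : Fin n → ℝ) (ha : ∀ i, 0 ≤ a i) (G : ℝ) (hG : 0 < G)
    (hsum : ∑ i, a i ≤ n * G) (ε : ℝ) (h0 : 0 < ε) (h1 : ε < 1) :
    ∃ I : Finset (Fin n), (1 - ε) * n ≤ (I.card : ℝ) ∧ 0 < I.card ∧
      (∑ i ∈ I, a i ^ 2) / I.card ≤ 4 * G^2 / ε := by
  classical
  set e := min ε (1/2) with he
  have he0 : 0 < e := by positivity
  have he1 : e ≤ ε := min_le_left _ _
  have he2 : e ≤ 1/2 := min_le_right _ _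
  have he3 : ε / 2 ≤ e := le_min (by linarith) (by linarith)
  have hn' : (0:ℝ) < n := by exact_mod_cast hn
  let I : Finset (Fin n) := Finset.univ.filter (fun i => a i ≤ G / e)
  have hcard : ((Iᶜ).card : ℝ) * (G / e) ≤ n * G := by
    refine le_trans ?_ hsum
    calc ((Iᶜ).card : ℝ) * (G / e) = ∑ i ∈ Iᶜ, G / e := by simp
      _ ≤ ∑ i ∈ Iᶜ, a i := Finset.sum_le_sum fun i hi => by
          simp [I] at hi; exact hi.le
      _ ≤ ∑ i, a i := Finset.sum_le_sum_of_subset_of_nonneg (Finset.subset_univ _)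
          (fun i _ _ => ha i)
  have hcard2 : ((Iᶜ).card : ℝ) ≤ e * n := by
    rw [← mul_div_assoc, div_le_iff₀ he0] at hcard
    exact le_of_mul_le_mul_right (by linarith) hG
  have hcard3 : (I.card : ℝ) = n - (Iᶜ).card := by
    have := Finset.card_add_card_compl I
    rw [Fintype.card_fin] at this
    have h : (I.card:ℝ) + (Iᶜ).card = n := by exact_mod_cast this
    linarith
  have hI : (1 - e) * n ≤ I.card := by rw [hcard3]; linarith
  have hI2 : (n:ℝ) / 2 ≤ I.card := by nlinarith
  have hI3 : (0:ℝ) < I.card := by linarith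
  refine ⟨I, by nlinarith, by exact_mod_cast hI3, ?_⟩
  rw [div_le_iff₀ hI3]
  have hs : ∑ i ∈ I, a i ^2 ≤ (G / e) * (n * G) := by
    calc ∑ i ∈ I, a i ^2 ≤ ∑ i ∈ I, (G / e) * a i := Finset.sum_le_sum fun i hi => by
          simp [I] at hi
          rw [sq]; exact mul_le_mul_of_nonneg_right hi (ha i)
      _ = (G / e) * ∑ i ∈ I, a i := by rw [Finset.mul_sum]
      _ ≤ (G / e) * (n * G) := by
          gcongr
          exact (Finset.sum_le_sum_of_subset_of_nonneg (Finset.subset_univ _)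
            (fun i _ _ => ha i)).trans hsum
  refine hs.trans ?_
  calc (G / e) * (n * G) ≤ (G / (ε/2)) * (n * G) := by gcongr
    _ = 4 * G^2 / ε * (n / 2) := by field_simp; ring
    _ ≤ _ := by gcongr

lemma aux_MvalSub {n : ℕ} (T : EuclideanSpace ℝ (Fin n) ≃ₗ[ℝ] EuclideanSpace ℝ (Fin n))
    (b : OrthonormalBasis (Fin n) ℝ (EuclideanSpace ℝ (Fin n))) (I : Finset (Fin n))
    (hI : 0 < I.card) :
    ∃ F : Submodule ℝ (EuclideanSpace ℝ (Fin n)), Module.finrank ℝ F = I.card ∧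
      MvalSub F (Subtype.val ⁻¹' (T '' closedBall 0 1)) =
        √((∑ i ∈ I, ‖T.symm (b i)‖^2) / I.card) := by
  classical
  let F : Submodule ℝ (EuclideanSpace ℝ (Fin n)) :=
    Submodule.span ℝ (I.image b : Set (EuclideanSpace ℝ (Fin n)))
  let c : OrthonormalBasis I ℝ F := OrthonormalBasis.span b.orthonormal I
  have hfr : Module.finrank ℝ F = I.card := by
    rw [Module.finrank_eq_card_basis c.toBasis]; simp
  refine ⟨F, hfr, ?_⟩
  have : Nontrivial F := Module.nontrivial_of_finrank_pos (R := ℝ) (by rw [hfr]; exact hI)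
  let A : F →ₗ[ℝ] EuclideanSpace ℝ (Fin n) := (T.symm : _ →ₗ[ℝ] _) ∘ₗ F.subtype
  have hset : (Subtype.val ⁻¹' (T '' closedBall 0 1) : Set F) = {x | ‖A x‖ ≤ 1} := by
    ext x
    simp only [mem_preimage, mem_image, mem_closedBall, dist_zero_right, mem_ofPred_eq, A,
      LinearMap.comp_apply, Submodule.subtype_apply, LinearEquiv.coe_coe]
    constructor
    · rintro ⟨y, hy, h⟩; rw [← h]; simpa using hy
    · intro h; exact ⟨_, h, by simp⟩
  have h1 := aux_avg (V := F) (fun x => ‖A x‖^2) (fun r hr x => by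
    simp only [map_smul, norm_smul, mul_pow, Real.norm_of_nonneg hr.le])
  rw [aux_HS c A, hfr] at h1
  have h2 : ∑ i, ‖A (c i)‖^2 = ∑ i ∈ I, ‖T.symm (b i)‖^2 := by
    rw [← Finset.sum_coe_sort I (fun i => ‖T.symm (b i)‖^2)]
    refine Finset.sum_congr rfl fun i _ => ?_
    have h3 : ((c i : F) : EuclideanSpace ℝ (Fin n)) = b i :=
      OrthonormalBasis.span_apply b.orthonormal I i
    simp [A, h3]
  have hI' : (I.card : ℝ) ≠ 0 := by positivity
  unfold MvalSub
  rw [hset]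
  simp_rw [aux_gauge_pre]
  rw [← h2, h1]
  congr 1
  field_simp

lemma aux_sInf_sq (S : Set ℝ) (hS : S.Nonempty) (h1 : ∀ l ∈ S, 1 ≤ l) (A B : ℝ) (hB : 0 ≤ B)
    (h : ∀ l ∈ S, A ≤ l^2 * B) : A ≤ (sInf S)^2 * B := by
  have hC : 1 ≤ sInf S := le_csInf hS h1
  have hk : √A ≤ sInf S * √B := by
    have hl : ∀ l ∈ S, √A ≤ l * √B := by
      intro l hl
      have := Real.sqrt_le_sqrt (h l hl)
      rwa [Real.sqrt_mul (by positivity), Real.sqrt_sq (by linarith [h1 l hl])] at this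
    rcases (Real.sqrt_nonneg B).eq_or_lt with h0 | h0
    · obtain ⟨l, hl'⟩ := hS
      have := hl l hl'
      rw [← h0] at this ⊢
      simpa using this
    · rw [← div_le_iff₀ h0]
      exact le_csInf hS fun l hl' => (div_le_iff₀ h0).2 (hl l hl')
  rw [← Real.sqrt_sq (by linarith : 0 ≤ sInf S), ← Real.sqrt_mul (by positivity)] at hk
  exact (Real.sqrt_le_sqrt_iff (by positivity)).1 hk

lemma aux_main {n : ℕ} (hn : 0 < n) (K E : Set (EuclideanSpace ℝ (Fin n)))
    (hK : IsSymmetricConvexBody K) (hE : IsMaxVolEllipsoidIn E K) (ε : ℝ) (h0 : 0 < ε)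
    (h1 : ε < 1) : 1 ≤ cotype2Const K ∧ ∃ F : Submodule ℝ (EuclideanSpace ℝ (Fin n)),
      (1 - ε) * (n : ℝ) ≤ (Module.finrank ℝ F : ℝ) ∧
      MvalSub F (Subtype.val ⁻¹' E) ≤ 2 * (cotype2Const K * Mval K) / √ε := by
  have : Nonempty (Fin n) := ⟨⟨0, hn⟩⟩
  obtain ⟨hps, hadd, hpc, hmem, ⟨β, hβ, hβ'⟩, ⟨a, ha, ha'⟩⟩ := aux_gauge hK
  have hp0 : ∀ x, 0 ≤ gauge K x := gauge_nonneg
  have hpos : ∀ x, x ≠ 0 → 0 < gauge K x := by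
    intro x hx
    have h2 := ha' x
    have h3 : 0 < ‖x‖ := norm_pos_iff.2 hx
    by_contra hc
    have : gauge K x = 0 := le_antisymm (not_lt.1 hc) (hp0 x)
    rw [this] at h2; linarith
  obtain ⟨⟨T, rfl⟩, hsub, hmx⟩ := hE
  set S : Set ℝ := {l : ℝ | 0 < l ∧ ∀ (m : ℕ) (x : Fin m → EuclideanSpace ℝ (Fin n)),
    (1 / l) * Real.sqrt (∑ j, gauge K (x j) ^ 2) ≤
      Real.sqrt ((∑ ε : Fin m → Bool,
        gauge K (∑ j, (if ε j then (1 : ℝ) else -1) • x j) ^ 2) / 2 ^ m)} with hS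
  have hCS : cotype2Const K = sInf S := rfl
  have hSn : S.Nonempty := ⟨β * a, by positivity,
    aux_cotype_nonempty (gauge K) hp0 a β ha hβ hβ' ha'⟩
  have hS1 : ∀ l ∈ S, 1 ≤ l := by
    rintro l ⟨hl, hl'⟩
    obtain ⟨v, hv⟩ := exists_ne (0 : EuclideanSpace ℝ (Fin n))
    have h2 := hl' 1 (fun _ => v)
    have h3 : ∀ e : Fin 1 → Bool,
        gauge K (∑ j, (if e j then (1 : ℝ) else -1) • v) ^ 2 = gauge K v ^ 2 := by
      intro e
      rw [Fin.sum_univ_one, hps]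
      split_ifs <;> simp
    simp only [h3] at h2
    simp only [Finset.sum_const, Finset.card_univ, Fintype.card_fun, Fintype.card_bool,
      Fintype.card_fin, Finset.univ_unique, Finset.card_singleton, one_smul, pow_one,
      nsmul_eq_mul, Nat.cast_ofNat] at h2
    rw [mul_div_cancel_left₀ _ two_ne_zero, Real.sqrt_sq (hp0 v), one_div,
      inv_mul_le_iff₀ hl] at h2
    exact le_of_mul_le_mul_right (by linarith) (hpos v hv)
  have hC : 1 ≤ cotype2Const K := le_csInf hSn hS1
  refine ⟨hC, ?_⟩
  have hM0 : 0 ≤ Mval K := Real.sqrt_nonneg _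
  have hint : ∫ y, gauge K y ^ 2 ∂(stdGaussian (EuclideanSpace ℝ (Fin n))) = n * Mval K ^ 2 := by
    have h2 := aux_avg (V := EuclideanSpace ℝ (Fin n)) (fun x => gauge K x ^ 2)
      (fun r hr x => by simp only [hps, mul_pow, abs_of_pos hr])
    rw [h2, finrank_euclideanSpace_fin]
    unfold Mval
    rw [Real.sq_sqrt]
    rw [average_eq]
    exact smul_nonneg (by positivity) (integral_nonneg fun x => by positivity)
  have hT : ∀ x, gauge K (T x) ≤ ‖x‖ := by
    intro x
    rcases eq_or_ne x 0 with rfl | hx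
    · simp
    have hx' : 0 < ‖x‖ := norm_pos_iff.2 hx
    have h2 : T (‖x‖⁻¹ • x) ∈ K := hsub ⟨_, by
      simp [norm_smul, hx'.ne'], rfl⟩
    rw [hmem, map_smul, hps, abs_of_pos (by positivity), inv_mul_le_iff₀ hx', mul_one] at h2
    exact h2
  obtain ⟨hG, b, hb⟩ := aux_basis hn (gauge K) hp0 hps hadd hpos T hT
    (fun T' hT' => hmx _ ⟨T', rfl⟩ (by
      rintro _ ⟨y, hy, rfl⟩
      exact (hmem _).2 (hT' y (by simpa using hy))))
    (cotype2Const K * Mval K) (by positivity) (by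
      intro N x α hα hx
      have h2 := aux_sInf_sq S hSn hS1 (∑ j, gauge K (x j)^2) (α * (n * Mval K ^ 2))
        (by positivity) (by
          rintro l ⟨hl, hl'⟩
          have := aux_cotype (gauge K) hp0 hpc hps β hβ' l hl (hl' N) x α hα hx
          rw [hint] at this
          linarith)
      rw [hCS]
      linarith)
  obtain ⟨I, hI1, hI2, hI3⟩ := aux_select hn (fun i => ‖T.symm (b i)‖) (fun i => norm_nonneg _)
    _ hG hb ε h0 h1
  obtain ⟨F, hF1, hF2⟩ := aux_MvalSub T b I hI2
  refine ⟨F, by rw [hF1]; exact hI1, ?_⟩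
  rw [hF2]
  refine (Real.sqrt_le_sqrt hI3).trans (le_of_eq ?_)
  rw [Real.sqrt_div (by positivity), show 4 * (cotype2Const K * Mval K)^2 =
    (2 * (cotype2Const K * Mval K))^2 by ring, Real.sqrt_sq (by positivity)]

end assembly

/-- Lemma 3.2: there is an absolute constant `c > 0` such that if `E` is the maximal
volume ellipsoid of a symmetric convex body `K` in `ℝ^n`, then for every `ε ∈ (0,1)`
there is a subspace `F` with `dim F ≥ (1-ε)n` and
`M_{E∩F} ≤ [c h(C_K) log(2/ε)/√ε] M_K`. -/
theorem Mvalue_section_maximal_ellipsoid_le_cotype :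
    ∃ c : ℝ, 0 < c ∧
      ∀ (n : ℕ) (K E : Set (EuclideanSpace ℝ (Fin n))),
        IsSymmetricConvexBody K → IsMaxVolEllipsoidIn E K →
        ∀ ε : ℝ, ε ∈ Set.Ioo (0 : ℝ) 1 →
          ∃ F : Submodule ℝ (EuclideanSpace ℝ (Fin n)),
            (1 - ε) * (n : ℝ) ≤ (Module.finrank ℝ F : ℝ) ∧
            MvalSub F (Subtype.val ⁻¹' E) ≤
              c * hfun (cotype2Const K) * Real.log (2 / ε) / Real.sqrt ε * Mval K := by
  refine ⟨8, by norm_num, ?_⟩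
  intro n K E hK hE ε hε
  obtain ⟨h0, h1⟩ := hε
  rcases Nat.eq_zero_or_pos n with rfl | hn
  · refine ⟨⊤, by simp, ?_⟩
    have e1 : IsEmpty (sphere (0 : (⊤ : Submodule ℝ (EuclideanSpace ℝ (Fin 0)))) 1) := by
      refine ⟨fun x => ?_⟩
      have h2 := x.2
      have h3 : (x : (⊤ : Submodule ℝ (EuclideanSpace ℝ (Fin 0)))) = 0 := Subsingleton.elim _ _
      rw [h3] at h2
      simp at h2
    have e2 : IsEmpty (sphere (0 : EuclideanSpace ℝ (Fin 0)) 1) := by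
      refine ⟨fun x => ?_⟩
      have h2 := x.2
      have h3 : (x : EuclideanSpace ℝ (Fin 0)) = 0 := Subsingleton.elim _ _
      rw [h3] at h2
      simp at h2
    have m1 : MvalSub (⊤ : Submodule ℝ (EuclideanSpace ℝ (Fin 0))) (Subtype.val ⁻¹' E) = 0 := by
      unfold MvalSub
      rw [Measure.eq_zero_of_isEmpty (Measure.toSphere _)]
      simp
    have m2 : Mval K = 0 := by
      unfold Mval
      rw [Measure.eq_zero_of_isEmpty (Measure.toSphere _)]
      simp
    rw [m1, m2]; simp
  · obtain ⟨hC, F, hF1, hF2⟩ := aux_main hn K E hK hE ε h0 h1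
    refine ⟨F, hF1, hF2.trans ?_⟩
    have hM0 : 0 ≤ Mval K := Real.sqrt_nonneg _
    have hs : 0 < √ε := Real.sqrt_pos.2 h0
    have hl2 : (1:ℝ)/2 ≤ Real.log 2 := by linarith [Real.log_two_gt_d9]
    have ha : (1:ℝ)/2 ≤ Real.log (2 * cotype2Const K) :=
      hl2.trans (Real.log_le_log (by norm_num) (by linarith))
    have hb : (1:ℝ)/2 ≤ Real.log (2 / ε) :=
      hl2.trans (Real.log_le_log (by norm_num) (by rw [le_div_iff₀ h0]; linarith))
    have hab : (1:ℝ)/4 ≤ Real.log (2 * cotype2Const K) * Real.log (2 / ε) := by nlinarith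
    have hCM : 0 ≤ cotype2Const K * Mval K := by positivity
    unfold hfun
    rw [div_mul_eq_mul_div]
    refine div_le_div_of_nonneg_right ?_ hs.le
    calc 2 * (cotype2Const K * Mval K) = 8 * (cotype2Const K * Mval K) * (1/4) := by ring
      _ ≤ 8 * (cotype2Const K * Mval K) *
          (Real.log (2 * cotype2Const K) * Real.log (2 / ε)) := by gcongr
      _ = _ := by ring
end
end
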